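/- For every j₀ ∈ ℚ, the explicit constant c(j₀) = 1/(80⁴⁶ · (209 + max{ log(1 + log H(j₀)), 255 + log(2 + log(1 + log H(j₀))) })) is admissible in the rank bound: for every elliptic curve E over ℚ with j-invariant equal to j₀, every integer N ≥ 1, and every sequence P₁,…,P_N of affine points of E(ℚ) whose x-coordinates form a non-trivial arithmetic progression, or whose y-coordinates form a non-trivial arithmetic progression, one has 1 + rank E(ℚ) ≥ c(j₀) · log N. -/

import Mathlib

open scoped TensorProduct

/-- The rank of an abelian group `G`, i.e. `dim_ℚ (G ⊗_ℤ ℚ)`. -/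
noncomputable def grpRank (G : Type*) [AddCommGroup G] : ℕ :=
  Module.finrank ℚ (ℚ ⊗[ℤ] G)

/-- `u 0, …, u (N-1)` is a non-trivial arithmetic progression. -/
def IsNontrivAP {F : Type*} [Field F] {N : ℕ} (u : Fin N → F) : Prop :=
  ∃ a b : F, b ≠ 0 ∧ ∀ i : Fin N, u i = a + (((i : ℕ) + 1 : ℕ) : F) * b

/-- The naive (multiplicative) height of a rational number: `H(a/b) = max {|a|, |b|}`
for coprime `a, b`. -/
noncomputable def naiveHeight (q : ℚ) : ℝ :=
  max |(q.num : ℝ)| (q.den : ℝ)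

/-- The explicit constant `c(j₀)` from the paper. -/
noncomputable def cConst (j₀ : ℚ) : ℝ :=
  1 / (80 ^ 46 *
    (209 + max (Real.log (1 + Real.log (naiveHeight j₀)))
      (255 + Real.log (2 + Real.log (1 + Real.log (naiveHeight j₀))))))


set_option linter.unusedSectionVars false
set_option linter.unusedVariables false
set_option linter.unusedSimpArgs false

namespace APR

open WeierstrassCurve

/-- The short Weierstrass curve `y² = x³ + A x + B`. -/
def SW {K : Type*} [CommRing K] (A B : K) : WeierstrassCurve K := ⟨0, 0, 0, A, B⟩

/-- Points on the short Weierstrass curve. -/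
abbrev Pt {K : Type*} [CommRing K] (A B : K) := (SW A B).toAffine.Point

section basics

variable {K : Type*} [Field K] {A B : K}

/-- The `x`-coordinate (zero at the origin). -/
def Xc : Pt A B → K
  | .zero => 0
  | .some x _ _ => x

/-- The `y`-coordinate (zero at the origin). -/
def Yc : Pt A B → K
  | .zero => 0
  | .some _ y _ => y

@[simp] lemma Xc_some {x y : K} (h : (SW A B).toAffine.Nonsingular x y) :
    Xc (Affine.Point.some x y h : Pt A B) = x := rfl
@[simp] lemma Yc_some {x y : K} (h : (SW A B).toAffine.Nonsingular x y) :
    Yc (Affine.Point.some x y h : Pt A B) = y := rfl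

lemma ne_zero_cases {P : Pt A B} (h : P ≠ 0) : ∃ x y, ∃ hh : (SW A B).toAffine.Nonsingular x y,
    P = .some x y hh := by
  cases P with
  | zero => exact absurd rfl h
  | some x y hh => exact ⟨x, y, hh, rfl⟩

lemma sw_eq {P : Pt A B} (h : P ≠ 0) : Yc P ^ 2 = Xc P ^ 3 + A * Xc P + B := by
  obtain ⟨x, y, hh, rfl⟩ := ne_zero_cases h
  have := (Affine.equation_iff _ _).1 hh.1
  rw [Xc_some, Yc_some]
  simpa [SW] using this

lemma pt_ext {P Q : Pt A B} (hP : P ≠ 0) (hQ : Q ≠ 0) (hx : Xc P = Xc Q) (hy : Yc P = Yc Q) :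
    P = Q := by
  obtain ⟨x, y, hh, rfl⟩ := ne_zero_cases hP
  obtain ⟨x', y', hh', rfl⟩ := ne_zero_cases hQ
  simp at hx hy
  subst hx hy; rfl

lemma exists_pt [(SW A B).IsElliptic] {x y : K} (h : y ^ 2 = x ^ 3 + A * x + B) :
    ∃ P : Pt A B, P ≠ 0 ∧ Xc P = x ∧ Yc P = y := by
  have h1 : (SW A B).toAffine.Equation x y := by
    rw [Affine.equation_iff]; simpa [SW] using h
  exact ⟨.some x y (Affine.equation_iff_nonsingular.1 h1), Affine.Point.some_ne_zero _, rfl, rfl⟩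

lemma Xc_neg (P : Pt A B) : Xc (-P) = Xc P := by
  cases P <;> rfl

lemma Yc_neg (P : Pt A B) : Yc (-P) = - Yc P := by
  cases P with
  | zero => simp [Yc, ← Affine.Point.zero_def]
  | some x y h => rw [Affine.Point.neg_some, Yc_some, Yc_some]; simp [Affine.negY, SW]

lemma Xc_zero : Xc (0 : Pt A B) = 0 := rfl
lemma Yc_zero : Yc (0 : Pt A B) = 0 := rfl

variable [DecidableEq K]

lemma X_eq {P Q : Pt A B} (hP : P ≠ 0) (hQ : Q ≠ 0) (hx : Xc P = Xc Q) : P = Q ∨ P = -Q := by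
  have h1 := sw_eq hP
  have h2 := sw_eq hQ
  rw [hx, ← h2, sq_eq_sq_iff_eq_or_eq_neg] at h1
  rcases h1 with h1 | h1
  · left; exact pt_ext hP hQ hx h1
  · right; exact pt_ext hP (by simpa using hQ) (by rw [hx, Xc_neg]) (by rw [h1, Yc_neg])

lemma add_formula {P Q : Pt A B} (hP : P ≠ 0) (hQ : Q ≠ 0) (hx : Xc P ≠ Xc Q) :
    P + Q ≠ 0 ∧ Xc (P + Q) = ((Yc P - Yc Q) / (Xc P - Xc Q)) ^ 2 - Xc P - Xc Q ∧
    Yc (P + Q) = - (Yc P + (Yc P - Yc Q) / (Xc P - Xc Q) * (Xc (P + Q) - Xc P)) := by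
  obtain ⟨x, y, hh, rfl⟩ := ne_zero_cases hP
  obtain ⟨x', y', hh', rfl⟩ := ne_zero_cases hQ
  simp only [Xc_some, Yc_some] at hx ⊢
  rw [Affine.Point.add_of_X_ne hx]
  refine ⟨Affine.Point.some_ne_zero _, ?_, ?_⟩
  · simp only [Xc_some, Affine.addX, Affine.slope_of_X_ne hx]; simp [SW]
  · simp only [Xc_some, Yc_some, Affine.addY, Affine.negY, Affine.negAddY, Affine.slope_of_X_ne hx]
    simp [SW]; ring

lemma sub_formula {P Q : Pt A B} (hP : P ≠ 0) (hQ : Q ≠ 0) (hx : Xc P ≠ Xc Q) :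
    P - Q ≠ 0 ∧ Xc (P - Q) = ((Yc P + Yc Q) / (Xc P - Xc Q)) ^ 2 - Xc P - Xc Q := by
  have hQ' : -Q ≠ 0 := by simpa using hQ
  have := add_formula hP hQ' (by rwa [Xc_neg])
  rw [sub_eq_add_neg]
  refine ⟨this.1, ?_⟩
  rw [this.2.1, Xc_neg, Yc_neg]; ring

lemma dbl_zero {P : Pt A B} (hy : Yc P = 0) : P + P = 0 := by
  by_cases hP : P = 0
  · simp [hP]
  have h : P = -P := pt_ext hP (by simpa using hP) (by rw [Xc_neg]) (by rw [Yc_neg, hy, neg_zero])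
  nth_rewrite 2 [h]; simp

variable [CharZero K]

lemma dbl_formula {P : Pt A B} (hP : P ≠ 0) (hy : Yc P ≠ 0) :
    P + P ≠ 0 ∧ Xc (P + P) = ((3 * Xc P ^ 2 + A) / (2 * Yc P)) ^ 2 - 2 * Xc P ∧
    Yc (P + P) = - (Yc P + (3 * Xc P ^ 2 + A) / (2 * Yc P) * (Xc (P + P) - Xc P)) := by
  obtain ⟨x, y, hh, rfl⟩ := ne_zero_cases hP
  simp only [Xc_some, Yc_some] at hy ⊢
  have h1 : y ≠ (SW A B).toAffine.negY x y := by
    simp only [Affine.negY, SW]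
    intro h
    apply hy
    have : 2 * y = 0 := by linear_combination h
    simpa using this
  rw [Affine.Point.add_of_Y_ne h1]
  have h2 : (SW A B).toAffine.slope x x y y = (3 * x ^ 2 + A) / (2 * y) := by
    rw [Affine.slope_of_Y_ne rfl h1]; simp [SW, Affine.negY]; ring
  refine ⟨Affine.Point.some_ne_zero _, ?_, ?_⟩
  · simp only [Xc_some, Affine.addX, h2]; simp [SW]; ring
  · simp only [Xc_some, Yc_some, Affine.addY, Affine.negY, Affine.negAddY, h2]
    simp [SW]; ring

lemma dbl_eq_zero_iff {P : Pt A B} (hP : P ≠ 0) : P + P = 0 ↔ Yc P = 0 :=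
  ⟨fun h => by by_contra h1; exact (dbl_formula hP h1).1 h, dbl_zero⟩

end basics

section transfer

variable {F K : Type*} [Field F] [Field K] [DecidableEq F] [DecidableEq K] [CharZero F] [CharZero K]
  (W : WeierstrassCurve F) (f : F →+* K) (u A B : K)

/-- transfer of points to a short model -/
noncomputable def tr [(SW A B).IsElliptic] (hu : u ≠ 0) (hA : f (-W.c₄ / 48) = u ^ 4 * A)
    (hB : f (-W.c₆ / 864) = u ^ 6 * B) : W.toAffine.Point → Pt A B
  | .zero => 0
  | .some x y h => .some (f (x + W.b₂ / 12) / u ^ 2) (f (y + (W.a₁ * x + W.a₃) / 2) / u ^ 3) (by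
      have h1 := (Affine.equation_iff _ _).1 h.1
      rw [← Affine.equation_iff_nonsingular, Affine.equation_iff]
      simp only [SW, zero_mul, add_zero]
      have h2 : f ((y + (W.a₁ * x + W.a₃) / 2) ^ 2) =
        f ((x + W.b₂ / 12) ^ 3 + (-W.c₄ / 48) * (x + W.b₂ / 12) + (-W.c₆ / 864)) := by
        congr 1
        rw [c₄, c₆, b₂, b₄, b₆]
        linear_combination h1
      rw [map_add, map_add, map_mul, hA, hB, map_pow, map_pow] at h2
      rw [div_pow, h2]
      field_simp)

variable {W f u A B}
variable [(SW A B).IsElliptic] (hu : u ≠ 0) (hA : f (-W.c₄ / 48) = u ^ 4 * A)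
    (hB : f (-W.c₆ / 864) = u ^ 6 * B)

lemma tr_zero : tr W f u A B hu hA hB 0 = 0 := rfl

lemma tr_some_ne {x y : F} (h : W.toAffine.Nonsingular x y) :
    tr W f u A B hu hA hB (.some x y h) ≠ 0 := Affine.Point.some_ne_zero _

lemma Xc_tr {x y : F} (h : W.toAffine.Nonsingular x y) :
    Xc (tr W f u A B hu hA hB (.some x y h)) = f (x + W.b₂ / 12) / u ^ 2 := rfl

lemma Yc_tr {x y : F} (h : W.toAffine.Nonsingular x y) :
    Yc (tr W f u A B hu hA hB (.some x y h)) = f (y + (W.a₁ * x + W.a₃) / 2) / u ^ 3 := rfl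

lemma tr_injective : Function.Injective (tr W f u A B hu hA hB) := by
  intro P Q h
  cases P with
  | zero =>
    cases Q with
    | zero => rfl
    | some x y hQ => exact absurd h.symm (tr_some_ne hu hA hB hQ)
  | some x y hP =>
    cases Q with
    | zero => exact absurd h (tr_some_ne hu hA hB hP)
    | some x' y' hQ =>
      have hx := congrArg Xc h
      have hy := congrArg Yc h
      rw [Xc_tr, Xc_tr, div_left_inj' (pow_ne_zero _ hu)] at hx
      rw [Yc_tr, Yc_tr, div_left_inj' (pow_ne_zero _ hu)] at hy
      have hx := f.injective hx
      have hy := f.injective hy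
      have : x = x' := by linear_combination hx
      subst this
      have : y = y' := by linear_combination hy
      subst this
      rfl

lemma tr_add_core {x₁ y₁ x₂ y₂ : F} (h₁ : W.toAffine.Nonsingular x₁ y₁)
    (h₂ : W.toAffine.Nonsingular x₂ y₂) (hxy : ¬(x₁ = x₂ ∧ y₁ = W.toAffine.negY x₂ y₂))
    {P Q : Pt A B} (hP : P = tr W f u A B hu hA hB (.some x₁ y₁ h₁))
    (hQ : Q = tr W f u A B hu hA hB (.some x₂ y₂ h₂)) (ℓ : K)
    (hℓ : ℓ = (f (W.toAffine.slope x₁ x₂ y₁ y₂) + f W.a₁ / 2) / u) (h0 : P + Q ≠ 0)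
    (hX : Xc (P + Q) = ℓ ^ 2 - Xc P - Xc Q) (hY : Yc (P + Q) = -(Yc P + ℓ * (Xc (P + Q) - Xc P))) :
    tr W f u A B hu hA hB (.some x₁ y₁ h₁ + .some x₂ y₂ h₂) = P + Q := by
  have hX' : Xc (P + Q) = f (W.toAffine.addX x₁ x₂ (W.toAffine.slope x₁ x₂ y₁ y₂) + W.b₂ / 12)
      / u ^ 2 := by
    rw [hX, hℓ, hP, hQ, Xc_tr, Xc_tr, Affine.addX, b₂]
    simp only [map_add, map_sub, map_mul, map_pow, map_div₀, map_ofNat]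
    field_simp
    ring
  rw [Affine.Point.add_some hxy]
  refine pt_ext (tr_some_ne hu hA hB _) h0 ?_ ?_
  · rw [Xc_tr, hX']
  · rw [Yc_tr, hY, hX', hℓ, hP, Xc_tr, Yc_tr, Affine.addY, Affine.negAddY, Affine.negY]
    simp only [map_add, map_sub, map_mul, map_div₀, map_neg, map_ofNat]
    field_simp
    ring

/-- transfer as a group homomorphism -/
noncomputable def trHom : W.toAffine.Point →+ Pt A B where
  toFun := tr W f u A B hu hA hB
  map_zero' := rfl
  map_add' P Q := by
    rcases P with _ | ⟨x₁, y₁, h₁⟩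
    · rw [← Affine.Point.zero_def, tr_zero, zero_add, zero_add]
    rcases Q with _ | ⟨x₂, y₂, h₂⟩
    · rw [← Affine.Point.zero_def, tr_zero, add_zero, add_zero]
    by_cases hxy : x₁ = x₂ ∧ y₁ = W.toAffine.negY x₂ y₂
    · rw [Affine.Point.add_of_Y_eq hxy.1 hxy.2, tr_zero, eq_comm, add_eq_zero_iff_eq_neg]
      refine pt_ext (tr_some_ne hu hA hB _) (by simpa using tr_some_ne hu hA hB h₂) ?_ ?_
      · rw [Xc_neg, Xc_tr, Xc_tr, hxy.1]
      · rw [Yc_neg, Yc_tr, Yc_tr, hxy.1, hxy.2, ← neg_div, ← map_neg, Affine.negY]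
        congr 2; ring
    · by_cases hx : x₁ = x₂
      · subst hx
        have hy0 : y₁ ≠ W.toAffine.negY x₁ y₂ := fun h => hxy ⟨rfl, h⟩
        have hy : y₁ = y₂ := Affine.Y_eq_of_Y_ne h₁.1 h₂.1 rfl hy0
        subst hy
        have hY : Yc (tr W f u A B hu hA hB (.some x₁ y₁ h₁)) ≠ 0 := by
          rw [Yc_tr]
          refine div_ne_zero ?_ (pow_ne_zero _ hu)
          rw [Ne, map_eq_zero]
          intro h
          apply hy0
          rw [Affine.negY]
          linear_combination 2 * h
        obtain ⟨g1, g2, g3⟩ := dbl_formula (tr_some_ne hu hA hB h₁) hY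
        refine tr_add_core hu hA hB h₁ h₂ hxy rfl rfl _ ?_ g1 (by rw [g2]; ring) g3
        rw [Affine.slope_of_Y_ne rfl hy0, Xc_tr, Yc_tr]
        have h5 : f (y₁ + (W.a₁ * x₁ + W.a₃) / 2) ≠ 0 := fun h => hY (by rw [Yc_tr, h, zero_div])
        have h6 : y₁ - W.toAffine.negY x₁ y₁ = 2 * (y₁ + (W.a₁ * x₁ + W.a₃) / 2) := by
          rw [Affine.negY]; ring
        have hA' : A = f (-W.c₄ / 48) / u ^ 4 := by rw [hA]; field_simp
        rw [h6, hA', c₄, b₄, b₂, map_div₀ f _ (2 * (y₁ + (W.a₁ * x₁ + W.a₃) / 2)), map_mul f 2, map_ofNat]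
        generalize hz : y₁ + (W.a₁ * x₁ + W.a₃) / 2 = z at *
        have hz' : y₁ = z - (W.a₁ * x₁ + W.a₃) / 2 := by linear_combination hz
        rw [hz']
        simp only [map_add, map_sub, map_mul, map_pow, map_div₀, map_ofNat, map_neg]
        field_simp
        ring
      · have hX : Xc (tr W f u A B hu hA hB (.some x₁ y₁ h₁)) ≠
            Xc (tr W f u A B hu hA hB (.some x₂ y₂ h₂)) := by
          rw [Xc_tr, Xc_tr, Ne, div_left_inj' (pow_ne_zero _ hu)]
          intro h
          exact hx (by linear_combination f.injective h)
        obtain ⟨g1, g2, g3⟩ := add_formula (tr_some_ne hu hA hB h₁) (tr_some_ne hu hA hB h₂) hX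
        refine tr_add_core hu hA hB h₁ h₂ hxy rfl rfl _ ?_ g1 g2 g3
        rw [Affine.slope_of_X_ne hx, Xc_tr, Xc_tr, Yc_tr, Yc_tr, ← sub_div, ← sub_div, ← map_sub,
          ← map_sub]
        have h5 : f (x₁ - x₂) ≠ 0 := by rw [Ne, map_eq_zero]; exact sub_ne_zero.2 hx
        rw [show x₁ + W.b₂ / 12 - (x₂ + W.b₂ / 12) = x₁ - x₂ by ring,
          show y₁ + (W.a₁ * x₁ + W.a₃) / 2 - (y₂ + (W.a₁ * x₂ + W.a₃) / 2)
            = (y₁ - y₂) + W.a₁ / 2 * (x₁ - x₂) by ring, map_div₀ f (y₁ - y₂), map_add,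
          map_mul f (W.a₁ / 2), map_div₀, map_ofNat]
        field_simp

end transfer
end APR

set_option linter.unusedSectionVars false
set_option linter.unusedVariables false
set_option linter.unusedSimpArgs false

namespace APR
open WeierstrassCurve Height

section parallelogram

variable {K : Type*} [Field K] {A B : K} [DecidableEq K] [CharZero K]

lemma xRep_ne {P : Pt A B} (h : P ≠ 0) : P.xRep = ![Xc P, 1] := by
  obtain ⟨x, y, hh, rfl⟩ := ne_zero_cases h
  rfl

/-- evaluated form of `addSubMap` for short curves -/
lemma addSub_eval (s t u : K) : (fun i ↦ (addSubMap (SW A B) i).eval ![s, t, u]) =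
    ![s ^ 2 - 2 * A * s * u - 4 * B * t * u + A ^ 2 * u ^ 2,
      2 * t * s + 2 * A * t * u + 4 * B * u ^ 2, t ^ 2 - 4 * s * u] := by
  ext i
  fin_cases i <;> simp [addSubMap, SW, b₂, b₄, b₆, b₈]

lemma sym2x_mk {P Q : Pt A B} (hP : P ≠ 0) (hQ : Q ≠ 0) :
    P.sym2x Q = ![Xc P * Xc Q, Xc P + Xc Q, 1] := by
  simp [Affine.Point.sym2x, xRep_ne hP, xRep_ne hQ]

lemma sym2x_mk0 {P : Pt A B} (hP : P ≠ 0)  :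
    P.sym2x 0 = ![Xc P, 1, 0] := by
  simp [Affine.Point.sym2x, xRep_ne hP]

lemma sym2x_0mk {P : Pt A B} (hP : P ≠ 0)  :
    (0 : Pt A B).sym2x P = ![Xc P, 1, 0] := by
  simp [Affine.Point.sym2x, xRep_ne hP]

lemma addSub_dbl (P : Pt A B) (hP : P ≠ 0) : ∃ c : K, c ≠ 0 ∧
    (fun i ↦ (addSubMap (SW A B) i).eval (P.sym2x P)) = c • (P + P).sym2x 0 := by
  rw [sym2x_mk hP hP, addSub_eval]
  have e := sw_eq hP
  by_cases hy : Yc P = 0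
  · rw [dbl_zero hy, Affine.Point.sym2x_zero_zero]
    rw [hy] at e
    refine ⟨(3 * Xc P ^ 2 + A) ^ 2, ?_, ?_⟩
    · have hns : (SW A B).toAffine.Nonsingular (Xc P) (Yc P) := by
        obtain ⟨x, y, hh, rfl⟩ := ne_zero_cases hP; exact hh
      rw [Affine.nonsingular_iff] at hns
      obtain ⟨_, h | h⟩ := hns
      · simp [SW] at h
        apply pow_ne_zero
        intro h'; exact h h'.symm
      · simp [SW, hy] at h
    · ext i
      fin_cases i
      · simp
        linear_combination (8 * Xc P) * e
      · simp
        linear_combination (-4) * e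
      · simp; ring
  · obtain ⟨g1, g2, g3⟩ := dbl_formula hP hy
    rw [sym2x_mk0 g1, g2]
    refine ⟨4 * Yc P ^ 2, by simpa using hy, ?_⟩
    ext i
    fin_cases i
    · simp
      field_simp
      linear_combination (32 * Xc P) * e
    · simp
      linear_combination (-4) * e
    · simp; ring

lemma addSub_prop (P Q : Pt A B) : ∃ c : K, c ≠ 0 ∧
    (fun i ↦ (addSubMap (SW A B) i).eval (P.sym2x Q)) = c • (P + Q).sym2x (P - Q) := by
  by_cases hP : P = 0
  · subst hP
    rw [zero_add, zero_sub, Affine.Point.sym2x_neg_right]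
    refine ⟨1, one_ne_zero, ?_⟩
    by_cases hQ : Q = 0
    · subst hQ
      rw [Affine.Point.sym2x_zero_zero, addSub_eval]; ext i; fin_cases i <;> simp
    · rw [sym2x_0mk hQ, addSub_eval, sym2x_mk hQ hQ]; ext i; fin_cases i <;> simp <;> ring
  by_cases hQ : Q = 0
  · subst hQ
    refine ⟨1, one_ne_zero, ?_⟩
    rw [add_zero, sub_zero, sym2x_mk0 hP, addSub_eval, sym2x_mk hP hP]
    ext i; fin_cases i <;> simp <;> ring
  by_cases hx : Xc P = Xc Q
  · rcases X_eq hP hQ hx with rfl | rfl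
    · rw [sub_self]; exact addSub_dbl P hP
    · rw [neg_add_cancel, Affine.Point.sym2x_neg_left, Affine.Point.sym2x_comm 0]
      rw [show -Q - Q = -(Q + Q) by abel, Affine.Point.sym2x_neg_left]
      exact addSub_dbl Q hQ
  obtain ⟨g1, g2, -⟩ := add_formula hP hQ hx
  obtain ⟨k1, k2⟩ := sub_formula hP hQ hx
  rw [sym2x_mk hP hQ, sym2x_mk g1 k1, g2, k2, addSub_eval]
  have hx' := sub_ne_zero.2 hx
  have e1 := sw_eq hP
  have e2 := sw_eq hQ
  refine ⟨(Xc P - Xc Q) ^ 2, pow_ne_zero _ hx', ?_⟩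
  ext i
  fin_cases i
  · simp
    field_simp
    generalize Xc P = x at *
    generalize Yc P = y at *
    generalize Xc Q = a at *
    generalize Yc Q = b at *
    have hB : B = y ^ 2 - x ^ 3 - A * x := by linear_combination -e1
    have hb2 : b ^ 2 = a ^ 3 + A * a + (y ^ 2 - x ^ 3 - A * x) := by rw [← hB, e2]
    rw [hB]
    have : (y - b) ^ 2 = y ^ 2 - 2 * y * b + b ^ 2 := by ring
    rw [this]
    have : (y + b) ^ 2 = y ^ 2 + 2 * y * b + b ^ 2 := by ring
    rw [this, hb2]
    linear_combination (4 * y ^ 2) * hb2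
  · simp
    field_simp
    linear_combination (-2) * e1 - 2 * e2
  · simp; ring

variable [AdmissibleAbsValues K]

/-- naive height on points -/
noncomputable def nh (P : Pt A B) : ℝ := logHeight₁ (Xc P)

lemma nh_eq (P : Pt A B) : nh P = logHeight P.xRep := by
  by_cases h : P = 0
  · subst h
    rw [nh, Xc_zero, logHeight₁_zero, Affine.Point.xRep_zero, logHeight_swap,
      ← logHeight₁_eq_logHeight, logHeight₁_zero]
  · rw [nh, xRep_ne h, logHeight₁_eq_logHeight]

lemma nh_parallelogram [(SW A B).IsElliptic] : ∃ C : ℝ, ∀ P Q : Pt A B,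
    |nh (P + Q) + nh (P - Q) - 2 * (nh P + nh Q)| ≤ C := by
  obtain ⟨C₁, h₁⟩ := abs_logHeight_addSubMap_sub_two_mul_logHeight_le (SW A B)
  obtain ⟨C₂, h₂⟩ := abs_logHeight_sym2_sub_le K
  have h₂' : ∀ P Q : Pt A B, |logHeight (P.sym2x Q) - (nh P + nh Q)| ≤ C₂ := by
    intro P Q
    have e : ∀ R : Pt A B, R.xRep = ![R.xRep 0, R.xRep 1] := by
      intro R; ext i; fin_cases i <;> rfl
    have := @h₂ (P.xRep 0) (P.xRep 1) (Q.xRep 0) (Q.xRep 1)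
      (by rw [← e]; exact P.xRep_ne_zero) (by rw [← e]; exact Q.xRep_ne_zero)
    rw [← e, ← e, ← nh_eq, ← nh_eq] at this
    exact this
  refine ⟨C₂ + C₁ + 2 * C₂, fun P Q => ?_⟩
  obtain ⟨c, hc, h⟩ := addSub_prop P Q
  have a1 := h₁ (P.sym2x Q)
  rw [h, logHeight_smul_eq_logHeight _ hc] at a1
  have a2 := h₂' P Q
  have a3 := h₂' (P + Q) (P - Q)
  rw [abs_le] at *
  constructor <;> linarith [a1.1, a1.2, a2.1, a2.2, a3.1, a3.2]

end parallelogram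
end APR

set_option linter.unusedSectionVars false
set_option linter.unusedVariables false
set_option linter.unusedSimpArgs false
namespace APR
open IsDedekindDomain NumberField

/-- finite colouring refining a relation on a set -/
def FC {X : Type*} (T : Set X) (R : X → X → Prop) : Prop :=
  ∃ (n : ℕ) (c : X → Fin n), ∀ a ∈ T, ∀ b ∈ T, c a = c b → R a b

lemma FC.of {X ι : Type*} [Finite ι] {T : Set X} {R : X → X → Prop} (c : X → ι)
    (h : ∀ a ∈ T, ∀ b ∈ T, c a = c b → R a b) : FC T R :=
  ⟨Nat.card ι, fun x => Finite.equivFin ι (c x),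
    fun a ha b hb hc => h a ha b hb ((Finite.equivFin ι).injective hc)⟩

lemma FC.refine {X : Type*} {T : Set X} {R R' : X → X → Prop} (h : FC T R)
    (h' : ∀ a0 ∈ T, FC {a | a ∈ T ∧ R a0 a} R') : FC T R' := by
  classical
  obtain ⟨n, c, hc⟩ := h
  have H : ∀ i : Fin n, ∃ m : ℕ, ∃ d : X → Fin m, ∀ a ∈ T, ∀ b ∈ T, c a = i → c b = i →
      d a = d b → R' a b := by
    intro i
    by_cases hi : ∃ a0 ∈ T, c a0 = i
    · obtain ⟨a0, ha0, h0⟩ := hi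
      obtain ⟨m, d, hd⟩ := h' a0 ha0
      exact ⟨m, d, fun a ha b hb hai hbi hab => hd a ⟨ha, hc a0 ha0 a ha (h0.trans hai.symm)⟩ b
        ⟨hb, hc a0 ha0 b hb (h0.trans hbi.symm)⟩ hab⟩
    · exact ⟨1, fun _ => 0, fun a ha b hb hai => absurd ⟨a, ha, hai⟩ hi⟩
  choose m d hd using H
  refine FC.of (ι := Σ i : Fin n, Fin (m i)) (fun a => ⟨c a, d (c a) a⟩) ?_
  intro a ha b hb hab
  have h1 : c a = c b := congrArg Sigma.fst hab
  have h2 : d (c a) a = d (c a) b := by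
    rw [Sigma.mk.injEq] at hab
    have := hab.2
    rw [← h1] at this
    exact eq_of_heq this
  exact hd (c a) a ha b hb rfl h1.symm h2

lemma FC.mono {X : Type*} {T T' : Set X} {R R' : X → X → Prop} (h : FC T R)
    (hT : T' ⊆ T) (hR : ∀ a ∈ T', ∀ b ∈ T', R a b → R' a b) : FC T' R' := by
  obtain ⟨n, c, hc⟩ := h
  exact ⟨n, c, fun a ha b hb hab => hR a ha b hb (hc a (hT ha) b (hT hb) hab)⟩

lemma FC.comap {X Y : Type*} {T : Set X} {R : X → X → Prop} (h : FC T R) (f : Y → X) :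
    FC (f ⁻¹' T) (fun a b => R (f a) (f b)) := by
  obtain ⟨n, c, hc⟩ := h
  exact ⟨n, c ∘ f, fun a ha b hb hab => hc _ ha _ hb hab⟩

lemma FC.and {X : Type*} {T : Set X} {R R' : X → X → Prop} (h : FC T R) (h' : FC T R') :
    FC T (fun a b => R a b ∧ R' a b) := by
  obtain ⟨n, c, hc⟩ := h
  obtain ⟨m, d, hd⟩ := h'
  refine FC.of (fun x => (c x, d x)) fun a ha b hb hab => ?_
  rw [Prod.mk.injEq] at hab
  exact ⟨hc a ha b hb hab.1, hd a ha b hb hab.2⟩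

lemma FC.union {X : Type*} {T T' : Set X} {R : X → X → Prop} (h : FC T R) (h' : FC T' R) :
    FC (T ∪ T') R := by
  classical
  obtain ⟨n, c, hc⟩ := h
  obtain ⟨m, d, hd⟩ := h'
  refine FC.of (ι := Fin n ⊕ Fin m) (fun x => if x ∈ T then .inl (c x) else .inr (d x)) ?_
  intro a ha b hb hab
  by_cases h1 : a ∈ T <;> by_cases h2 : b ∈ T <;> simp [h1, h2] at hab
  · exact hc a h1 b h2 hab
  · exact hd a (ha.resolve_left h1) b (hb.resolve_left h2) hab

lemma FC.finite {X : Type*} {T : Set X} {R : X → X → Prop} (hT : T.Finite) (hR : ∀ a, R a a) :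
    FC T R := by
  classical
  have := hT.to_subtype
  refine FC.of (ι := Option T) (fun x => if h : x ∈ T then some ⟨x, h⟩ else none) ?_
  intro a ha b hb hab
  simp only [ha, hb, dif_pos, Option.some.injEq, Subtype.mk.injEq] at hab
  exact hab ▸ hR a

section NF
variable {K : Type*} [Field K] [NumberField K]

/-- v-adic order -/
noncomputable def ordv (v : HeightOneSpectrum (𝓞 K)) (a : 𝓞 K) : ℕ :=
  (Associates.mk v.asIdeal).count (Associates.mk (Ideal.span {a} : Ideal (𝓞 K))).factors

lemma ordv_mul (v : HeightOneSpectrum (𝓞 K)) {a b : 𝓞 K} (ha : a ≠ 0) (hb : b ≠ 0) :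
    ordv v (a * b) = ordv v a + ordv v b := by
  have h1 := v.intValuation_if_neg ha
  have h2 := v.intValuation_if_neg hb
  have h3 := v.intValuation_if_neg (mul_ne_zero ha hb)
  rw [map_mul, h1, h2, ← WithZero.exp_add, WithZero.exp_inj] at h3
  unfold ordv
  omega

lemma even_ordv (v : HeightOneSpectrum (𝓞 K)) {a : 𝓞 K} (ha : a ≠ 0)
    (h : IsSquare (v.valuation K (algebraMap (𝓞 K) K a))) : Even (ordv v a) := by
  rw [v.valuation_of_algebraMap, v.intValuation_if_neg ha] at h
  obtain ⟨r, hr⟩ := h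
  have hr0 : r ≠ 0 := by
    rintro rfl
    simp at hr
  obtain ⟨n, rfl⟩ : ∃ n : ℤ, r = WithZero.exp n := ⟨WithZero.log r, (WithZero.exp_log hr0).symm⟩
  rw [← WithZero.exp_add, WithZero.exp_inj] at hr
  have h2 : Even ((ordv v a : ℕ) : ℤ) := ⟨-n, by unfold ordv; omega⟩
  exact_mod_cast h2

lemma exists_sq_ideal {a : 𝓞 K} (ha : a ≠ 0) (h : ∀ v : HeightOneSpectrum (𝓞 K), Even (ordv v a)) :
    ∃ J : Ideal (𝓞 K), J ≠ 0 ∧ Ideal.span {a} = J ^ 2 := by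
  classical
  have hs : (Ideal.span {a} : Ideal (𝓞 K)) ≠ 0 := by simpa using ha
  have := Associates.is_pow_of_dvd_count (a := Associates.mk (Ideal.span {a} : Ideal (𝓞 K)))
    (k := 2) (by simpa using ha) ?_
  · obtain ⟨b, hb⟩ := this
    obtain ⟨J, rfl⟩ := Associates.mk_surjective b
    rw [← Associates.mk_pow, Associates.mk_eq_mk_iff_associated, associated_iff_eq] at hb
    refine ⟨J, ?_, hb⟩
    rintro rfl
    exact hs (by rw [hb]; simp)
  · intro p hp
    obtain ⟨I, rfl⟩ := Associates.mk_surjective p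
    rw [Associates.irreducible_mk] at hp
    have hI : Prime I := hp.prime
    let v : HeightOneSpectrum (𝓞 K) := ⟨I, Ideal.isPrime_of_prime hI, hI.ne_zero⟩
    exact (h v).two_dvd

lemma fc_int (S : Set (HeightOneSpectrum (𝓞 K))) (hS : S.Finite) :
    FC {a : 𝓞 K | a ≠ 0 ∧ ∀ v ∉ S, Even (ordv v a)}
      (fun a b => IsSquare (algebraMap (𝓞 K) K a * algebraMap (𝓞 K) K b)) := by
  classical
  have := hS.to_subtype
  have s1 : FC {a : 𝓞 K | a ≠ 0 ∧ ∀ v ∉ S, Even (ordv v a)}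
      (fun a b => ∃ J : Ideal (𝓞 K), J ≠ 0 ∧ Ideal.span {a * b} = J ^ 2) := by
    refine FC.of (ι := S → Prop) (fun a v => Even (ordv v.1 a)) ?_
    rintro a ⟨ha, ha'⟩ b ⟨hb, hb'⟩ hab
    apply exists_sq_ideal (mul_ne_zero ha hb)
    intro v
    rw [ordv_mul v ha hb, Nat.even_add]
    by_cases hv : v ∈ S
    · exact iff_of_eq (congrFun hab ⟨v, hv⟩)
    · exact iff_of_true (ha' v hv) (hb' v hv)
  have s2 : FC {a : 𝓞 K | a ≠ 0 ∧ ∀ v ∉ S, Even (ordv v a)}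
      (fun a b => ∃ (u : (𝓞 K)ˣ) (c d : 𝓞 K), c ≠ 0 ∧ d ≠ 0 ∧ a * c ^ 2 = u * (b * d ^ 2)) := by
    refine s1.refine ?_
    rintro a0 ⟨ha0, -⟩
    let J : 𝓞 K → Ideal (𝓞 K) := fun a =>
      if h : ∃ J : Ideal (𝓞 K), J ≠ 0 ∧ Ideal.span {a0 * a} = J ^ 2 then h.choose else ⊤
    have hJ0 : ∀ a, J a ∈ nonZeroDivisors (Ideal (𝓞 K)) := by
      intro a
      simp only [J]
      split_ifs with h
      · exact mem_nonZeroDivisors_of_ne_zero h.choose_spec.1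
      · exact mem_nonZeroDivisors_of_ne_zero (by simp)
    refine FC.of (fun a => ClassGroup.mk0 ⟨J a, hJ0 a⟩) ?_
    rintro a ⟨⟨ha, -⟩, hJa⟩ b ⟨⟨hb, -⟩, hJb⟩ hab
    have h1 : Ideal.span {a0 * a} = J a ^ 2 := by
      simp only [J]; rw [dif_pos hJa]; exact hJa.choose_spec.2
    have h2 : Ideal.span {a0 * b} = J b ^ 2 := by
      simp only [J]; rw [dif_pos hJb]; exact hJb.choose_spec.2
    rw [ClassGroup.mk0_eq_mk0_iff] at hab
    obtain ⟨x, y, hx, hy, hxy⟩ := hab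
    simp only at hxy
    have h3 : Ideal.span {a0 * (a * x ^ 2)} = Ideal.span {a0 * (b * y ^ 2)} := by
      have e1 : Ideal.span {a0 * (a * x ^ 2)} = Ideal.span {a0 * a} * Ideal.span {x} ^ 2 := by
        rw [Ideal.span_singleton_pow, Ideal.span_singleton_mul_span_singleton]; congr 2; ring
      have e2 : Ideal.span {a0 * (b * y ^ 2)} = Ideal.span {a0 * b} * Ideal.span {y} ^ 2 := by
        rw [Ideal.span_singleton_pow, Ideal.span_singleton_mul_span_singleton]; congr 2; ring
      rw [e1, e2, h1, h2, ← mul_pow, ← mul_pow, mul_comm, hxy, mul_comm]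
    rw [Ideal.span_singleton_eq_span_singleton] at h3
    obtain ⟨u, hu⟩ := h3.symm
    refine ⟨u, x, y, hx, hy, ?_⟩
    apply mul_left_cancel₀ ha0
    rw [← hu]; ring
  refine s2.refine ?_
  rintro a0 ⟨ha0, -⟩
  let Q := (𝓞 K)ˣ ⧸ (powMonoidHom (α := (𝓞 K)ˣ) 2).range
  have hfin : Finite Q := by
    have hfg : Group.FG (𝓞 K)ˣ := Group.fg_iff_monoid_fg.mpr inferInstance
    have hfq : Group.FG Q := QuotientGroup.fg _
    apply CommGroup.finite_of_fg_isMulTorsion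
    intro q
    obtain ⟨u, rfl⟩ := QuotientGroup.mk_surjective q
    rw [isOfFinOrder_iff_pow_eq_one]
    refine ⟨2, by norm_num, ?_⟩
    rw [← QuotientGroup.mk_pow, QuotientGroup.eq_one_iff]
    exact ⟨u, rfl⟩
  let U : 𝓞 K → (𝓞 K)ˣ := fun a =>
      if h : ∃ (u : (𝓞 K)ˣ) (c d : 𝓞 K), c ≠ 0 ∧ d ≠ 0 ∧ a0 * c ^ 2 = u * (a * d ^ 2)
      then h.choose else 1
  have hU : ∀ a, (∃ (u : (𝓞 K)ˣ) (c d : 𝓞 K), c ≠ 0 ∧ d ≠ 0 ∧ a0 * c ^ 2 = u * (a * d ^ 2)) →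
      ∃ (c d : 𝓞 K), c ≠ 0 ∧ d ≠ 0 ∧ a0 * c ^ 2 = U a * (a * d ^ 2) := by
    intro a h
    simp only [U]; rw [dif_pos h]; exact h.choose_spec
  refine FC.of (ι := Q) (fun a => (U a : Q)) ?_
  rintro a ⟨⟨ha, -⟩, h1⟩ b ⟨⟨hb, -⟩, h2⟩ hab
  obtain ⟨c, d, hc, hd, h3⟩ := hU a h1
  obtain ⟨c', d', hc', hd', h4⟩ := hU b h2
  rw [QuotientGroup.eq] at hab
  obtain ⟨t, ht⟩ := hab
  have ht' : (U b : 𝓞 K) = U a * t ^ 2 := by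
    have : U b = U a * t ^ 2 := by
      rw [eq_comm]
      simp only [powMonoidHom_apply] at ht
      rw [ht]; simp
    exact_mod_cast congrArg Units.val this
  have h5 : (a0 * c * c') ^ 2 = (a * b) * (U a * t * d * d') ^ 2 := by
    have : (a0 * c * c') ^ 2 = (a0 * c ^ 2) * (a0 * c' ^ 2) := by ring
    rw [this, h3, h4, ht']; ring
  set m := algebraMap (𝓞 K) K
  have hz : m (U a * t * d * d') ≠ 0 := by
    have : (U a * t * d * d' : 𝓞 K) ≠ 0 := by simp [hd, hd']
    simpa [m] using this
  refine ⟨m (a0 * c * c') / m (U a * t * d * d'), ?_⟩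
  have h6 : m (a0 * c * c') ^ 2 = m a * m b * m (U a * t * d * d') ^ 2 := by
    rw [← map_pow, h5, map_mul, map_mul, map_pow]
  field_simp
  rw [h6]

lemma fc_K (S : Set (HeightOneSpectrum (𝓞 K))) (hS : S.Finite) :
    FC {z : K | z ≠ 0 ∧ ∀ v ∉ S, IsSquare (v.valuation K z)} (fun a b => IsSquare (a * b)) := by
  classical
  have H : ∀ z : K, ∃ a : 𝓞 K, ∃ t : K, t ≠ 0 ∧ algebraMap (𝓞 K) K a = z * t ^ 2 := by
    intro z
    obtain ⟨a, b, hb, rfl⟩ := IsFractionRing.div_surjective (A := 𝓞 K) z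
    have hb' : algebraMap (𝓞 K) K b ≠ 0 := by
      simpa using nonZeroDivisors.ne_zero hb
    refine ⟨a * b, algebraMap (𝓞 K) K b, hb', ?_⟩
    rw [map_mul]; field_simp
  choose a t ht hat using H
  refine ((fc_int S hS).comap a).mono ?_ ?_
  · rintro z ⟨hz, hz'⟩
    have hne : a z ≠ 0 := by
      intro h
      have := hat z
      rw [h, map_zero] at this
      exact mul_ne_zero hz (pow_ne_zero 2 (ht z)) this.symm
    refine ⟨hne, fun v hv => even_ordv v hne ?_⟩
    rw [hat, map_mul, map_pow]
    exact (hz' v hv).mul (IsSquare.sq _)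
  · rintro z ⟨hz, -⟩ z' ⟨hz', -⟩ ⟨r, hr⟩
    refine ⟨r / (t z * t z'), ?_⟩
    rw [hat, hat] at hr
    have := ht z
    have := ht z'
    field_simp
    rw [pow_two r, ← hr]; ring

end NF
end APR

set_option linter.unusedSectionVars false
set_option linter.unusedVariables false
set_option linter.unusedSimpArgs false
namespace APR
open IsDedekindDomain NumberField Height

section WMW
variable {K : Type*} [Field K] [CharZero K] [DecidableEq K] {A B : K} [(SW A B).IsElliptic]

lemma sw_disc : 4 * A ^ 3 + 27 * B ^ 2 ≠ 0 := by
  have h := (SW A B).isUnit_Δ.ne_zero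
  intro h'
  apply h
  simp only [WeierstrassCurve.Δ, WeierstrassCurve.b₂, WeierstrassCurve.b₄, WeierstrassCurve.b₆,
    WeierstrassCurve.b₈, SW]
  linear_combination (-16) * h'

variable {e1 e2 e3 : K} 

lemma roots_ne (hs : e1 + e2 + e3 = 0) (hA : A = e1 * e2 + e1 * e3 + e2 * e3)
    (hB : B = - (e1 * e2 * e3)) : e1 - e2 ≠ 0 ∧ e1 - e3 ≠ 0 ∧ e2 - e3 ≠ 0 := by
  have h := sw_disc (A := A) (B := B)
  have e : 4 * A ^ 3 + 27 * B ^ 2 = - ((e1 - e2) * (e1 - e3) * (e2 - e3)) ^ 2 := by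
    have h3 : e3 = -e1 - e2 := by linear_combination hs
    rw [hA, hB, h3]; ring
  rw [e] at h
  refine ⟨?_, ?_, ?_⟩ <;> (intro h'; apply h; rw [h']; ring)

lemma halving (hs : e1 + e2 + e3 = 0) (hA : A = e1 * e2 + e1 * e3 + e2 * e3)
    (hB : B = - (e1 * e2 * e3)) {R : Pt A B} (hR : R ≠ 0) (h1 : IsSquare (Xc R - e1))
    (h2 : IsSquare (Xc R - e2)) (h3 : IsSquare (Xc R - e3)) : ∃ S : Pt A B, R = S + S := by
  obtain ⟨t1, h1⟩ := h1
  obtain ⟨t2, h2⟩ := h2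
  obtain ⟨t3, h3⟩ := h3
  obtain ⟨d1, d2, d3⟩ := roots_ne hs hA hB
  have e := sw_eq hR
  have key : ∀ t1 : K, Xc R - e1 = t1 * t1 → Yc R = t1 * t2 * t3 → ∃ S : Pt A B, R = S + S := by
    intro t1 h1 hy
    have he3 : e3 = -e1 - e2 := by linear_combination hs
    obtain ⟨S, hS0, hSx, hSy⟩ := exists_pt (A := A) (B := B)
      (x := Xc R + t1 * t2 + t1 * t3 + t2 * t3) (y := (t1 + t2) * (t1 + t3) * (t2 + t3)) (by
        have q1 : Xc R + t1 * t2 + t1 * t3 + t2 * t3 - e1 = (t1 + t2) * (t1 + t3) := by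
          linear_combination h1
        have q2 : Xc R + t1 * t2 + t1 * t3 + t2 * t3 - e2 = (t1 + t2) * (t2 + t3) := by
          linear_combination h2
        have q3 : Xc R + t1 * t2 + t1 * t3 + t2 * t3 - e3 = (t1 + t3) * (t2 + t3) := by
          linear_combination h3
        set x := Xc R + t1 * t2 + t1 * t3 + t2 * t3
        have : ((t1 + t2) * (t1 + t3) * (t2 + t3)) ^ 2 = (x - e1) * (x - e2) * (x - e3) := by
          rw [q1, q2, q3]; ring
        rw [this]
        linear_combination (- x ^ 2) * hs - x * hA - hB)
    have n12 : t1 + t2 ≠ 0 := fun h => d1 (by linear_combination h2 - h1 + (t2 - t1) * h)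
    have n13 : t1 + t3 ≠ 0 := fun h => d2 (by linear_combination h3 - h1 + (t3 - t1) * h)
    have n23 : t2 + t3 ≠ 0 := fun h => d3 (by linear_combination h3 - h2 + (t3 - t2) * h)
    have hSy0 : Yc S ≠ 0 := by rw [hSy]; exact mul_ne_zero (mul_ne_zero n12 n13) n23
    obtain ⟨f0, f1, f2⟩ := dbl_formula hS0 hSy0
    have hx3 : 3 * Xc R = t1 ^ 2 + t2 ^ 2 + t3 ^ 2 := by linear_combination h1 + h2 + h3 + hs
    have hl : (3 * Xc S ^ 2 + A) / (2 * Yc S) = t1 + t2 + t3 := by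
      rw [div_eq_iff (mul_ne_zero two_ne_zero hSy0), hSx, hSy]
      have g1 : e1 = Xc R - t1 * t1 := by linear_combination -h1
      have g2 : e2 = Xc R - t2 * t2 := by linear_combination -h2
      have g3 : e3 = Xc R - t3 * t3 := by linear_combination -h3
      rw [g1, g2, g3] at hA
      linear_combination hA + (2 * Xc R  + 2 * (t1 * t2 + t1 * t3 + t2 * t3)) * hx3
    rw [hl] at f1 f2
    have hX : Xc R = Xc (S + S) := by
      rw [f1, hSx]; linear_combination hx3
    refine ⟨S, pt_ext hR f0 hX ?_⟩
    rw [f2, ← hX, hSx, hSy, hy]; ring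
  have hy2 : Yc R ^ 2 = (t1 * t2 * t3) ^ 2 := by
    have : (t1 * t2 * t3) ^ 2 = (Xc R - e1) * (Xc R - e2) * (Xc R - e3) := by
      rw [h1, h2, h3]; ring
    rw [this, e]
    linear_combination (Xc R) ^ 2 * hs + Xc R * hA + hB
  rw [sq_eq_sq_iff_eq_or_eq_neg] at hy2
  rcases hy2 with hy | hy
  · exact key t1 h1 hy
  · exact key (-t1) (by rw [h1]; ring) (by rw [hy]; ring)

lemma sq_of_add (he : e1 ^ 3 + A * e1 + B = 0) {P Q : Pt A B} (hP : P ≠ 0) (hQ : Q ≠ 0)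
    (hx : Xc P ≠ Xc Q)
    (h : IsSquare ((Xc P - e1) * (Xc Q - e1))) (hP1 : Xc P - e1 ≠ 0) (hQ1 : Xc Q - e1 ≠ 0) :
    IsSquare (Xc (P + Q) - e1) := by
  obtain ⟨g0, g1, g2⟩ := add_formula hP hQ hx
  obtain ⟨t, ht⟩ := h
  have eP := sw_eq hP
  have eQ := sw_eq hQ
  have ht0 : t ≠ 0 := by
    rintro rfl
    rw [mul_zero] at ht
    exact mul_ne_zero hP1 hQ1 ht
  set l := (Yc P - Yc Q) / (Xc P - Xc Q) with hl
  have hl' : l * (Xc P - Xc Q) = Yc P - Yc Q := by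
    rw [hl, div_mul_cancel₀]; exact sub_ne_zero.2 hx
  refine ⟨(l * (e1 - Xc P) + Yc P) / t, ?_⟩
  have : (Xc (P + Q) - e1) * (t * t) = (l * (e1 - Xc P) + Yc P) ^ 2 := by
    rw [← ht, g1]
    apply mul_left_cancel₀ (sub_ne_zero.2 hx)
    have hY : Yc Q = Yc P - l * (Xc P - Xc Q) := by linear_combination hl'
    rw [hY] at eQ
    linear_combination (Xc Q - e1) * eP - (Xc P - e1) * eQ - (Xc P - Xc Q) * he
  field_simp
  rw [pow_two t, this]

end WMW

section val
variable {K : Type*} [Field K] [NumberField K] 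

lemma val_even (v : Valuation K (WithZero (Multiplicative ℤ))) {z e1 e2 e3 y : K}
    (h12 : v (e1 - e2) = 1) (h13 : v (e1 - e3) = 1)
    (hz : (z - e1) * (z - e2) * (z - e3) = y ^ 2) (h0 : z - e1 ≠ 0) : IsSquare (v (z - e1)) := by
  have hv : v (z - e1) * v (z - e2) * v (z - e3) = v y ^ 2 := by
    rw [← map_mul, ← map_mul, hz, map_pow]
  have e2' : z - e2 = (z - e1) + (e1 - e2) := by ring
  have e3' : z - e3 = (z - e1) + (e1 - e3) := by ring
  rcases lt_trichotomy (v (z - e1)) 1 with h | h | h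
  · have g2 : v (z - e2) = 1 := by
      rw [e2', Valuation.map_add_eq_of_lt_right v (by rwa [h12]), h12]
    have g3 : v (z - e3) = 1 := by
      rw [e3', Valuation.map_add_eq_of_lt_right v (by rwa [h13]), h13]
    rw [g2, g3, mul_one, mul_one] at hv
    rw [hv]; exact IsSquare.sq _
  · rw [h]; exact IsSquare.one
  · have g2 : v (z - e2) = v (z - e1) := by
      rw [e2', Valuation.map_add_eq_of_lt_left v (by rwa [h12])]
    have g3 : v (z - e3) = v (z - e1) := by
      rw [e3', Valuation.map_add_eq_of_lt_left v (by rwa [h13])]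
    rw [g2, g3] at hv
    have hne : v (z - e1) ≠ 0 := (Valuation.ne_zero_iff v).2 h0
    refine ⟨v y / v (z - e1), ?_⟩
    field_simp
    rw [← hv, pow_succ, pow_two]

end val

section MW
variable {K : Type*} [Field K] [NumberField K] [DecidableEq K] {A B : K} [(SW A B).IsElliptic]
variable {e1 e2 e3 : K} 

lemma bad_finite {d : K} (hd : d ≠ 0) :
    {v : HeightOneSpectrum (𝓞 K) | v.valuation K d ≠ 1}.Finite := by
  refine ((HeightOneSpectrum.Support.finite (𝓞 K) d).union
    (HeightOneSpectrum.Support.finite (𝓞 K) d⁻¹)).subset ?_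
  intro v hv
  rcases lt_or_gt_of_ne hv with h | h
  · right
    change 1 < v.valuation K d⁻¹
    rw [map_inv₀]
    exact (one_lt_inv₀ (zero_lt_iff.2 ((Valuation.ne_zero_iff _).2 hd))).2 h
  · left; exact h

lemma fc_point (hs : e1 + e2 + e3 = 0) (hA : A = e1 * e2 + e1 * e3 + e2 * e3)
    (hB : B = - (e1 * e2 * e3)) : FC {P : Pt A B | P ≠ 0 ∧ Yc P ≠ 0}
      (fun P Q => IsSquare ((Xc P - e1) * (Xc Q - e1))) := by
  obtain ⟨d1, d2, d3⟩ := roots_ne hs hA hB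
  refine ((fc_K _ ((bad_finite d1).union (bad_finite d2))).comap (fun P : Pt A B => Xc P - e1)).mono
    ?_ (fun _ _ _ _ h => h)
  rintro P ⟨hP, hy⟩
  have e := sw_eq hP
  have e' : (Xc P - e1) * (Xc P - e2) * (Xc P - e3) = Yc P ^ 2 := by
    rw [e]; linear_combination (- (Xc P) ^ 2) * hs - Xc P * hA - hB
  have h0 : Xc P - e1 ≠ 0 := by
    intro h
    rw [h] at e'
    exact hy (by simpa using e'.symm)
  refine ⟨h0, fun v hv => ?_⟩
  simp only [Set.mem_union, Set.mem_setOf_eq, not_or, not_not] at hv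
  exact val_even _ hv.1 hv.2 e' h0

lemma fc_all (hs : e1 + e2 + e3 = 0) (hA : A = e1 * e2 + e1 * e3 + e2 * e3)
    (hB : B = - (e1 * e2 * e3)) : FC (Set.univ : Set (Pt A B)) (fun P Q => ∃ S, P - Q = S + S) := by
  have c1 := fc_point (A := A) (B := B) hs hA hB
  have c2 := fc_point (A := A) (B := B) (e1 := e2) (e2 := e1) (e3 := e3)
    (by rw [← hs]; ring) (by rw [hA]; ring) (by rw [hB]; ring)
  have c3 := fc_point (A := A) (B := B) (e1 := e3) (e2 := e1) (e3 := e2)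
    (by rw [← hs]; ring) (by rw [hA]; ring) (by rw [hB]; ring)
  have hfac : ∀ x, x ^ 3 + A * x + B = (x - e1) * (x - e2) * (x - e3) := by
    intro x; rw [hA, hB]; linear_combination x ^ 2 * hs
  have r1 : e1 ^ 3 + A * e1 + B = 0 := by rw [hfac]; ring
  have r2 : e2 ^ 3 + A * e2 + B = 0 := by rw [hfac]; ring
  have r3 : e3 ^ 3 + A * e3 + B = 0 := by rw [hfac]; ring
  have fin : {P : Pt A B | ¬ (P ≠ 0 ∧ Yc P ≠ 0)}.Finite := by
    have : {P : Pt A B | P ≠ 0 ∧ Yc P = 0}.Finite := by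
      refine Set.Finite.of_injOn (f := Xc) (t := {e1, e2, e3}) ?_ ?_ (Set.toFinite _)
      · rintro P ⟨hP, hy⟩
        have e := sw_eq hP
        rw [hfac, hy] at e
        have e' : (Xc P - e1) * (Xc P - e2) * (Xc P - e3) = 0 := by rw [← e]; ring
        simp only [mul_eq_zero, sub_eq_zero] at e'
        simp only [Set.mem_insert_iff, Set.mem_singleton_iff]
        tauto
      · rintro P ⟨hP, hy⟩ Q ⟨hQ, hy'⟩ hx
        exact pt_ext hP hQ hx (hy.trans hy'.symm)
    refine (this.union (Set.finite_singleton 0)).subset ?_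
    intro P hP
    simp only [Set.mem_setOf_eq, not_and_or, not_not, Set.mem_union, Set.mem_singleton_iff] at hP ⊢
    tauto
  have main := ((c1.and (c2.and c3)).mono (R' := fun P Q : Pt A B => ∃ S, P - Q = S + S)
    (T' := {P : Pt A B | P ≠ 0 ∧ Yc P ≠ 0}) le_rfl ?_).union
      (FC.finite fin (fun P => ⟨0, by simp⟩))
  · refine main.mono ?_ (fun _ _ _ _ h => h)
    intro P _
    exact em _
  · rintro P ⟨hP, hyP⟩ Q ⟨hQ, hyQ⟩ ⟨s1, s2, s3⟩
    have ne : ∀ R : Pt A B, R ≠ 0 → Yc R ≠ 0 → ∀ e, e ^ 3 + A * e + B = 0 → Xc R - e ≠ 0 := by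
      intro R hR hy e he h
      have := sw_eq hR
      rw [sub_eq_zero.1 h, he] at this
      exact hy (by simpa using this)
    by_cases hx : Xc P = Xc Q
    · rcases X_eq hP hQ hx with h | h
      · exact ⟨0, by simp [h]⟩
      · exact ⟨P, by rw [h]; abel⟩
    · obtain ⟨S, hS⟩ := halving hs hA hB (add_formula hP hQ hx).1
        (sq_of_add r1 hP hQ hx s1 (ne P hP hyP _ r1) (ne Q hQ hyQ _ r1))
        (sq_of_add r2 hP hQ hx s2 (ne P hP hyP _ r2) (ne Q hQ hyQ _ r2))
        (sq_of_add r3 hP hQ hx s3 (ne P hP hyP _ r3) (ne Q hQ hyQ _ r3))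
      refine ⟨S - Q, ?_⟩
      have : P - Q = (P + Q) - Q - Q := by abel
      rw [this, hS]; abel

lemma finite_of_nh (c : ℝ) : {P : Pt A B | nh P ≤ c}.Finite := by
  have h := Northcott.finite_le (h := fun x : K => Height.logHeight₁ x) c
  have h1 : {P : Pt A B | nh P ≤ c} ⊆ {0} ∪ ⋃ x ∈ {x : K | Height.logHeight₁ x ≤ c},
      {P : Pt A B | P ≠ 0 ∧ Xc P = x} := by
    intro P hP
    by_cases h0 : P = 0
    · left; exact h0
    · right
      simp only [Set.mem_iUnion]
      exact ⟨Xc P, hP, h0, rfl⟩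
  refine Set.Finite.subset ((Set.finite_singleton _).union (h.biUnion ?_)) h1
  intro x _
  by_cases hex : ∃ Q : Pt A B, Q ≠ 0 ∧ Xc Q = x
  · obtain ⟨Q, hQ, rfl⟩ := hex
    refine (Set.toFinite {Q, -Q}).subset ?_
    rintro P ⟨hP, hx⟩
    exact X_eq hP hQ hx
  · refine Set.finite_empty.subset ?_
    intro P hP
    exact hex ⟨P, hP⟩

/-- Mordell–Weil for curves with full 2-torsion. -/
theorem mordell_weil (hs : e1 + e2 + e3 = 0) (hA : A = e1 * e2 + e1 * e3 + e2 * e3)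
    (hB : B = - (e1 * e2 * e3)) : AddGroup.FG (Pt A B) := by
  obtain ⟨C, hC⟩ := nh_parallelogram (A := A) (B := B)
  have : Northcott (nh : Pt A B → ℝ) := ⟨finite_of_nh⟩
  refine AddCommGroup.fg_of_descent' (h := nh) ?_ (fun P => Height.zero_le_logHeight₁ _) hC
  obtain ⟨n, c, hc⟩ := fc_all (A := A) (B := B) hs hA hB
  set H := (nsmulAddMonoidHom (α := Pt A B) 2).range
  have : Finite (Pt A B ⧸ H) := by
    refine Finite.of_injective (fun q : Pt A B ⧸ H => c q.out) ?_
    intro q q' h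
    obtain ⟨S, hS⟩ := hc _ trivial _ trivial h
    rw [← QuotientAddGroup.out_eq' q, ← QuotientAddGroup.out_eq' q', QuotientAddGroup.eq]
    refine ⟨-S, ?_⟩
    simp only [nsmulAddMonoidHom_apply, two_nsmul]
    have : -q.out + q'.out = -(q.out - q'.out) := by abel
    rw [this, hS]; abel
  exact AddSubgroup.finiteIndex_of_finite_quotient

end MW
end APR

set_option linter.unusedSectionVars false
set_option linter.unusedVariables false
set_option linter.unusedSimpArgs false
namespace APR
open TensorProduct

open scoped MatrixOrder in
lemma psd_factor {n : Type*} [Fintype n] [DecidableEq n] {M : Matrix n n ℝ} (h : M.PosSemidef) :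
    ∃ S : Matrix n n ℝ, M = S.conjTranspose * S := by
  obtain ⟨S, hS⟩ := CStarAlgebra.nonneg_iff_eq_star_mul_self.mp h.nonneg
  exact ⟨S, hS⟩

section canon
variable {G : Type*} [AddCommGroup G]

lemma canonical (hh : G → ℝ) (h0 : ∀ P, 0 ≤ hh P) (C C2 : ℝ)
    (hC : ∀ P Q, |hh (P + Q) + hh (P - Q) - 2 * (hh P + hh Q)| ≤ C)
    (hC2 : ∀ P, |hh (P + P) - 4 * hh P| ≤ C2) :
    ∃ q : G → ℝ, (∀ P, 0 ≤ q P) ∧ (∀ P Q, q (P + Q) + q (P - Q) = 2 * (q P + q Q)) ∧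
      ∀ P, |q P - hh P| ≤ C2 / 3 := by
  let a : G → ℕ → ℝ := fun P n => hh (2 ^ n • P) / 4 ^ n
  have hd : ∀ P n, dist (a P n) (a P (n + 1)) ≤ C2 / 4 * (1 / 4) ^ n := by
    intro P n
    rw [Real.dist_eq]
    have e : a P n - a P (n + 1) = - (hh (2 ^ n • P + 2 ^ n • P) - 4 * hh (2 ^ n • P)) / 4 ^ (n + 1) := by
      simp only [a]
      rw [pow_succ 2 n, mul_comm, mul_smul, two_smul]
      field_simp
      ring
    rw [e, abs_div, abs_neg]
    have : |(4 : ℝ) ^ (n + 1)| = 4 ^ (n + 1) := abs_of_pos (by positivity)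
    rw [this]
    have e2 : C2 / 4 * (1 / 4) ^ n = C2 / 4 ^ (n + 1) := by
      rw [one_div, inv_pow, pow_succ]; field_simp
    rw [e2]
    gcongr
    exact hC2 _
  have hlim : ∀ P, ∃ l, Filter.Tendsto (a P) Filter.atTop (nhds l) := fun P =>
    cauchySeq_tendsto_of_complete (cauchySeq_of_le_geometric (1 / 4) (C2 / 4) (by norm_num) (hd P))
  choose q hq using hlim
  refine ⟨q, ?_, ?_, ?_⟩
  · intro P
    exact ge_of_tendsto' (hq P) (fun n => div_nonneg (h0 _) (by positivity))
  · intro P Q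
    have t1 : Filter.Tendsto (fun n => a (P + Q) n + a (P - Q) n - 2 * (a P n + a Q n)) Filter.atTop
        (nhds (q (P + Q) + q (P - Q) - 2 * (q P + q Q))) :=
      ((hq _).add (hq _)).sub (((hq _).add (hq _)).const_mul 2)
    have t2 : Filter.Tendsto (fun n => a (P + Q) n + a (P - Q) n - 2 * (a P n + a Q n)) Filter.atTop
        (nhds 0) := by
      have t3 : Filter.Tendsto (fun n : ℕ => C * (1 / 4 : ℝ) ^ n) Filter.atTop (nhds 0) := by
        have := (tendsto_pow_atTop_nhds_zero_of_lt_one (r := (1 / 4 : ℝ)) (by norm_num)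
          (by norm_num)).const_mul C
        simpa using this
      refine squeeze_zero_norm (fun n => ?_) t3
      have e : a (P + Q) n + a (P - Q) n - 2 * (a P n + a Q n) =
        (hh (2 ^ n • P + 2 ^ n • Q) + hh (2 ^ n • P - 2 ^ n • Q) -
          2 * (hh (2 ^ n • P) + hh (2 ^ n • Q))) / 4 ^ n := by
        simp only [a, smul_add, smul_sub]; ring
      rw [e, Real.norm_eq_abs, abs_div]
      have : |(4 : ℝ) ^ n| = 4 ^ n := abs_of_pos (by positivity)
      rw [this, one_div, inv_pow, ← div_eq_mul_inv]
      gcongr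
      exact hC _ _
    have := tendsto_nhds_unique t1 t2
    linarith
  · intro P
    have := dist_le_of_le_geometric_of_tendsto₀ (1 / 4) (C2 / 4) (by norm_num) (hd P) (hq P)
    rw [Real.dist_eq, abs_sub_comm] at this
    simp only [a, pow_zero, one_smul, div_one] at this
    refine this.trans (le_of_eq (by ring))

lemma polar_add {q : G → ℝ} (hq : ∀ P Q, q (P + Q) + q (P - Q) = 2 * (q P + q Q)) (P Q R : G) :
    q (P + Q + R) = q (P + Q) + q (P + R) + q (Q + R) - q P - q Q - q R := by
  have h1 := hq (P + R) Q
  have h2 := hq P (R - Q)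
  have h3 := hq (P + Q) R
  have h4 := hq R Q
  have e1 : P + R + Q = P + Q + R := by abel
  have e2 : P + R - Q = P + (R - Q) := by abel
  have e3 : P - (R - Q) = P + Q - R := by abel
  have e4 : R + Q = Q + R := by abel
  rw [e1, e2] at h1
  rw [e3] at h2
  rw [e4] at h4
  linarith

lemma q_zero {q : G → ℝ} (hq : ∀ P Q, q (P + Q) + q (P - Q) = 2 * (q P + q Q)) : q 0 = 0 := by
  have := hq 0 0
  simp at this; linarith

lemma q_dbl {q : G → ℝ} (hq : ∀ P Q, q (P + Q) + q (P - Q) = 2 * (q P + q Q)) (P : G) :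
    q (P + P) = 4 * q P := by
  have := hq P P
  have h0 := q_zero hq
  simp [h0] at this; linarith

lemma q_pow {q : G → ℝ} (hq : ∀ P Q, q (P + Q) + q (P - Q) = 2 * (q P + q Q)) (P : G) (t : ℕ) :
    q (2 ^ t • P) = 4 ^ t * q P := by
  induction t with
  | zero => simp
  | succ n ih => rw [pow_succ 2 n, mul_comm, mul_smul, two_smul, q_dbl hq, ih]; ring

lemma q_neg {q : G → ℝ} (hq : ∀ P Q, q (P + Q) + q (P - Q) = 2 * (q P + q Q)) (P : G) :
    q (-P) = q P := by
  have := hq 0 P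
  have h0 := q_zero hq
  simp [h0] at this; linarith

/-- polar form as a bilinear map, normalised to `bil P P = q P` -/
noncomputable def bil {q : G → ℝ} (hq : ∀ P Q, q (P + Q) + q (P - Q) = 2 * (q P + q Q)) :
    G →ₗ[ℤ] G →ₗ[ℤ] ℝ :=
  LinearMap.mk₂ ℤ (fun P Q => (q (P + Q) - q P - q Q) / 2)
    (fun P P' Q => by
      have := polar_add hq P P' Q
      rw [this]; ring)
    (fun c P Q => by
      let f : G →+ ℝ := ⟨⟨fun P => (q (P + Q) - q P - q Q) / 2, by simp [q_zero hq]⟩, fun P P' => by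
        have := polar_add hq P P' Q
        simp only; rw [this]; ring⟩
      exact map_zsmul f c P)
    (fun P Q Q' => by
      have := polar_add hq P Q Q'
      rw [← add_assoc, this]; ring)
    (fun c P Q => by
      let f : G →+ ℝ := ⟨⟨fun Q => (q (P + Q) - q P - q Q) / 2, by simp [q_zero hq]⟩, fun Q Q' => by
        have := polar_add hq P Q Q'
        simp only; rw [← add_assoc, this]; ring⟩
      exact map_zsmul f c Q)

lemma bil_self {q : G → ℝ} (hq : ∀ P Q, q (P + Q) + q (P - Q) = 2 * (q P + q Q)) (P : G) :
    bil hq P P = q P := by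
  simp only [bil, LinearMap.mk₂_apply]; rw [q_dbl hq]; ring

lemma bil_comm {q : G → ℝ} (hq : ∀ P Q, q (P + Q) + q (P - Q) = 2 * (q P + q Q)) (P Q : G) :
    bil hq P Q = bil hq Q P := by
  simp only [bil, LinearMap.mk₂_apply]; rw [add_comm]; ring

/-- extension of a bilinear form to `ℚ ⊗ G` -/
noncomputable def bilQ (b : G →ₗ[ℤ] G →ₗ[ℤ] ℝ) : (ℚ ⊗[ℤ] G) →ₗ[ℚ] (ℚ ⊗[ℤ] G) →ₗ[ℚ] ℝ :=
  LinearMap.liftBaseChange ℚ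
    (((LinearMap.liftBaseChangeEquiv (R := ℤ) (M := G) (N := ℝ) ℚ).toLinearMap.restrictScalars ℤ) ∘ₗ b)

lemma bilQ_tmul (b : G →ₗ[ℤ] G →ₗ[ℤ] ℝ) (s t : ℚ) (P Q : G) :
    bilQ b (s ⊗ₜ P) (t ⊗ₜ Q) = s * t * b P Q := by
  simp only [bilQ, LinearMap.liftBaseChange_tmul, LinearMap.smul_apply, LinearMap.comp_apply,
    LinearMap.restrictScalars_apply, LinearEquiv.coe_coe]
  change (s : ℚ) • (LinearMap.liftBaseChange ℚ (b P)) (t ⊗ₜ Q) = _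
  rw [LinearMap.liftBaseChange_tmul]
  rw [Rat.smul_def, Rat.smul_def]; ring

lemma exists_int_mul (v : ℚ ⊗[ℤ] G) : ∃ n : ℚ, n ≠ 0 ∧ ∃ P : G, n • v = 1 ⊗ₜ P := by
  have key : ∀ v : ℚ ⊗[ℤ] G, ∃ n : ℤ, n ≠ 0 ∧ ∃ P : G, n • v = 1 ⊗ₜ P := by
    intro v
    induction v using TensorProduct.induction_on with
    | zero => exact ⟨1, one_ne_zero, 0, by simp⟩
    | tmul s P =>
      refine ⟨s.den, by exact_mod_cast s.den_nz, s.num • P, ?_⟩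
      rw [TensorProduct.tmul_smul, TensorProduct.smul_tmul', TensorProduct.smul_tmul']
      congr 1
      simp
    | add v w hv hw =>
      obtain ⟨n, hn, P, hP⟩ := hv
      obtain ⟨m, hm, Q, hQ⟩ := hw
      refine ⟨n * m, mul_ne_zero hn hm, m • P + n • Q, ?_⟩
      rw [smul_add, TensorProduct.tmul_add, TensorProduct.tmul_smul, TensorProduct.tmul_smul, ← hP, ← hQ,
        smul_smul, smul_smul, mul_comm n m]
  obtain ⟨n, hn, P, hP⟩ := key v
  exact ⟨n, by exact_mod_cast hn, P, by rw [← hP]; exact Int.cast_smul_eq_zsmul ℚ n v⟩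

/-- Euclidean model of a nonnegative quadratic form on a group of finite rank. -/
lemma exists_euclid [Module.Finite ℚ (ℚ ⊗[ℤ] G)] {q : G → ℝ} (h0 : ∀ P, 0 ≤ q P)
    (hq : ∀ P Q, q (P + Q) + q (P - Q) = 2 * (q P + q Q)) :
    ∃ f : G → EuclideanSpace ℝ (Fin (Module.finrank ℚ (ℚ ⊗[ℤ] G))),
      ∀ P Q, ‖f P - f Q‖ ^ 2 = q (P - Q) := by
  classical
  set r := Module.finrank ℚ (ℚ ⊗[ℤ] G) with hr
  let bas := Module.finBasis ℚ (ℚ ⊗[ℤ] G)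
  set b := bil hq
  have hpos : ∀ v, 0 ≤ bilQ b v v := by
    intro v
    obtain ⟨n, hn, P, hP⟩ := exists_int_mul v
    have h1 : bilQ b (n • v) (n • v) = q P := by
      rw [hP, bilQ_tmul, bil_self hq]; simp
    rw [map_smul, map_smul, LinearMap.smul_apply, Rat.smul_def, Rat.smul_def, ← mul_assoc] at h1
    have h2 : (0 : ℝ) < (n : ℝ) * n := by
      have : (n : ℝ) ≠ 0 := by exact_mod_cast hn
      exact mul_self_pos.2 this
    by_contra hneg
    push Not at hneg
    have := mul_neg_of_pos_of_neg h2 hneg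
    have := h0 P
    linarith
  have hsym : ∀ v w, bilQ b v w = bilQ b w v := by
    intro v w
    induction v using TensorProduct.induction_on with
    | zero => simp
    | tmul s P =>
      induction w using TensorProduct.induction_on with
      | zero => simp
      | tmul t Q => rw [bilQ_tmul, bilQ_tmul, bil_comm]; ring
      | add x y hx hy => rw [map_add, map_add, LinearMap.add_apply, hx, hy]
    | add x y hx hy => rw [map_add, map_add, LinearMap.add_apply, hx, hy]
  let M : Matrix (Fin r) (Fin r) ℝ := fun i j => bilQ b (bas i) (bas j)
  have hM : ∀ c : Fin r → ℚ, (fun i => (c i : ℝ)) ⬝ᵥ M.mulVec (fun i => (c i : ℝ)) =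
      bilQ b (∑ i, c i • bas i) (∑ i, c i • bas i) := by
    intro c
    simp only [map_sum, map_smul, LinearMap.sum_apply, LinearMap.smul_apply, dotProduct,
      Matrix.mulVec, M, Finset.mul_sum, Rat.smul_def, Finset.smul_sum]
    refine Finset.sum_congr rfl fun i _ => Finset.sum_congr rfl fun j _ => ?_
    rw [hsym (bas j) (bas i)]; ring
  have hpsd : M.PosSemidef := by
    refine Matrix.PosSemidef.of_dotProduct_mulVec_nonneg ?_ ?_
    · ext i j
      simp only [Matrix.conjTranspose_apply, star_trivial, M]
      exact hsym _ _
    · intro x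
      rw [star_trivial]
      have hd : DenseRange (Pi.map (fun (_ : Fin r) (c : ℚ) => (c : ℝ))) :=
        DenseRange.piMap (fun _ => Rat.denseRange_cast)
      refine hd.induction_on (p := fun x => 0 ≤ x ⬝ᵥ M.mulVec x) x ?_ ?_
      · refine isClosed_le continuous_const ?_
        simp only [dotProduct, Matrix.mulVec]
        fun_prop
      · intro c
        have : Pi.map (fun (_ : Fin r) (c : ℚ) => (c : ℝ)) c = fun i => (c i : ℝ) := rfl
        rw [this, hM c]
        exact hpos _
  obtain ⟨S, hS⟩ := psd_factor hpsd
  refine ⟨fun P => WithLp.toLp 2 (S.mulVec (fun i => ((bas.repr (1 ⊗ₜ P) i : ℚ) : ℝ))), ?_⟩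
  intro P Q
  have e : (1 : ℚ) ⊗ₜ[ℤ] (P - Q) = ∑ i, bas.repr (1 ⊗ₜ (P - Q)) i • bas i := (bas.sum_repr _).symm
  have h1 : q (P - Q) = bilQ b (1 ⊗ₜ (P - Q)) (1 ⊗ₜ (P - Q)) := by
    rw [bilQ_tmul, bil_self hq]; simp
  rw [h1, e, ← hM, ← WithLp.toLp_sub, ← Matrix.mulVec_sub]
  have e2 : ((fun i => ((bas.repr (1 ⊗ₜ P) i : ℚ) : ℝ)) - (fun i => ((bas.repr (1 ⊗ₜ Q) i : ℚ) : ℝ)))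
      = (fun i => ((bas.repr (1 ⊗ₜ (P - Q)) i : ℚ) : ℝ)) := by
    ext i
    simp [TensorProduct.tmul_sub]
  rw [e2, EuclideanSpace.norm_sq_eq, hS, Matrix.conjTranspose_eq_transpose_of_trivial,
    ← Matrix.mulVec_mulVec, Matrix.dotProduct_mulVec, Matrix.vecMul_transpose]
  simp [dotProduct, pow_two]
  rfl

end canon

section packing
variable {E : Type*} [NormedAddCommGroup E] [NormedSpace ℝ E] [FiniteDimensional ℝ E]
variable {ι : Type*}

lemma packing_step (S : Finset ι) (hS : S.Nonempty) (f : ι → E) (c : E) {R : ℝ} (hR : 0 < R)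
    (hf : ∀ i ∈ S, ‖f i - c‖ ≤ R) : ∃ S' ⊆ S, S'.Nonempty ∧
      S.card ≤ 5 ^ (Module.finrank ℝ E) * S'.card ∧ ∃ c' : E, ∀ i ∈ S', ‖f i - c'‖ ≤ R / 2 := by
  classical
  let g : ι → E := fun i => (2 / R) • (f i - c)
  have hg : ∀ i ∈ S, ‖g i‖ ≤ 2 := by
    intro i hi
    simp only [g]
    rw [norm_smul, Real.norm_of_nonneg (by positivity)]
    calc 2 / R * ‖f i - c‖ ≤ 2 / R * R := by gcongr; exact hf i hi
      _ = 2 := by field_simp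
  let T := (S.image g).powerset.filter (fun M => ∀ x ∈ M, ∀ y ∈ M, x ≠ y → 1 ≤ ‖x - y‖)
  have hT : T.Nonempty := ⟨∅, by simp [T]⟩
  obtain ⟨M, hM, hmax⟩ := Finset.exists_max_image T Finset.card hT
  simp only [T, Finset.mem_filter, Finset.mem_powerset] at hM
  have hcard : M.card ≤ 5 ^ Module.finrank ℝ E := by
    refine Besicovitch.card_le_of_separated M ?_ hM.2
    intro x hx
    obtain ⟨i, hi, rfl⟩ := Finset.mem_image.1 (hM.1 hx)
    exact hg i hi
  have hcov : ∀ i ∈ S, ∃ x ∈ M, ‖g i - x‖ ≤ 1 := by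
    intro i hi
    by_contra hno
    push Not at hno
    have hnot : g i ∉ M := fun h => by have := hno _ h; simp at this; linarith
    have hin : insert (g i) M ∈ T := by
      simp only [T, Finset.mem_filter, Finset.mem_powerset]
      refine ⟨Finset.insert_subset (Finset.mem_image_of_mem g hi) hM.1, ?_⟩
      intro x hx y hy hxy
      rw [Finset.mem_insert] at hx hy
      rcases hx with rfl | hx <;> rcases hy with rfl | hy
      · exact absurd rfl hxy
      · exact (hno y hy).le
      · rw [norm_sub_rev]; exact (hno x hx).le
      · exact hM.2 x hx y hy hxy
    have := hmax _ hin
    rw [Finset.card_insert_of_notMem hnot] at this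
    omega
  choose! p hp hp' using hcov
  have hMne : M.Nonempty := by
    obtain ⟨i, hi⟩ := hS
    exact ⟨_, hp i hi⟩
  obtain ⟨x, hx, hxmax⟩ := Finset.exists_max_image M (fun x => (S.filter (fun i => p i = x)).card) hMne
  have hle : S.card ≤ (S.filter (fun i => p i = x)).card * M.card :=
    Finset.card_le_mul_card_image_of_maps_to hp _ hxmax
  refine ⟨S.filter (fun i => p i = x), Finset.filter_subset _ _, ?_, ?_, c + (R / 2) • x, ?_⟩
  · rw [← Finset.card_pos]
    by_contra h0
    have : (S.filter (fun i => p i = x)).card = 0 := by omega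
    rw [this] at hle
    have := Finset.card_pos.2 hS
    omega
  · calc S.card ≤ (S.filter (fun i => p i = x)).card * M.card := hle
      _ ≤ (S.filter (fun i => p i = x)).card * 5 ^ Module.finrank ℝ E := by gcongr
      _ = _ := mul_comm _ _
  · intro i hi
    rw [Finset.mem_filter] at hi
    have h1 := hp' i hi.1
    rw [hi.2] at h1
    have h2 : f i - (c + (R / 2) • x) = (R / 2) • (g i - x) := by
      simp only [g]
      rw [smul_sub, smul_smul]
      have : R / 2 * (2 / R) = 1 := by field_simp
      rw [this, one_smul]; abel
    rw [h2, norm_smul, Real.norm_of_nonneg (by positivity)]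
    nlinarith

lemma packing (S : Finset ι) (hS : S.Nonempty) (f : ι → E) (c : E) {R : ℝ} (hR : 0 < R)
    (hf : ∀ i ∈ S, ‖f i - c‖ ≤ R) (t : ℕ) : ∃ S' ⊆ S, S'.Nonempty ∧
      S.card ≤ 5 ^ (Module.finrank ℝ E * t) * S'.card ∧ ∃ c' : E, ∀ i ∈ S', ‖f i - c'‖ ≤ R / 2 ^ t := by
  induction t with
  | zero => exact ⟨S, le_rfl, hS, by simp, c, by simpa using hf⟩
  | succ n ih =>
    obtain ⟨S1, hS1, hne, hc, c1, h1⟩ := ih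
    obtain ⟨S2, hS2, hne2, hcc, c2, h2⟩ := packing_step S1 hne f c1 (by positivity) h1
    refine ⟨S2, hS2.trans hS1, hne2, ?_, c2, fun i hi => ?_⟩
    · calc S.card ≤ 5 ^ (Module.finrank ℝ E * n) * S1.card := hc
        _ ≤ 5 ^ (Module.finrank ℝ E * n) * (5 ^ (Module.finrank ℝ E) * S2.card) := by gcongr
        _ = _ := by ring
    · refine (h2 i hi).trans (le_of_eq ?_)
      rw [pow_succ]; field_simp

end packing

/-- packing for a quadratic form on a group of finite rank -/
lemma packing_q {G : Type*} [AddCommGroup G] [Module.Finite ℚ (ℚ ⊗[ℤ] G)] {q : G → ℝ}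
    (h0 : ∀ P, 0 ≤ q P) (hq : ∀ P Q, q (P + Q) + q (P - Q) = 2 * (q P + q Q))
    {ι : Type*} (S : Finset ι) (hS : S.Nonempty) (f : ι → G) {R : ℝ} (hR : 0 < R)
    (hf : ∀ i ∈ S, q (f i) ≤ R) (t : ℕ) : ∃ S' ⊆ S, S'.Nonempty ∧
      S.card ≤ 5 ^ (Module.finrank ℚ (ℚ ⊗[ℤ] G) * t) * S'.card ∧
      ∀ i ∈ S', ∀ j ∈ S', q (f i - f j) ≤ 4 * R / 4 ^ t := by
  obtain ⟨π, hπ⟩ := exists_euclid h0 hq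
  have hf' : ∀ i ∈ S, ‖π (f i) - π 0‖ ≤ Real.sqrt R := by
    intro i hi
    apply Real.le_sqrt_of_sq_le
    rw [hπ, sub_zero]; exact hf i hi
  obtain ⟨S', h1, h2, h3, c, h4⟩ := packing S hS (fun i => π (f i)) (π 0) (Real.sqrt_pos.2 hR) hf' t
  rw [finrank_euclideanSpace_fin] at h3
  refine ⟨S', h1, h2, h3, fun i hi j hj => ?_⟩
  rw [← hπ]
  have h5 : ‖π (f i) - π (f j)‖ ≤ 2 * (Real.sqrt R / 2 ^ t) := by
    calc ‖π (f i) - π (f j)‖ = ‖(π (f i) - c) - (π (f j) - c)‖ := by congr 1; abel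
      _ ≤ ‖π (f i) - c‖ + ‖π (f j) - c‖ := norm_sub_le _ _
      _ ≤ _ := by have := h4 i hi; have := h4 j hj; linarith
  calc ‖π (f i) - π (f j)‖ ^ 2 ≤ (2 * (Real.sqrt R / 2 ^ t)) ^ 2 := by gcongr
    _ = 4 * R / 4 ^ t := by
      rw [mul_pow, div_pow, Real.sq_sqrt hR.le, ← pow_mul, mul_comm t 2, pow_mul]; norm_num; ring

end APR

set_option linter.unusedSectionVars false
set_option linter.unusedVariables false
set_option linter.unusedSimpArgs false
namespace APR
open Polynomial Finset

theorem indep_aux (φ ψ : ℚ[X]) (hco : IsCoprime φ ψ) (m : ℕ) (hφ : φ.natDegree = m) (h0 : φ ≠ 0) :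
    ∀ (k : ℕ) (Cf : ℕ → ℚ[X]), (∀ b, (Cf b).degree < (m : WithBot ℕ)) →
      ∑ b ∈ range k, Cf b * (φ ^ b * ψ ^ (k - 1 - b)) = 0 → ∀ b < k, Cf b = 0 := by
  intro k
  induction k with
  | zero => intro Cf _ _ b hb; omega
  | succ k ih =>
    intro Cf hC hsum
    rw [Finset.sum_range_succ'] at hsum
    have hfac : ∀ b ∈ range k, Cf (b+1) * (φ ^ (b+1) * ψ ^ (k + 1 - 1 - (b+1))) =
        φ * (Cf (b+1) * (φ ^ b * ψ ^ (k - 1 - b))) := by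
      intro b hb
      have : k + 1 - 1 - (b+1) = k - 1 - b := by omega
      rw [this]; ring
    rw [Finset.sum_congr rfl hfac, ← Finset.mul_sum] at hsum
    have hdvd : φ ∣ Cf 0 * ψ ^ k := by
      refine ⟨-(∑ b ∈ range k, Cf (b+1) * (φ ^ b * ψ ^ (k - 1 - b))), ?_⟩
      simp only [pow_zero, one_mul, add_tsub_cancel_right, tsub_zero] at hsum
      linear_combination hsum
    have hd0 : φ ∣ Cf 0 := (IsCoprime.pow_right hco).dvd_of_dvd_mul_right hdvd
    have hz : Cf 0 = 0 := by
      apply Polynomial.eq_zero_of_dvd_of_degree_lt hd0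
      rw [Polynomial.degree_eq_natDegree h0, hφ]; exact hC 0
    rw [hz, zero_mul, add_zero] at hsum
    have hs2 := (mul_eq_zero.mp hsum).resolve_left h0
    have := ih (fun b => Cf (b+1)) (fun b => hC _) hs2
    intro b hb
    rcases b with _ | b
    · exact hz
    · exact this b (by omega)

/-- homogenised evaluation of an integer polynomial of degree below `n`. -/
theorem homog_eval (p : ℤ[X]) (n : ℕ) (hp : p.natDegree < n) (x z : ℤ) (hz : z ≠ 0) :
    ((∑ k : Fin n, x ^ (k:ℕ) * z ^ (k.rev : ℕ) * p.coeff k : ℤ) : ℚ) =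
      (z:ℚ) ^ (n-1) * (p.map (Int.castRingHom ℚ)).eval ((x:ℚ)/z) := by
  have hz' : (z:ℚ) ≠ 0 := by exact_mod_cast hz
  rw [Polynomial.eval_map, Polynomial.eval₂_eq_sum_range' _ hp, Finset.mul_sum,
    ← Fin.sum_univ_eq_sum_range (fun k => (z:ℚ)^(n-1) * ((Int.castRingHom ℚ) (p.coeff k) * ((x:ℚ)/z)^k))]
  push_cast
  apply Finset.sum_congr rfl
  intro k _
  have : n - 1 = (k:ℕ) + (k.rev : ℕ) := by rw [Fin.val_rev]; omega
  rw [this, pow_add, div_pow]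
  simp only [eq_intCast]
  field_simp

theorem dvd_vand (n : ℕ) (x z : Fin n → ℤ) (ℓ : ℤ) (h : ∀ i j, ℓ ∣ x i * z j - x j * z i) :
    ℓ ^ (∑ i : Fin n, (Finset.Ioi i).card) ∣ (Matrix.projVandermonde x z).det := by
  rw [Matrix.det_projVandermonde, ← Finset.prod_pow_eq_pow_sum]
  apply Finset.prod_dvd_prod_of_dvd
  intro i _
  rw [← Finset.prod_const]
  apply Finset.prod_dvd_prod_of_dvd
  intro j _
  exact h j i

theorem card_Ioi_sum (n : ℕ) : 2 * (∑ i : Fin n, (Finset.Ioi i).card) = n * (n-1) := by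
  simp only [Fin.card_Ioi]
  have := Fin.sum_univ_eq_sum_range (fun k => n - 1 - k) n
  rw [this, Finset.sum_range_reflect (fun k => k) n, mul_comm, Finset.sum_range_id_mul_two]

theorem det_bound (φ ψ : ℤ[X]) (m : ℕ) (hm : 0 < m)
    (hco : IsCoprime (φ.map (Int.castRingHom ℚ)) (ψ.map (Int.castRingHom ℚ)))
    (hφ : φ.natDegree = m) (hψ : ψ.natDegree ≤ m)
    (x z x' z' g : Fin (m*m) → ℤ) (hz : ∀ i, z i ≠ 0)
    (hne : ∀ i j, i ≠ j → x i * z j ≠ x j * z i)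
    (hP : ∀ i, (z i : ℚ)^m * (φ.map (Int.castRingHom ℚ)).eval ((x i:ℚ)/z i) = g i * x' i)
    (hQ : ∀ i, (z i : ℚ)^m * (ψ.map (Int.castRingHom ℚ)).eval ((x i:ℚ)/z i) = g i * z' i)
    (ℓ : ℤ) (hℓ : Prime ℓ) (hg : ∀ i, ¬ ℓ ∣ g i) (hdiv : ∀ i j, ℓ ∣ x i * z j - x j * z i)
    (H : ℤ) (hH : ∀ i, |x i| ≤ H ∧ |z i| ≤ H ∧ |x' i| ≤ H ∧ |z' i| ≤ H) :
    |ℓ| ^ (m*m*(m*m-1)/2) ≤ (m*m).factorial * (H ^ (2*(m-1)))^(m*m) := by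
  classical
  set e := (finProdFinEquiv : Fin m × Fin m ≃ Fin (m*m)) with he
  let pp : Fin m × Fin m → ℤ[X] := fun c => X^(c.1:ℕ) * (φ^(c.2:ℕ) * ψ^(m-1-(c.2:ℕ)))
  have hpp : ∀ c, (pp c).natDegree < m*m := by
    intro c
    have h1 : (pp c).natDegree ≤ (c.1:ℕ) + ((c.2:ℕ) * m + (m-1-(c.2:ℕ)) * m) := by
      refine natDegree_mul_le.trans ?_
      refine add_le_add (natDegree_X_pow_le _) (natDegree_mul_le.trans (add_le_add ?_ ?_))
      · refine natDegree_pow_le.trans ?_; rw [hφ]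
      · refine natDegree_pow_le.trans ?_; gcongr
    have h2 : (c.2:ℕ) + (m-1-(c.2:ℕ)) = m - 1 := by have := c.2.2; omega
    rw [← add_mul, h2] at h1
    have h3 : (c.1:ℕ) < m := c.1.2
    obtain ⟨k, rfl⟩ : ∃ k, m = k+1 := ⟨m-1, by omega⟩
    simp only [add_tsub_cancel_right] at h1
    nlinarith
  let Cf : Matrix (Fin (m*m)) (Fin (m*m)) ℤ := fun k j => (pp (e.symm j)).coeff k
  let M' : Matrix (Fin (m*m)) (Fin (m*m)) ℤ := fun i j =>
    x i ^ ((e.symm j).1:ℕ) * z i ^ (m-1-((e.symm j).1:ℕ)) *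
      (x' i ^ ((e.symm j).2:ℕ) * z' i ^ (m-1-((e.symm j).2:ℕ)))
  have hmat : Matrix.projVandermonde x z * Cf = Matrix.diagonal (fun i => g i ^ (m-1)) * M' := by
    ext i j
    rw [Matrix.diagonal_mul, Matrix.mul_apply]
    simp only [Matrix.projVandermonde_apply, Cf, M']
    have h1 := homog_eval (pp (e.symm j)) (m*m) (hpp _) (x i) (z i) (hz i)
    have hzi : (z i:ℚ) ≠ 0 := by exact_mod_cast hz i
    apply Int.cast_injective (α := ℚ)
    rw [h1]
    generalize e.symm j = c
    have ha : (c.1:ℕ) + (m-1-(c.1:ℕ)) = m-1 := by have := c.1.2; omega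
    have hb : (c.2:ℕ) + (m-1-(c.2:ℕ)) = m-1 := by have := c.2.2; omega
    have hn : m*m - 1 = (c.1:ℕ) + (m-1-(c.1:ℕ)) + (m * (c.2:ℕ) + m * (m-1-(c.2:ℕ))) := by
      rw [← mul_add, ha, hb]
      obtain ⟨k, rfl⟩ : ∃ k, m = k+1 := ⟨m-1, by omega⟩
      simp only [add_tsub_cancel_right]
      have : (k+1)*(k+1) = k + (k+1)*k + 1 := by ring
      omega
    simp only [pp, Polynomial.map_mul, Polynomial.map_pow, Polynomial.map_X, eval_mul, eval_pow, eval_X]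
    have hg' : (g i:ℚ)^(m-1) = (g i:ℚ)^(c.2:ℕ) * (g i:ℚ)^(m-1-(c.2:ℕ)) := by rw [← pow_add, hb]
    push_cast
    rw [hg', hn]
    calc _ = ((z i:ℚ)^(c.1:ℕ) * ((x i:ℚ)/z i)^(c.1:ℕ)) * (z i:ℚ)^(m-1-(c.1:ℕ)) *
          (((z i : ℚ)^m * (φ.map (Int.castRingHom ℚ)).eval ((x i:ℚ)/z i))^(c.2:ℕ) *
          ((z i : ℚ)^m * (ψ.map (Int.castRingHom ℚ)).eval ((x i:ℚ)/z i))^(m-1-(c.2:ℕ))) := by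
            rw [pow_add, pow_add, pow_add, pow_mul, pow_mul, mul_pow, mul_pow]; ring
      _ = _ := by
            rw [hP, hQ, ← mul_pow, mul_div_cancel₀ _ hzi, mul_pow, mul_pow]; ring
  have hdet := congrArg Matrix.det hmat
  rw [Matrix.det_mul, Matrix.det_mul, Matrix.det_diagonal] at hdet
  have hV0 : (Matrix.projVandermonde x z).det ≠ 0 := by
    rw [Matrix.det_projVandermonde]
    refine Finset.prod_ne_zero_iff.mpr fun i _ => Finset.prod_ne_zero_iff.mpr fun j hj => ?_
    have := hne j i (by rintro rfl; simp at hj)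
    exact sub_ne_zero.mpr this
  have hφ0 : φ ≠ 0 := by rintro rfl; simp at hφ; omega
  have hinj : Function.Injective (Int.castRingHom ℚ) := Int.cast_injective
  have hC0 : Cf.det ≠ 0 := by
    intro h0
    obtain ⟨v, hv, hv0⟩ := Matrix.exists_mulVec_eq_zero_iff.mpr h0
    apply hv
    have hsum : ∑ c : Fin m × Fin m, C (v (e c)) * pp c = 0 := by
      ext k
      rw [finset_sum_coeff]
      simp only [coeff_C_mul, coeff_zero]
      by_cases hk : k < m*m
      · have := congrFun hv0 ⟨k, hk⟩
        simp only [Matrix.mulVec, dotProduct, Cf, Pi.zero_apply] at this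
        rw [← this, ← Equiv.sum_comp e]
        apply Finset.sum_congr rfl
        intro c _
        rw [Equiv.symm_apply_apply]; ring
      · apply Finset.sum_eq_zero
        intro c _
        rw [coeff_eq_zero_of_natDegree_lt (lt_of_lt_of_le (hpp c) (not_lt.mp hk)), mul_zero]
    let D : ℕ → ℚ[X] := fun b => if hb : b < m then
      ∑ a : Fin m, C ((v (e (a, ⟨b, hb⟩)) : ℤ) : ℚ) * X^(a:ℕ) else 0
    have hDd : ∀ b, (D b).degree < (m : WithBot ℕ) := by
      intro b
      simp only [D]
      split_ifs with hb
      · exact degree_sum_fin_lt _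
      · simp
    have hsum2 : ∑ b ∈ range m, D b * ((φ.map (Int.castRingHom ℚ)) ^ b * (ψ.map (Int.castRingHom ℚ)) ^ (m - 1 - b)) = 0 := by
      have h3 := congrArg (Polynomial.map (Int.castRingHom ℚ)) hsum
      rw [Polynomial.map_zero, Polynomial.map_sum, Fintype.sum_prod_type_right] at h3
      rw [← h3, ← Fin.sum_univ_eq_sum_range (fun b => D b * ((φ.map (Int.castRingHom ℚ)) ^ b * (ψ.map (Int.castRingHom ℚ)) ^ (m - 1 - b)))]
      apply Finset.sum_congr rfl
      intro b _
      simp only [D, b.2, dif_pos, Finset.sum_mul]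
      apply Finset.sum_congr rfl
      intro a _
      simp [pp, mul_assoc]
    have hD0 := indep_aux _ _ hco m (by rw [natDegree_map_eq_of_injective hinj, hφ])
      ((Polynomial.map_ne_zero_iff hinj).mpr hφ0) m D hDd hsum2
    funext j
    obtain ⟨⟨a, b⟩, rfl⟩ := e.surjective j
    have h4 := hD0 b b.2
    simp only [D, b.2, dif_pos] at h4
    have h5 := congrArg (fun p => p.coeff (a:ℕ)) h4
    simp only [finset_sum_coeff, coeff_C_mul, coeff_X_pow, coeff_zero] at h5
    rw [Finset.sum_eq_single a] at h5
    · simpa using h5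
    · intro c _ hc
      rw [if_neg (fun h => hc (Fin.ext h.symm)), mul_zero]
    · simp
  have hM0 : M'.det ≠ 0 := by
    intro h0
    rw [h0, mul_zero] at hdet
    exact (mul_ne_zero hV0 hC0) hdet
  have hdvd : ℓ ^ (m*m*(m*m-1)/2) ∣ M'.det := by
    have h1 := dvd_vand (m*m) x z ℓ hdiv
    have h2 := card_Ioi_sum (m*m)
    have h3 : m*m*(m*m-1)/2 = ∑ i : Fin (m*m), (Finset.Ioi i).card := by omega
    rw [h3]
    refine hℓ.pow_dvd_of_dvd_mul_left _ ?_ (hdet ▸ (h1.mul_right Cf.det))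
    intro h4
    obtain ⟨i, _, h5⟩ := (Prime.dvd_finset_prod_iff hℓ _).mp h4
    exact hg i (hℓ.dvd_of_dvd_pow h5)
  have hle : |ℓ| ^ (m*m*(m*m-1)/2) ≤ |M'.det| := by
    rw [← abs_pow]
    have := Int.le_of_dvd (abs_pos.mpr hM0) ((abs_dvd_abs _ _).mpr hdvd)
    exact this
  refine hle.trans ?_
  have hmm : 0 < m*m := Nat.mul_pos hm hm
  have hH0 : 0 ≤ H := (abs_nonneg _).trans (hH ⟨0, hmm⟩).1
  have h6 := Matrix.det_le (A := M') (abv := AbsoluteValue.abs) (x := H^(2*(m-1))) ?_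
  · simpa using h6
  · intro i j
    simp only [AbsoluteValue.abs_apply, M']
    generalize e.symm j = c
    have ha : (c.1:ℕ) + (m-1-(c.1:ℕ)) = m-1 := by have := c.1.2; omega
    have hb : (c.2:ℕ) + (m-1-(c.2:ℕ)) = m-1 := by have := c.2.2; omega
    obtain ⟨q1, q2, q3, q4⟩ := hH i
    rw [abs_mul, abs_mul, abs_mul, abs_pow, abs_pow, abs_pow, abs_pow]
    calc _ ≤ (H^(c.1:ℕ) * H^(m-1-(c.1:ℕ))) * (H^(c.2:ℕ) * H^(m-1-(c.2:ℕ))) := by gcongr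
      _ = _ := by rw [← pow_add, ← pow_add, ha, hb, two_mul, pow_add]
end APR

set_option linter.unusedSectionVars false
set_option linter.unusedVariables false
set_option linter.unusedSimpArgs false
namespace APR
open Polynomial Finset

/-- binary quartic form with integer coefficients -/
def frm {R : Type*} [CommRing R] (c : Fin 5 → ℤ) (x z : R) : R :=
  ∑ i : Fin 5, (c i : R) * (x ^ (i:ℕ) * z ^ (4 - (i:ℕ)))

theorem frm_eq {R : Type*} [CommRing R] (c : Fin 5 → ℤ) (x z : R) :
    frm c x z = c 0 * z^4 + c 1 * (x * z^3) + c 2 * (x^2*z^2) + c 3 * (x^3*z) + c 4 * x^4 := by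
  simp [frm, Fin.sum_univ_five]

theorem frm_smul {R : Type*} [CommRing R] (c : Fin 5 → ℤ) (l x z : R) :
    frm c (l*x) (l*z) = l^4 * frm c x z := by
  rw [frm_eq, frm_eq]; ring

theorem frm_map {R S : Type*} [CommRing R] [CommRing S] (f : R →+* S) (c : Fin 5 → ℤ) (x z : R) :
    f (frm c x z) = frm c (f x) (f z) := by
  rw [frm_eq, frm_eq]; simp

def Bez (c d : Fin 5 → ℤ) (ρ : ℤ) : Prop :=
  ∀ (R : Type) [CommRing R] (x z : R), (∃ u v : R, u * frm c x z + v * frm d x z = ρ * x^7) ∧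
    (∃ u v : R, u * frm c x z + v * frm d x z = ρ * z^7)

noncomputable def itp (c d : Fin 5 → ℤ) : ℕ → ℤ[X] × ℤ[X]
  | 0 => (X, 1)
  | s+1 => (frm c (itp c d s).1 (itp c d s).2, frm d (itp c d s).1 (itp c d s).2)

theorem itp_deg (c d : Fin 5 → ℤ) (hc : c 4 ≠ 0) (hd : d 4 = 0) (s : ℕ) :
    (itp c d s).1.natDegree = 4^s ∧ (itp c d s).2.natDegree < 4^s := by
  induction s with
  | zero => simp [itp]
  | succ s ih =>
    obtain ⟨h1, h2⟩ := ih
    simp only [itp]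
    rw [pow_succ]
    generalize (itp c d s).1 = p at *
    generalize (itp c d s).2 = q at *
    generalize 4^s = m at *
    have hp0 : p ≠ 0 := by rintro rfl; simp at h1; omega
    have hb : ∀ (e : ℤ) (i : ℕ), i < 4 → ((e : ℤ[X]) * (p^i*q^(4-i))).natDegree < m*4 := by
      intro e i hi
      refine lt_of_le_of_lt (natDegree_mul_le) ?_
      rw [natDegree_intCast, zero_add]
      refine lt_of_le_of_lt (natDegree_mul_le.trans (add_le_add natDegree_pow_le natDegree_pow_le)) ?_
      rw [h1]
      interval_cases i <;> omega
    have hlow : ∀ e : Fin 5 → ℤ, ((e 0 : ℤ[X]) * (p^0*q^(4-0)) + e 1 * (p^1 * q^(4-1)) + e 2 * (p^2*q^(4-2)) + e 3 * (p^3*q^(4-3))).natDegree < m*4 := by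
      intro e
      refine lt_of_le_of_lt (natDegree_add_le _ _) (max_lt ?_ (hb _ _ (by norm_num)))
      refine lt_of_le_of_lt (natDegree_add_le _ _) (max_lt ?_ (hb _ _ (by norm_num)))
      refine lt_of_le_of_lt (natDegree_add_le _ _) (max_lt (hb _ _ (by norm_num)) (hb _ _ (by norm_num)))
    have heq : ∀ e : Fin 5 → ℤ, frm e p q = ((e 0 : ℤ[X]) * (p^0*q^(4-0)) + e 1 * (p^1 * q^(4-1)) + e 2 * (p^2*q^(4-2)) + e 3 * (p^3*q^(4-3))) + e 4 * p^4 := by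
      intro e; rw [frm_eq]; norm_num
    constructor
    · rw [heq]
      have h5 : ((c 4 : ℤ[X]) * p^4).natDegree = m*4 := by
        rw [show (c 4 : ℤ[X]) = C (c 4) by simp, natDegree_C_mul hc, natDegree_pow, h1, mul_comm]
      rw [natDegree_add_eq_right_of_natDegree_lt (by rw [h5]; exact hlow c), h5]
    · rw [heq, hd]
      simpa using hlow d

theorem itp_coprime (c d : Fin 5 → ℤ) (ρ : ℤ) (hρ : ρ ≠ 0) (hb : Bez c d ρ) (s : ℕ) :
    IsCoprime ((itp c d s).1.map (Int.castRingHom ℚ)) ((itp c d s).2.map (Int.castRingHom ℚ)) := by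
  induction s with
  | zero => simpa [itp] using isCoprime_one_right
  | succ s ih =>
    simp only [itp]
    have e : ∀ e, (frm e (itp c d s).1 (itp c d s).2).map (Int.castRingHom ℚ) =
      frm e ((itp c d s).1.map (Int.castRingHom ℚ)) ((itp c d s).2.map (Int.castRingHom ℚ)) :=
      fun e => frm_map (Polynomial.mapRingHom (Int.castRingHom ℚ)) e _ _
    rw [e, e]
    generalize (itp c d s).1.map (Int.castRingHom ℚ) = p at *
    generalize (itp c d s).2.map (Int.castRingHom ℚ) = q at *
    obtain ⟨⟨u1, v1, h1⟩, ⟨u2, v2, h2⟩⟩ := hb ℚ[X] p q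
    obtain ⟨a, b, hab⟩ := IsCoprime.pow (m := 7) (n := 7) ih
    have hu : (C ((ρ:ℚ)⁻¹) : ℚ[X]) * (ρ : ℚ[X]) = 1 := by
      rw [show (ρ : ℚ[X]) = C (ρ:ℚ) by simp, ← C_mul, inv_mul_cancel₀ (by exact_mod_cast hρ), C_1]
    refine ⟨C ((ρ:ℚ)⁻¹) * (a * u1 + b * u2), C ((ρ:ℚ)⁻¹) * (a * v1 + b * v2), ?_⟩
    linear_combination C ((ρ:ℚ)⁻¹) * a * h1 + C ((ρ:ℚ)⁻¹) * b * h2 + (a * p^7 + b*q^7) * hu + hab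

theorem dvd_rho (c d : Fin 5 → ℤ) (ρ : ℤ) (hb : Bez c d ρ) (x z g x' z' : ℤ) (hco : IsCoprime x z)
    (h1 : frm c x z = g * x') (h2 : frm d x z = g * z') : g ∣ ρ := by
  obtain ⟨⟨u1, v1, e1⟩, ⟨u2, v2, e2⟩⟩ := hb ℤ x z
  obtain ⟨a, b, hab⟩ := IsCoprime.pow (m := 7) (n := 7) hco
  rw [h1, h2] at e1 e2
  simp only [Int.cast_id] at e1 e2
  refine ⟨a * (u1 * x' + v1 * z') + b * (u2*x'+v2*z'), ?_⟩
  linear_combination -a * e1 - b * e2 - ρ * hab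

theorem itp_eval (c d : Fin 5 → ℤ) (X Z : ℕ → ℤ) (hz : Z 0 ≠ 0) (ℓ : ℤ) (hℓ : Prime ℓ)
    (hdbl : ∀ s, ∃ g : ℤ, ¬ ℓ ∣ g ∧ frm c (X s) (Z s) = g * X (s+1) ∧ frm d (X s) (Z s) = g * Z (s+1)) (s : ℕ) :
    ∃ g : ℤ, ¬ ℓ ∣ g ∧
     (Z 0 : ℚ)^(4^s) * ((itp c d s).1.map (Int.castRingHom ℚ)).eval ((X 0:ℚ)/Z 0) = g * X s ∧
     (Z 0 : ℚ)^(4^s) * ((itp c d s).2.map (Int.castRingHom ℚ)).eval ((X 0:ℚ)/Z 0) = g * Z s := by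
  have hz' : (Z 0 : ℚ) ≠ 0 := by exact_mod_cast hz
  induction s with
  | zero =>
    refine ⟨1, fun h => hℓ.not_isUnit (isUnit_of_dvd_one h), ?_, ?_⟩
    · simp [itp]; field_simp
    · simp [itp]
  | succ s ih =>
    obtain ⟨g, hg, h1, h2⟩ := ih
    obtain ⟨k, hk, h3, h4⟩ := hdbl s
    refine ⟨g^4*k, ?_, ?_⟩
    · intro h
      rcases hℓ.dvd_or_dvd h with h | h
      · exact hg (hℓ.dvd_of_dvd_pow h)
      · exact hk h
    have e : ∀ e, ((frm e (itp c d s).1 (itp c d s).2).map (Int.castRingHom ℚ)).eval ((X 0:ℚ)/Z 0) =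
      frm e (((itp c d s).1.map (Int.castRingHom ℚ)).eval ((X 0:ℚ)/Z 0)) (((itp c d s).2.map (Int.castRingHom ℚ)).eval ((X 0:ℚ)/Z 0)) :=
      fun e => frm_map ((Polynomial.evalRingHom ((X 0:ℚ)/Z 0)).comp (Polynomial.mapRingHom (Int.castRingHom ℚ))) e _ _
    simp only [itp]
    rw [e, e, pow_succ, pow_mul, ← frm_smul, ← frm_smul, h1, h2, frm_smul, frm_smul]
    have h3' := congrArg (Int.castRingHom ℚ) h3
    have h4' := congrArg (Int.castRingHom ℚ) h4
    rw [frm_map] at h3' h4'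
    simp only [eq_intCast] at h3' h4'
    rw [h3', h4']
    push_cast
    constructor <;> ring

theorem det_contra (m : ℕ) (Bd : ℝ) (hB0 : 0 ≤ Bd) (hm : 12 * (Bd+1) ≤ m) (H : ℤ) (hH : (H:ℝ) ≤ Real.exp Bd) (hH0 : 0 ≤ H)
    (ℓ : ℤ) (hℓ : 2 ≤ |ℓ|) (h : |ℓ| ^ (m*m*(m*m-1)/2) ≤ (m*m).factorial * (H ^ (2*(m-1)))^(m*m)) : False := by
  have hm12 : (12:ℝ) ≤ m := by nlinarith
  have hm12' : 12 ≤ m := by exact_mod_cast hm12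
  set n := m*m with hn
  have hn0 : 0 < n := by positivity
  have h1 : (2:ℝ) ^ (n*(n-1)/2) ≤ (n:ℝ)^n * ((Real.exp Bd)^(2*(m-1)))^n := by
    have h2 : (2:ℤ) ^ (n*(n-1)/2) ≤ |ℓ| ^ (n*(n-1)/2) := by gcongr
    have h3 : ((2:ℤ) ^ (n*(n-1)/2) : ℝ) ≤ (((n.factorial : ℤ) * (H ^ (2*(m-1)))^n : ℤ) : ℝ) := by exact_mod_cast h2.trans h
    push_cast at h3
    refine h3.trans ?_
    have hf : (n.factorial : ℝ) ≤ (n:ℝ)^n := by exact_mod_cast Nat.factorial_le_pow n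
    have hHr : (0:ℝ) ≤ H := by exact_mod_cast hH0
    gcongr
  have h4 := Real.log_le_log (by positivity) h1
  rw [Real.log_mul (by positivity) (by positivity), Real.log_pow, Real.log_pow, Real.log_pow, Real.log_pow, Real.log_exp] at h4
  have hexact : ((n*(n-1)/2 : ℕ) : ℝ) = (n:ℝ)*((m:ℝ)*m-1)/2 := by
    have h5 := card_Ioi_sum n
    have h6 : 2 * (n*(n-1)/2) = n*(n-1) := by omega
    have h7 : (2:ℝ) * ((n*(n-1)/2 : ℕ) : ℝ) = n * ((n-1 : ℕ):ℝ) := by exact_mod_cast h6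
    rw [Nat.cast_sub (by omega)] at h7
    have h8 : (n:ℝ) = m*m := by rw [hn]; push_cast; ring
    push_cast at h7
    rw [← h8]; linarith
  have hlogn : Real.log n ≤ 2 * (m-1) := by
    rw [hn]; push_cast
    rw [Real.log_mul (by positivity) (by positivity)]
    have := Real.log_le_sub_one_of_pos (x := m) (by positivity)
    linarith
  rw [hexact] at h4
  push_cast at h4
  rw [Nat.cast_sub (by omega)] at h4
  push_cast at h4
  have hnr : (0:ℝ) < n := by exact_mod_cast hn0
  have h9 : (n:ℝ) * (((m:ℝ)*m-1)/2 * Real.log 2) ≤ n * (2*(m-1) + 2*(m-1)*Bd) := by nlinarith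
  have h10 := le_of_mul_le_mul_left h9 hnr
  have hl2 : (0.69:ℝ) < Real.log 2 := by have := Real.log_two_gt_d9; linarith
  have h11 : ((m:ℝ)-1) * ((m+1)/2*Real.log 2) ≤ (m-1) * (2*(1+Bd)) := by nlinarith
  have h12 := le_of_mul_le_mul_left h11 (by linarith)
  nlinarith

theorem lemM (c d : Fin 5 → ℤ) (hc : c 4 ≠ 0) (hd : d 4 = 0) (ρ : ℤ) (hρ : ρ ≠ 0) (hb : Bez c d ρ)
    (ℓ : ℕ) (hℓ : ℓ.Prime) (hℓρ : ¬ (ℓ:ℤ) ∣ ρ) {ι : Type*} (S : Finset ι) (X Z : ι → ℕ → ℤ)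
    (hco : ∀ i s, IsCoprime (X i s) (Z i s))
    (hdbl : ∀ i s, ∃ g : ℤ, frm c (X i s) (Z i s) = g * X i (s+1) ∧ frm d (X i s) (Z i s) = g * Z i (s+1))
    (hz : ∀ i ∈ S, Z i 0 ≠ 0) (hne : ∀ i ∈ S, ∀ j ∈ S, i ≠ j → X i 0 * Z j 0 ≠ X j 0 * Z i 0)
    (t : ℕ) (Bd : ℝ) (hB0 : 0 ≤ Bd)
    (hB : ∀ i ∈ S, ((|X i 0| : ℤ):ℝ) ≤ Real.exp Bd ∧ ((|Z i 0| : ℤ):ℝ) ≤ Real.exp Bd ∧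
      ((|X i t| : ℤ):ℝ) ≤ Real.exp Bd ∧ ((|Z i t| : ℤ):ℝ) ≤ Real.exp Bd)
    (hm : 12 * (Bd + 1) ≤ (4:ℝ)^t) : S.card ≤ (ℓ+1) * (4^t*4^t) := by
  classical
  by_contra hcon
  push Not at hcon
  haveI : Fact ℓ.Prime := ⟨hℓ⟩
  let col : ι → Option (ZMod ℓ) := fun i => if (Z i 0 : ZMod ℓ) = 0 then none else some ((X i 0 : ZMod ℓ) / (Z i 0 : ZMod ℓ))
  have hcard : (Finset.univ : Finset (Option (ZMod ℓ))).card * (4^t*4^t) ≤ S.card := by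
    rw [Finset.card_univ, Fintype.card_option, ZMod.card]; exact hcon.le
  obtain ⟨y, _, hy⟩ := Finset.exists_le_card_fiber_of_mul_le_card_of_maps_to
    (s := S) (t := Finset.univ) (f := col) (fun i _ => Finset.mem_univ _) ⟨none, Finset.mem_univ _⟩ hcard
  obtain ⟨S', hS', hS'c⟩ := Finset.exists_subset_card_eq hy
  let e := (Finset.equivFinOfCardEq hS'c).symm
  have hmem : ∀ i, (e i : ι) ∈ S ∧ col (e i) = y := fun i => by
    have := hS' (e i).2
    simpa using this
  have hprime : Prime (ℓ:ℤ) := Nat.prime_iff_prime_int.mp hℓ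
  have hd' : ∀ i s, ∃ g : ℤ, ¬ (ℓ:ℤ) ∣ g ∧ frm c (X i s) (Z i s) = g * X i (s+1) ∧ frm d (X i s) (Z i s) = g * Z i (s+1) := by
    intro i s
    obtain ⟨g, h1, h2⟩ := hdbl i s
    exact ⟨g, fun h => hℓρ (h.trans (dvd_rho c d ρ hb _ _ _ _ _ (hco i s) h1 h2)), h1, h2⟩
  have hev := fun i : Fin (4^t*4^t) => itp_eval c d (X (e i)) (Z (e i)) (hz _ (hmem i).1) ℓ hprime (hd' _) t
  choose g hg1 hg2 hg3 using hev
  obtain ⟨hdeg1, hdeg2⟩ := itp_deg c d hc hd t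
  have key := det_bound (itp c d t).1 (itp c d t).2 (4^t) (by positivity) (itp_coprime c d ρ hρ hb t)
    hdeg1 hdeg2.le (fun i => X (e i) 0) (fun i => Z (e i) 0) (fun i => X (e i) t) (fun i => Z (e i) t)
    g (fun i => hz _ (hmem i).1)
    (fun i j hij => hne _ (hmem i).1 _ (hmem j).1 (fun h => hij (e.injective (Subtype.ext h))))
    hg2 hg3 ℓ hprime hg1 ?_ ⌊Real.exp Bd⌋ ?_
  · refine det_contra (4^t) Bd hB0 (by push_cast; exact hm) _ (Int.floor_le _) ?_ ℓ ?_ key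
    · exact Int.floor_nonneg.mpr (Real.exp_pos _).le
    · have := hℓ.two_le
      rw [abs_of_nonneg (by positivity)]; exact_mod_cast this
  · intro i j
    have h1 := (hmem i).2
    have h2 := (hmem j).2
    rw [← h2] at h1
    simp only [col] at h1
    apply (ZMod.intCast_zmod_eq_zero_iff_dvd _ ℓ).mp
    push_cast
    split_ifs at h1 with p q q
    · rw [p, q]; ring
    · rw [Option.some.injEq, div_eq_div_iff p q] at h1
      rw [h1]; ring
  · intro i
    obtain ⟨a1, a2, a3, a4⟩ := hB _ (hmem i).1
    exact ⟨Int.le_floor.mpr a1, Int.le_floor.mpr a2, Int.le_floor.mpr a3, Int.le_floor.mpr a4⟩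
end APR

set_option linter.unusedSectionVars false
set_option linter.unusedVariables false
set_option linter.unusedSimpArgs false
namespace APR
open Finset

theorem exists_prime (ρ : ℤ) (hρ : ρ ≠ 0) (k : ℕ) (hk : 1 ≤ k) (hR : Real.log (|ρ| : ℤ) ≤ k) :
    ∃ ℓ : ℕ, ℓ.Prime ∧ ¬ (ℓ:ℤ) ∣ ρ ∧ ℓ ≤ (10*k)^2 := by
  by_contra hcon
  push Not at hcon
  set n := (10*k)^2 with hn
  have hsub : (Finset.range (n+1)).filter Nat.Prime ⊆ ρ.natAbs.primeFactors := by
    intro p hp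
    rw [Finset.mem_filter, Finset.mem_range] at hp
    rw [Nat.mem_primeFactors]
    refine ⟨hp.2, ?_, by simpa using hρ⟩
    by_contra h
    have := hcon p hp.2 (by rw [← Int.natCast_dvd] at h; by_contra h2; exact h (by simpa using h2))
    omega
  have hpi : Nat.primeCounting n ≤ ρ.natAbs.primeFactors.card := by
    have : Nat.primeCounting n = ((Finset.range (n+1)).filter Nat.Prime).card := by
      rw [Nat.primeCounting, Nat.primeCounting', Nat.count_eq_card_filter_range]
    rw [this]; exact Finset.card_le_card hsub
  have h2 : 2 ^ ρ.natAbs.primeFactors.card ≤ ρ.natAbs := by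
    have h3 : 2 ^ ρ.natAbs.primeFactors.card ≤ ∏ p ∈ ρ.natAbs.primeFactors, p := by
      rw [← Finset.prod_const]
      exact Finset.prod_le_prod' fun p hp => (Nat.prime_of_mem_primeFactors hp).two_le
    exact h3.trans (Nat.le_of_dvd (by positivity) (Nat.prod_primeFactors_dvd _))
  have h4 : (Nat.primeCounting n : ℝ) * Real.log 2 ≤ k := by
    have h5 : (2:ℝ)^(Nat.primeCounting n) ≤ ((|ρ| : ℤ) : ℝ) := by
      have h6 : 2 ^ (Nat.primeCounting n) ≤ ρ.natAbs := (Nat.pow_le_pow_right (by norm_num) hpi).trans h2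
      have h7 : ((ρ.natAbs : ℕ) : ℝ) = ((|ρ| : ℤ) : ℝ) := by
        rw [Int.abs_eq_natAbs]; simp
      rw [← h7]; exact_mod_cast h6
    have := Real.log_le_log (by positivity) h5
    rw [Real.log_pow] at this
    linarith
  have hkr : (1:ℝ) ≤ k := by exact_mod_cast hk
  have hnr : (n:ℝ) = 100*(k:ℝ)^2 := by rw [hn]; push_cast; ring
  have hlog10 : Real.log (10*(k:ℝ)) ≤ 10*k-1 := Real.log_le_sub_one_of_pos (by positivity)
  have hlogn : Real.log n = 2 * Real.log (10*(k:ℝ)) := by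
    rw [hn]; push_cast; rw [Real.log_pow]; push_cast; ring
  have hl2 : (0.69:ℝ) < Real.log 2 := by have := Real.log_two_gt_d9; linarith
  have hl2' : Real.log 2 < 0.7 := by have := Real.log_two_lt_d9; linarith
  have hlogn1 : Real.log (n+1) ≤ 20 * k := by
    have : Real.log (n+1) ≤ Real.log (2*n) := by
      apply Real.log_le_log (by positivity); rw [hnr]; nlinarith
    rw [Real.log_mul (by norm_num) (by rw [hnr]; positivity)] at this
    linarith
  have hlpos : 0 < Real.log n := by
    apply Real.log_pos; rw [hnr]; nlinarith
  have h8 := Chebyshev.pi_ge n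
  rw [div_le_iff₀ hlpos] at h8
  have h9 : 49 * (k:ℝ)^2 ≤ Nat.primeCounting n * (20*k) := by
    have h10 : (Nat.primeCounting n : ℝ) * Real.log n ≤ Nat.primeCounting n * (20*k) := by
      gcongr; linarith
    have h12 : 69 * (k:ℝ)^2 ≤ n * Real.log 2 := by rw [hnr]; nlinarith
    nlinarith
  have h11 : 2.45 * (k:ℝ) ≤ Nat.primeCounting n := by
    by_contra h; push Not at h
    nlinarith
  nlinarith
end APR

set_option linter.unusedSectionVars false
set_option linter.unusedVariables false
set_option linter.unusedSimpArgs false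
namespace APR
open Finset

section basechange
open NumberField Height
variable {K : Type*} [Field K] [NumberField K]

theorem iSup_fin_one (v : FinitePlace K) (a b : ℤ) (h : IsCoprime a b) :
    ⨆ i, v ((![(a:K), (b:K)] : Fin 2 → K) i) = 1 := by
  have hv : IsNonarchimedean (v ·) := FinitePlace.add_le v
  have H (n : ℤ) : v n ≤ 1 := IsNonarchimedean.apply_intCast_le_one hv
  obtain ⟨s, t, hst⟩ := h
  have h1 : (s:K) * a + t * b = 1 := by exact_mod_cast hst
  have h2 : 1 ≤ max (v a) (v b) := by
    have h3 := hv (s * a) (t * b)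
    simp only [h1, map_one, map_mul] at h3
    refine h3.trans (max_le_max ?_ ?_)
    · exact mul_le_of_le_one_left (apply_nonneg v _) (H _)
    · exact mul_le_of_le_one_left (apply_nonneg v _) (H _)
  apply le_antisymm
  · apply ciSup_le
    intro i
    fin_cases i
    · exact H a
    · exact H b
  · refine h2.trans (max_le ?_ ?_)
    · exact Finite.le_ciSup_of_le (0 : Fin 2) (le_refl _)
    · exact Finite.le_ciSup_of_le (1 : Fin 2) (le_refl _)

theorem logHeight₁_rat (q : ℚ) : logHeight₁ (q : K) = totalWeight K * logHeight₁ q := by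
  have hq : (q : K) = (q.num : K) / (q.den : ℤ) := by
    conv_lhs => rw [← Rat.num_div_den q]
    push_cast; rfl
  have hd : ((q.den : ℤ) : K) ≠ 0 := by exact_mod_cast q.den_nz
  have hco : IsCoprime q.num (q.den:ℤ) := Rat.isCoprime_num_den q
  have hne : (![(q.num:K), ((q.den:ℤ):K)] : Fin 2 → K) ≠ 0 := by
    intro h; exact hd (congrFun h 1)
  rw [Rat.logHeight₁_eq_log_max, hq, logHeight₁_eq_log_mulHeight₁, mulHeight₁_div_eq_mulHeight,
    NumberField.mulHeight_eq hne, finprod_eq_one_of_forall_eq_one (fun v => iSup_fin_one v _ _ hco), mul_one]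
  have h1 : ∀ v : InfinitePlace K, (⨆ i, v ((![(q.num:K), ((q.den:ℤ):K)] : Fin 2 → K) i)) = ((max q.num.natAbs q.den : ℕ) : ℝ) := by
    intro v
    have ha : ∀ n : ℤ, v (n:K) = |(n:ℝ)| := by
      intro n
      rw [← v.norm_embedding_eq]
      simp
    have hA : v (q.num:K) = (q.num.natAbs : ℝ) := by rw [ha, Nat.cast_natAbs, Int.cast_abs]
    have hB : v ((q.den:ℤ):K) = (q.den : ℝ) := by rw [ha]; simp
    rw [Nat.cast_max]
    apply le_antisymm
    · apply ciSup_le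
      intro i
      fin_cases i
      · exact hA.le.trans (le_max_left _ _)
      · exact hB.le.trans (le_max_right _ _)
    · refine (max_le ?_ ?_)
      · exact Finite.le_ciSup_of_le (0 : Fin 2) hA.ge
      · exact Finite.le_ciSup_of_le (1 : Fin 2) hB.ge
  simp_rw [h1]
  rw [Finset.prod_pow_eq_pow_sum, Real.log_pow, NumberField.totalWeight_eq_sum_mult]
end basechange

def frm3 {R : Type*} [CommRing R] (c : Fin 4 → ℤ) (x z : R) : R :=
  c 0 * z^3 + c 1 * (x * z^2) + c 2 * (x^2*z) + c 3 * x^3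

/-- Lattes data: a pair of coprime quartic forms with bounded Bezout certificates. -/
structure LD (c d : Fin 5 → ℤ) (ρ : ℤ) (M : ℝ) : Prop where
  c4 : c 4 ≠ 0
  d4 : d 4 = 0
  rho : ρ ≠ 0
  bez : Bez c d ρ
  lrho : Real.log (|ρ| : ℤ) ≤ M
  up : ∀ x z H : ℤ, |x| ≤ H → |z| ≤ H → (|frm c x z| : ℤ) ≤ Real.exp M * H^4 ∧ (|frm d x z| : ℤ) ≤ Real.exp M * H^4
  low : ∀ x z H T : ℤ, |x| ≤ H → |z| ≤ H → |frm c x z| ≤ T → |frm d x z| ≤ T →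
    ((|ρ * x^7| : ℤ) : ℝ) ≤ Real.exp M * H^3 * T ∧ ((|ρ * z^7| : ℤ) : ℝ) ≤ Real.exp M * H^3 * T

theorem frm_abs (c : Fin 5 → ℤ) (E : ℤ) (hc : ∀ i, |c i| ≤ E) (x z H : ℤ) (hx : |x| ≤ H) (hz : |z| ≤ H) :
    |frm c x z| ≤ 5 * E * H^4 := by
  have hH : 0 ≤ H := (abs_nonneg _).trans hx
  have hE : 0 ≤ E := (abs_nonneg _).trans (hc 0)
  unfold frm
  refine (Finset.abs_sum_le_sum_abs _ _).trans ?_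
  have : ∀ i ∈ (Finset.univ : Finset (Fin 5)), |((c i : ℤ) : ℤ) * (x^(i:ℕ) * z^(4-(i:ℕ)))| ≤ E * H^4 := by
    intro i _
    rw [abs_mul, abs_mul, abs_pow, abs_pow]
    have h4 : H^4 = H^(i:ℕ) * H^(4-(i:ℕ)) := by rw [← pow_add]; congr 1; omega
    rw [h4]
    have := hc i
    gcongr
  refine (Finset.sum_le_sum this).trans ?_
  simp; linarith

theorem frm3_abs (c : Fin 4 → ℤ) (E : ℤ) (hc : ∀ i, |c i| ≤ E) (x z H : ℤ) (hx : |x| ≤ H) (hz : |z| ≤ H) :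
    |frm3 c x z| ≤ 4 * E * H^3 := by
  have hH : 0 ≤ H := (abs_nonneg _).trans hx
  have hE : 0 ≤ E := (abs_nonneg _).trans (hc 0)
  unfold frm3
  simp only [Int.cast_id]
  have h0 : |c 0 * z^3| ≤ E * H^3 := by
    rw [abs_mul, abs_pow]; have := hc 0; gcongr
  have h1 : |c 1 * (x * z^2)| ≤ E * H^3 := by
    rw [abs_mul, abs_mul, abs_pow]; have := hc 1
    calc _ ≤ E * (H * H^2) := by gcongr
      _ = _ := by ring
  have h2 : |c 2 * (x^2 * z)| ≤ E * H^3 := by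
    rw [abs_mul, abs_mul, abs_pow]; have := hc 2
    calc _ ≤ E * (H^2 * H) := by gcongr
      _ = _ := by ring
  have h3 : |c 3 * x^3| ≤ E * H^3 := by
    rw [abs_mul, abs_pow]; have := hc 3; gcongr
  have a1 := abs_add_le (c 0 * z^3 + c 1 * (x * z^2) + c 2 * (x^2*z)) (c 3 * x^3)
  have a2 := abs_add_le (c 0 * z^3 + c 1 * (x * z^2)) (c 2 * (x^2*z))
  have a3 := abs_add_le (c 0 * z^3) (c 1 * (x * z^2))
  linarith

theorem LD.mk' (c d : Fin 5 → ℤ) (f1 g1 f2 g2 : Fin 4 → ℤ) (ρ E : ℤ) (M : ℝ) (c4 : c 4 ≠ 0) (d4 : d 4 = 0) (rho : ρ ≠ 0)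
    (b1 : ∀ (R : Type) [CommRing R] (x z : R), frm3 f1 x z * frm c x z + frm3 g1 x z * frm d x z = ρ * x^7)
    (b2 : ∀ (R : Type) [CommRing R] (x z : R), frm3 f2 x z * frm c x z + frm3 g2 x z * frm d x z = ρ * z^7)
    (hc : ∀ i, |c i| ≤ E) (hd : ∀ i, |d i| ≤ E) (hf1 : ∀ i, |f1 i| ≤ E) (hg1 : ∀ i, |g1 i| ≤ E)
    (hf2 : ∀ i, |f2 i| ≤ E) (hg2 : ∀ i, |g2 i| ≤ E) (hρ : |ρ| ≤ E) (hE : 8 * (E:ℝ) ≤ Real.exp M) : LD c d ρ M := by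
  have hE0 : 0 ≤ E := (abs_nonneg _).trans hρ
  have hE0r : (0:ℝ) ≤ E := by exact_mod_cast hE0
  refine ⟨c4, d4, rho, fun R _ x z => ⟨⟨_, _, b1 R x z⟩, ⟨_, _, b2 R x z⟩⟩, ?_, ?_, ?_⟩
  · rw [Real.log_le_iff_le_exp (by exact_mod_cast abs_pos.mpr rho)]
    have : ((|ρ| : ℤ):ℝ) ≤ E := by exact_mod_cast hρ
    linarith
  · intro x z H hx hz
    have hH : 0 ≤ H := (abs_nonneg _).trans hx
    have hHr : (0:ℝ) ≤ (H:ℝ)^4 := by positivity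
    have h1 : ((|frm c x z| : ℤ):ℝ) ≤ 5 * E * H^4 := by exact_mod_cast frm_abs c E hc x z H hx hz
    have h2 : ((|frm d x z| : ℤ):ℝ) ≤ 5 * E * H^4 := by exact_mod_cast frm_abs d E hd x z H hx hz
    constructor
    · refine h1.trans ?_; gcongr; linarith
    · refine h2.trans ?_; gcongr; linarith
  · intro x z H T hx hz hF hG
    have hH : 0 ≤ H := (abs_nonneg _).trans hx
    have hT : 0 ≤ T := (abs_nonneg _).trans hF
    have key : ∀ f g : Fin 4 → ℤ, (∀ i, |f i| ≤ E) → (∀ i, |g i| ≤ E) → ((|frm3 f x z * frm c x z + frm3 g x z * frm d x z| : ℤ):ℝ) ≤ Real.exp M * H^3 * T := by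
      intro f g hf hg
      have h1 : |frm3 f x z * frm c x z + frm3 g x z * frm d x z| ≤ 8 * E * H^3 * T := by
        refine (abs_add_le _ _).trans ?_
        rw [abs_mul, abs_mul]
        have q1 := frm3_abs f E hf x z H hx hz
        have q2 := frm3_abs g E hg x z H hx hz
        have q3 : |frm3 f x z| * |frm c x z| ≤ (4*E*H^3) * T := by gcongr
        have q4 : |frm3 g x z| * |frm d x z| ≤ (4*E*H^3) * T := by gcongr
        linarith
      have h2 : ((|frm3 f x z * frm c x z + frm3 g x z * frm d x z| : ℤ):ℝ) ≤ 8 * E * H^3 * T := by exact_mod_cast h1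
      refine h2.trans ?_
      have : (0:ℝ) ≤ H := by exact_mod_cast hH
      have : (0:ℝ) ≤ T := by exact_mod_cast hT
      gcongr
    have r1 := b1 ℤ x z
    have r2 := b2 ℤ x z
    simp only [Int.cast_id] at r1 r2
    exact ⟨r1 ▸ key f1 g1 hf1 hg1, r2 ▸ key f2 g2 hf2 hg2⟩

theorem LD.dbl {c d ρ M} (h : LD c d ρ M) (x z x' z' g : ℤ) (hco : IsCoprime x z) (hco' : IsCoprime x' z')
    (h1 : frm c x z = g * x') (h2 : frm d x z = g * z') :
    |Real.log (max |x'| |z'| : ℤ) - 4 * Real.log (max |x| |z| : ℤ)| ≤ M := by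
  set H := max |x| |z| with hH
  set H' := max |x'| |z'| with hH'
  have hx : |x| ≤ H := le_max_left _ _
  have hz : |z| ≤ H := le_max_right _ _
  have pos : ∀ a b : ℤ, IsCoprime a b → 0 < max |a| |b| := by
    intro a b hab
    by_contra hcon
    push Not at hcon
    have ha : a = 0 := abs_nonpos_iff.mp ((le_max_left _ _).trans hcon)
    have hb : b = 0 := abs_nonpos_iff.mp ((le_max_right _ _).trans hcon)
    rw [ha, hb] at hab
    exact not_isCoprime_zero_zero hab
  have hHp : 0 < H := pos _ _ hco
  have hHp' : 0 < H' := pos _ _ hco'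
  have hg : g ∣ ρ := dvd_rho c d ρ h.bez x z g x' z' hco h1 h2
  have hg0 : g ≠ 0 := fun h0 => h.rho (by rw [h0] at hg; exact zero_dvd_iff.mp hg)
  have hgρ : |g| ≤ |ρ| := Int.le_of_dvd (abs_pos.mpr h.rho) ((abs_dvd_abs _ _).mpr hg)
  have hg1 : 1 ≤ |g| := Int.one_le_abs hg0
  have hHr : (0:ℝ) < H := by exact_mod_cast hHp
  have hHr' : (0:ℝ) < H' := by exact_mod_cast hHp'
  obtain ⟨u1, u2⟩ := h.up x z H hx hz
  have e1 : |frm c x z| = |g| * |x'| := by rw [h1, abs_mul]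
  have e2 : |frm d x z| = |g| * |z'| := by rw [h2, abs_mul]
  have up : (H':ℝ) ≤ Real.exp M * H^4 := by
    rcases le_total |x'| |z'| with hc | hc
    · have : H' ≤ |frm d x z| := by
        rw [hH', max_eq_right hc, e2]; nlinarith [abs_nonneg z']
      have : (H':ℝ) ≤ (|frm d x z| : ℤ) := by exact_mod_cast this
      linarith
    · have : H' ≤ |frm c x z| := by
        rw [hH', max_eq_left hc, e1]; nlinarith [abs_nonneg x']
      have : (H':ℝ) ≤ (|frm c x z| : ℤ) := by exact_mod_cast this
      linarith
  have hρr : (0:ℝ) < (|ρ| : ℤ) := by exact_mod_cast abs_pos.mpr h.rho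
  obtain ⟨l1, l2⟩ := h.low x z H (|ρ| * H') hx hz
    (by rw [e1]; have := le_max_left |x'| |z'|; gcongr)
    (by rw [e2]; have := le_max_right |x'| |z'|; gcongr)
  have low : (H:ℝ)^4 ≤ Real.exp M * H' := by
    have hl : ((|ρ| : ℤ):ℝ) * (H:ℝ)^7 ≤ Real.exp M * H^3 * (|ρ| * H' : ℤ) := by
      rcases le_total |x| |z| with hc | hc
      · have : H = |z| := by rw [hH, max_eq_right hc]
        rw [abs_mul, abs_pow, ← this] at l2
        push_cast at l2 ⊢
        exact l2
      · have : H = |x| := by rw [hH, max_eq_left hc]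
        rw [abs_mul, abs_pow, ← this] at l1
        push_cast at l1 ⊢
        exact l1
    rw [Int.cast_mul] at hl
    have : (((|ρ| : ℤ):ℝ) * (H:ℝ)^3) * (H:ℝ)^4 ≤ (((|ρ| : ℤ):ℝ) * (H:ℝ)^3) * (Real.exp M * H') := by
      calc _ = ((|ρ| : ℤ):ℝ) * (H:ℝ)^7 := by ring
        _ ≤ _ := hl
        _ = _ := by ring
    exact le_of_mul_le_mul_left this (by positivity)
  have lu := Real.log_le_log hHr' up
  have ll := Real.log_le_log (by positivity) low
  rw [Real.log_mul (by positivity) (by positivity), Real.log_exp] at lu ll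
  rw [Real.log_pow] at lu ll
  push_cast at lu ll
  rw [abs_le]; constructor <;> linarith

theorem LD_zero (M : ℝ) (hM : 70 ≤ M) : LD ![0, -512, 192, -24, 1] ![64, 192, 192, 64, 0] 1259712 M := by
  refine LD.mk' _ _ ![1245184, 3743744, 3756544, 1259712] ![0, 9961472, -3670016, 413696]
    ![6464, 7168, 2432, 0] ![19683, -7337, 914, -38] _ 10000000 _ (by simp) (by simp) (by norm_num) ?_ ?_ ?_ ?_ ?_ ?_ ?_ ?_ (by norm_num) ?_
  · intro R _ x z; rw [frm_eq, frm_eq]; simp [frm3]; ring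
  · intro R _ x z; rw [frm_eq, frm_eq]; simp [frm3]; ring
  · intro i; fin_cases i <;> simp
  · intro i; fin_cases i <;> simp
  · intro i; fin_cases i <;> simp
  · intro i; fin_cases i <;> simp
  · intro i; fin_cases i <;> simp
  · intro i; fin_cases i <;> simp
  · refine le_trans ?_ (Real.exp_le_exp.mpr hM)
    have h := Real.add_one_le_exp (7:ℝ)
    have : Real.exp 70 = (Real.exp 7)^10 := by rw [← Real.exp_nat_mul]; norm_num
    rw [this]
    have : (8:ℝ)^10 ≤ (Real.exp 7)^10 := by gcongr; linarith
    push_cast; linarith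

theorem LD_1728 (M : ℝ) (hM : 70 ≤ M) : LD ![1, -4, 6, -4, 1] ![0, 16, 32, 16, 0] 256 M := by
  refine LD.mk' _ _ ![0, 208, 448, 256] ![-13, 50, -69, 36]
    ![256, 448, 208, 0] ![36, -69, 50, -13] _ 1000 _ (by simp) (by simp) (by norm_num) ?_ ?_ ?_ ?_ ?_ ?_ ?_ ?_ (by norm_num) ?_
  · intro R _ x z; rw [frm_eq, frm_eq]; simp [frm3]; ring
  · intro R _ x z; rw [frm_eq, frm_eq]; simp [frm3]; ring
  · intro i; fin_cases i <;> simp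
  · intro i; fin_cases i <;> simp
  · intro i; fin_cases i <;> simp
  · intro i; fin_cases i <;> simp
  · intro i; fin_cases i <;> simp
  · intro i; fin_cases i <;> simp
  · refine le_trans ?_ (Real.exp_le_exp.mpr hM)
    have h := Real.add_one_le_exp (7:ℝ)
    have : Real.exp 70 = (Real.exp 7)^10 := by rw [← Real.exp_nat_mul]; norm_num
    rw [this]
    have : (8:ℝ)^10 ≤ (Real.exp 7)^10 := by gcongr; linarith
    push_cast; linarith

theorem mono_bd (α β Q : ℤ) (ha : |α| ≤ Q) (hb : |β| ≤ Q) (hQ : 1 ≤ Q) (i j : ℕ) (hij : i + j ≤ 7) :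
    |α^i*β^j| ≤ Q^7 := by
  rw [abs_mul, abs_pow, abs_pow]
  calc |α|^i*|β|^j ≤ Q^i*Q^j := by gcongr
    _ = Q^(i+j) := by rw [pow_add]
    _ ≤ Q^7 := pow_le_pow_right₀ hQ hij

theorem mono_bd2 (α β Q : ℤ) (ha : |α| ≤ Q) (hb : |β| ≤ Q) (hQ : 1 ≤ Q) (i j i' j' : ℕ) (hij : i + j ≤ 7) (hij' : i' + j' ≤ 7)
    (s t : ℤ) (hst : |s| + |t| ≤ 250) (v : ℤ) (hv : v = s*(α^i*β^j) + t*(α^i'*β^j')) :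
    |v| ≤ 250*Q^7 := by
  have h1 := mono_bd α β Q ha hb hQ i j hij
  have h2 := mono_bd α β Q ha hb hQ i' j' hij'
  have hQ7 : 0 ≤ Q^7 := by positivity
  rw [hv]
  refine (abs_add_le _ _).trans ?_
  rw [abs_mul s, abs_mul t]
  have h3 : |s| * |α^i*β^j| ≤ |s| * Q^7 := by gcongr
  have h4 : |t| * |α^i'*β^j'| ≤ |t| * Q^7 := by gcongr
  nlinarith

theorem LD_gen (α β Q : ℤ) (h0 : ℝ) (ha : |α| ≤ Q) (hb : |β| ≤ Q) (hα : α ≠ 0) (hβ : β ≠ 0) (hαβ : 4*α+27*β ≠ 0)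
    (hQ : (Q:ℝ) ≤ 7000 * Real.exp (h0 - 1)) (h01 : 1 ≤ h0) :
    LD ![α^2, -8*α*β, -2*α*β, 0, β^2] ![4*α*β, 4*α*β, 0, 4*β^2, 0] (4*β^4*α^2*(4*α+27*β)) (80*h0) := by
  have hQ1 : 1 ≤ Q := (Int.one_le_abs hα).trans ha
  refine LD.mk' _ _ ![12*α^4*β+96*α^3*β^2, 12*α^4*β+88*α^3*β^2, -4*α^3*β^2, 16*α^3*β^2+108*α^2*β^3]
    ![-3*α^5-24*α^4*β, 26*α^4*β+192*α^3*β^2, 5*α^4*β+32*α^3*β^2, α^3*β^2]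
    ![16*α*β^4, 0, 12*β^5, 0] ![27*α*β^4, 5*α*β^4, 0, -3*β^5] _ (250*Q^7) _ ?_ (by simp) ?_ ?_ ?_ ?_ ?_ ?_ ?_ ?_ ?_ ?_ ?_
  · simpa using hβ
  · simp [hα, hβ, hαβ]
  · intro R _ x z; rw [frm_eq, frm_eq]; simp [frm3]; ring
  · intro R _ x z; rw [frm_eq, frm_eq]; simp [frm3]; ring
  · intro i; fin_cases i
    · exact mono_bd2 α β Q ha hb hQ1 2 0 0 0 (by norm_num) (by norm_num) 1 0 (by norm_num) _ (by simp)
    · exact mono_bd2 α β Q ha hb hQ1 1 1 0 0 (by norm_num) (by norm_num) (-8) 0 (by norm_num) _ (by simp; ring)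
    · exact mono_bd2 α β Q ha hb hQ1 1 1 0 0 (by norm_num) (by norm_num) (-2) 0 (by norm_num) _ (by simp; ring)
    · exact mono_bd2 α β Q ha hb hQ1 1 1 0 0 (by norm_num) (by norm_num) 0 0 (by norm_num) _ (by simp)
    · exact mono_bd2 α β Q ha hb hQ1 0 2 0 0 (by norm_num) (by norm_num) 1 0 (by norm_num) _ (by simp)
  · intro i; fin_cases i
    · exact mono_bd2 α β Q ha hb hQ1 1 1 0 0 (by norm_num) (by norm_num) 4 0 (by norm_num) _ (by simp; ring)
    · exact mono_bd2 α β Q ha hb hQ1 1 1 0 0 (by norm_num) (by norm_num) 4 0 (by norm_num) _ (by simp; ring)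
    · exact mono_bd2 α β Q ha hb hQ1 1 1 0 0 (by norm_num) (by norm_num) 0 0 (by norm_num) _ (by simp)
    · exact mono_bd2 α β Q ha hb hQ1 0 2 0 0 (by norm_num) (by norm_num) 4 0 (by norm_num) _ (by simp)
    · exact mono_bd2 α β Q ha hb hQ1 0 2 0 0 (by norm_num) (by norm_num) 0 0 (by norm_num) _ (by simp)
  · intro i; fin_cases i
    · exact mono_bd2 α β Q ha hb hQ1 4 1 3 2 (by norm_num) (by norm_num) 12 96 (by norm_num) _ (by simp; ring)
    · exact mono_bd2 α β Q ha hb hQ1 4 1 3 2 (by norm_num) (by norm_num) 12 88 (by norm_num) _ (by simp; ring)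
    · exact mono_bd2 α β Q ha hb hQ1 4 1 3 2 (by norm_num) (by norm_num) 0 (-4) (by norm_num) _ (by simp; ring)
    · exact mono_bd2 α β Q ha hb hQ1 3 2 2 3 (by norm_num) (by norm_num) 16 108 (by norm_num) _ (by simp; ring)
  · intro i; fin_cases i
    · exact mono_bd2 α β Q ha hb hQ1 5 0 4 1 (by norm_num) (by norm_num) (-3) (-24) (by norm_num) _ (by simp; ring)
    · exact mono_bd2 α β Q ha hb hQ1 4 1 3 2 (by norm_num) (by norm_num) 26 192 (by norm_num) _ (by simp; ring)
    · exact mono_bd2 α β Q ha hb hQ1 4 1 3 2 (by norm_num) (by norm_num) 5 32 (by norm_num) _ (by simp; ring)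
    · exact mono_bd2 α β Q ha hb hQ1 3 2 2 3 (by norm_num) (by norm_num) 1 0 (by norm_num) _ (by simp)
  · intro i; fin_cases i
    · exact mono_bd2 α β Q ha hb hQ1 1 4 0 0 (by norm_num) (by norm_num) 16 0 (by norm_num) _ (by simp; ring)
    · exact mono_bd2 α β Q ha hb hQ1 1 4 0 0 (by norm_num) (by norm_num) 0 0 (by norm_num) _ (by simp)
    · exact mono_bd2 α β Q ha hb hQ1 0 5 0 0 (by norm_num) (by norm_num) 12 0 (by norm_num) _ (by simp)
    · exact mono_bd2 α β Q ha hb hQ1 0 5 0 0 (by norm_num) (by norm_num) 0 0 (by norm_num) _ (by simp)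
  · intro i; fin_cases i
    · exact mono_bd2 α β Q ha hb hQ1 1 4 0 0 (by norm_num) (by norm_num) 27 0 (by norm_num) _ (by simp; ring)
    · exact mono_bd2 α β Q ha hb hQ1 1 4 0 0 (by norm_num) (by norm_num) 5 0 (by norm_num) _ (by simp; ring)
    · exact mono_bd2 α β Q ha hb hQ1 0 5 0 0 (by norm_num) (by norm_num) 0 0 (by norm_num) _ (by simp)
    · exact mono_bd2 α β Q ha hb hQ1 0 5 0 0 (by norm_num) (by norm_num) (-3) 0 (by norm_num) _ (by simp)
  · exact mono_bd2 α β Q ha hb hQ1 3 4 2 5 (by norm_num) (by norm_num) 16 108 (by norm_num) _ (by ring)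
  · have hQ0 : (0:ℝ) ≤ Q := by exact_mod_cast (by omega : 0 ≤ Q)
    have e3 : (2.7:ℝ) ≤ Real.exp 1 := by have := Real.exp_one_gt_d9; linarith
    have h1 : (7000:ℝ) ≤ Real.exp 9 := by
      have : Real.exp 9 = (Real.exp 1)^9 := by rw [← Real.exp_nat_mul]; norm_num
      rw [this]
      calc (7000:ℝ) ≤ 2.7^9 := by norm_num
        _ ≤ _ := by gcongr
    have h2 : (2000:ℝ) ≤ Real.exp 8 := by
      have : Real.exp 8 = (Real.exp 1)^8 := by rw [← Real.exp_nat_mul]; norm_num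
      rw [this]
      calc (2000:ℝ) ≤ 2.7^8 := by norm_num
        _ ≤ _ := by gcongr
    have h3 : (Q:ℝ) ≤ Real.exp (8+h0) := by
      calc (Q:ℝ) ≤ 7000 * Real.exp (h0-1) := hQ
        _ ≤ Real.exp 9 * Real.exp (h0-1) := by gcongr
        _ = _ := by rw [← Real.exp_add]; ring_nf
    push_cast
    calc 8 * (250*(Q:ℝ)^7) = 2000 * (Q:ℝ)^7 := by ring
      _ ≤ Real.exp 8 * (Real.exp (8+h0))^7 := by gcongr
      _ = Real.exp (8 + 7*(8+h0)) := by rw [← Real.exp_nat_mul, ← Real.exp_add]; norm_num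
      _ ≤ _ := by apply Real.exp_le_exp.mpr; linarith
end APR

set_option linter.unusedSectionVars false
set_option linter.unusedVariables false
set_option linter.unusedSimpArgs false
namespace APR
open WeierstrassCurve Height

/-- All data attached to `W` needed in the assembly. -/
structure Setup (W : WeierstrassCurve ℚ) (K : Type) [Field K] [NumberField K] [DecidableEq K]
    (A B : K) [(SW A B).IsElliptic] (h0 : ℝ) where
  u : K
  hu : u ≠ 0
  hA : algebraMap ℚ K (-W.c₄ / 48) = u ^ 4 * A
  hB : algebraMap ℚ K (-W.c₆ / 864) = u ^ 6 * B
  h01 : 1 ≤ h0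
  htA : logHeight₁ A ≤ totalWeight K * (20 * h0)
  htB : logHeight₁ B ≤ totalWeight K * (20 * h0)
  e1 : K
  e2 : K
  e3 : K
  hs : e1 + e2 + e3 = 0
  hAe : A = e1*e2+e1*e3+e2*e3
  hBe : B = -(e1*e2*e3)
  k : ℕ
  hk1 : 1 ≤ k
  hk3 : k ≤ 3
  hur : ∃ q : ℚ, u^(2*k) = (q : K)
  c : Fin 5 → ℤ
  d : Fin 5 → ℤ
  ρ : ℤ
  ld : LD c d ρ (80*h0)
  dbl0 : ∀ Q : Pt A B, Q ≠ 0 → Q + Q = 0 → frm d (Xc Q ^ k) 1 = 0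
  dbl1 : ∀ Q : Pt A B, Q ≠ 0 → Q + Q ≠ 0 → frm c (Xc Q ^ k) 1 = Xc (Q+Q) ^ k * frm d (Xc Q ^ k) 1

theorem dbl_mul {K : Type*} [Field K] {A B : K} [DecidableEq K] [CharZero K] (Q : Pt A B) (hQ : Q ≠ 0) (h : Q + Q ≠ 0) :
    Xc (Q+Q) * (4 * Yc Q^2) = Xc Q^4 - 2*A*Xc Q^2 - 8*B*Xc Q + A^2 := by
  have hy : Yc Q ≠ 0 := fun hy => h (dbl_zero hy)
  obtain ⟨_, h2, _⟩ := dbl_formula hQ hy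
  have e := sw_eq hQ
  rw [h2]
  field_simp
  linear_combination (-32 * Xc Q) * e

theorem exists_field (n : ℕ) (hn : n ≠ 0) (γ A B : ℚ) : ∃ (K : Type) (_ : Field K) (_ : NumberField K) (u e1 e2 e3 : K),
    u^n = (γ : K) ∧ e1 + e2 + e3 = 0 ∧ (A:K) = e1*e2+e1*e3+e2*e3 ∧ (B:K) = -(e1*e2*e3) := by
  classical
  let p : Polynomial ℚ := (Polynomial.X^n - Polynomial.C γ)
  let P : Cubic ℚ := ⟨1, 0, A, B⟩
  let f := p * P.toPoly
  have hp0 : p ≠ 0 := Polynomial.X_pow_sub_C_ne_zero (Nat.pos_of_ne_zero hn) γ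
  have hP0 : P.toPoly ≠ 0 := Cubic.ne_zero_of_a_ne_zero (by simp [P])
  have hspl := Polynomial.SplittingField.splits f
  have hf0 : f.map (algebraMap ℚ f.SplittingField) ≠ 0 :=
    (Polynomial.map_ne_zero_iff (algebraMap ℚ f.SplittingField).injective).mpr (mul_ne_zero hp0 hP0)
  have s1 : (p.map (algebraMap ℚ f.SplittingField)).Splits :=
    hspl.of_dvd hf0 (Polynomial.map_dvd _ (Dvd.intro _ rfl))
  have s2 : (P.toPoly.map (algebraMap ℚ f.SplittingField)).Splits :=
    hspl.of_dvd hf0 (Polynomial.map_dvd _ (Dvd.intro_left _ rfl))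
  haveI : CharZero f.SplittingField := charZero_of_injective_algebraMap (algebraMap ℚ f.SplittingField).injective
  obtain ⟨u, hu⟩ := s1.exists_eval_eq_zero (by
    rw [Polynomial.degree_map, Polynomial.degree_X_pow_sub_C (Nat.pos_of_ne_zero hn)]
    exact_mod_cast hn)
  obtain ⟨x, y, z, h3⟩ := (Cubic.splits_iff_roots_eq_three (φ := algebraMap ℚ f.SplittingField) (P := P) (by simp [P])).mp s2
  have ha : P.a ≠ 0 := by simp [P]
  have hb := Cubic.b_eq_three_roots ha h3
  have hc := Cubic.c_eq_three_roots ha h3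
  have hd := Cubic.d_eq_three_roots ha h3
  simp [P] at hb hc hd
  refine ⟨f.SplittingField, inferInstance, { to_charZero := inferInstance, to_finiteDimensional := inferInstance }, u, x, y, z, ?_, ?_, ?_, ?_⟩
  · simp [p, sub_eq_zero] at hu; exact hu
  · linear_combination hb
  · exact hc
  · exact hd

theorem SW_ell {K : Type*} [Field K] [CharZero K] (A B : K) (h : 4*A^3+27*B^2 ≠ 0) : (SW A B).IsElliptic := by
  constructor
  rw [isUnit_iff_ne_zero]
  have : (SW A B).Δ = -16*(4*A^3+27*B^2) := by
    simp [SW, WeierstrassCurve.Δ, b₂, b₄, b₆, b₈]; ring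
  rw [this]
  exact mul_ne_zero (by norm_num) h

theorem logHeight₁_rat_div (α β : ℤ) (hβ : β ≠ 0) (Q : ℝ) (ha : (|α| : ℤ) ≤ Q) (hb : (|β| : ℤ) ≤ Q) (hα : α ≠ 0) :
    logHeight₁ ((α:ℚ)/β) ≤ Real.log Q := by
  rw [Rat.logHeight₁_eq_log_max]
  apply Real.log_le_log
  · have := ((α:ℚ)/β).den_pos
    have : 0 < max ((α:ℚ)/β).num.natAbs ((α:ℚ)/β).den := lt_max_of_lt_right this
    exact_mod_cast this
  · rw [Nat.cast_max]
    apply max_le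
    · have h1 : ((α:ℚ)/β).num ∣ α := by
        have := Rat.num_dvd α hβ
        rwa [Rat.divInt_eq_div] at this
      have h2 : ((α:ℚ)/β).num.natAbs ≤ α.natAbs := Nat.le_of_dvd (Int.natAbs_pos.mpr hα) (Int.natAbs_dvd_natAbs.mpr h1)
      have h3 : (((α:ℚ)/β).num.natAbs : ℝ) ≤ α.natAbs := by exact_mod_cast h2
      refine h3.trans (le_trans (le_of_eq ?_) ha)
      rw [Nat.cast_natAbs]
    · have h1 : (((α:ℚ)/β).den : ℤ) ∣ β := by
        have := Rat.den_dvd α β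
        rwa [Rat.divInt_eq_div] at this
      have h2 : (((α:ℚ)/β).den : ℤ) ≤ |β| := Int.le_of_dvd (abs_pos.mpr hβ) ((dvd_abs _ _).mpr h1)
      have h3 : (((α:ℚ)/β).den : ℝ) ≤ (|β| : ℤ) := by exact_mod_cast h2
      exact h3.trans hb

theorem exists_setup (W : WeierstrassCurve ℚ) [W.IsElliptic] (h0 : ℝ)
    (hh0 : h0 = 1 + Real.log (max W.j.num.natAbs W.j.den : ℕ)) :
    ∃ (K : Type) (_ : Field K) (_ : NumberField K) (_ : DecidableEq K) (A B : K) (_ : (SW A B).IsElliptic),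
      Nonempty (Setup W K A B h0) := by
  classical
  have hHpos : 1 ≤ (max W.j.num.natAbs W.j.den : ℕ) := le_max_of_le_right W.j.den_pos
  have hHr : (1:ℝ) ≤ ((max W.j.num.natAbs W.j.den : ℕ) : ℝ) := by exact_mod_cast hHpos
  have h01 : 1 ≤ h0 := by
    rw [hh0]; have := Real.log_nonneg hHr; linarith
  have hexp : Real.exp (h0 - 1) = ((max W.j.num.natAbs W.j.den : ℕ) : ℝ) := by
    rw [hh0, add_sub_cancel_left, Real.exp_log (by linarith)]
  have hΔ0 : W.Δ ≠ 0 := by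
    have := W.isUnit_Δ
    exact this.ne_zero
  have hc46 : 1728 * W.Δ = W.c₄^3 - W.c₆^2 := W.c_relation
  have hj : W.j * W.Δ = W.c₄^3 := by
    rw [WeierstrassCurve.j]
    have : ((W.Δ'⁻¹ : ℚˣ) : ℚ) * W.Δ = 1 := by
      simp [inv_mul_cancel₀ hΔ0]
    linear_combination W.c₄^3 * this
  have hD0 : ∀ (K : Type) [Field K] [NumberField K], (0:ℝ) ≤ totalWeight K * (20*h0) := by
    intro K _ _; positivity
  by_cases hc4 : W.c₄ = 0
  · skip
    have hc6 : W.c₆ ≠ 0 := by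
      intro h; rw [hc4, h] at hc46; apply hΔ0; linarith
    obtain ⟨K, _, _, u, e1, e2, e3, hu, hs, hA, hB⟩ := exists_field 6 (by norm_num) (-W.c₆/864) 0 1
    have hell : (SW (0:K) 1).IsElliptic := SW_ell _ _ (by norm_num)
    refine ⟨K, _, ‹_›, inferInstance, 0, 1, hell, ⟨{
      u := u, e1 := e1, e2 := e2, e3 := e3, hs := hs, h01 := h01, k := 3, c := _, d := _, ρ := _,
      hu := ?_, hA := ?_, hB := ?_, htA := ?_, htB := ?_, hAe := ?_, hBe := ?_, hk1 := by norm_num, hk3 := by norm_num,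
      hur := ⟨_, hu⟩, ld := LD_zero (80*h0) (by linarith), dbl0 := ?_, dbl1 := ?_ }⟩⟩
    · rintro rfl
      have : ((-W.c₆/864 : ℚ):K) = 0 := by rw [← hu]; simp
      have h2 : (-W.c₆/864 : ℚ) = 0 := by exact_mod_cast this
      apply hc6; linarith
    · rw [hc4]; simp
    · rw [hu]; simp
    · rw [logHeight₁_zero]; exact hD0 K
    · rw [logHeight₁_one]; exact hD0 K
    · rw [← hA]; simp
    · rw [← hB]; simp
    · intro Q hQ h
      have hy := (dbl_eq_zero_iff hQ).mp h
      have e := sw_eq hQ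
      rw [hy] at e
      rw [frm_eq]; simp
      have : Xc Q^3 = -1 := by linear_combination -e
      rw [this]; ring
    · intro Q hQ h
      have h1 := dbl_mul Q hQ h
      have e := sw_eq hQ
      have h2 : Xc (Q+Q)^3 * (64 * (Xc Q^3+1)^3) = (Xc Q^4 - 8 * Xc Q)^3 := by
        have : Xc Q^3 + 1 = Yc Q^2 := by linear_combination -e
        rw [this]
        calc _ = (Xc (Q+Q) * (4*Yc Q^2))^3 := by ring
          _ = _ := by rw [h1]; ring
      rw [frm_eq, frm_eq]; simp
      linear_combination -h2
  by_cases hc6 : W.c₆ = 0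
  · obtain ⟨K, _, _, u, e1, e2, e3, hu, hs, hA, hB⟩ := exists_field 4 (by norm_num) (-W.c₄/48) 1 0
    have hell : (SW (1:K) 0).IsElliptic := SW_ell _ _ (by norm_num)
    refine ⟨K, _, ‹_›, inferInstance, 1, 0, hell, ⟨{
      u := u, e1 := e1, e2 := e2, e3 := e3, hs := hs, h01 := h01, k := 2, c := _, d := _, ρ := _,
      hu := ?_, hA := ?_, hB := ?_, htA := ?_, htB := ?_, hAe := ?_, hBe := ?_, hk1 := by norm_num, hk3 := by norm_num,
      hur := ⟨_, hu⟩, ld := LD_1728 (80*h0) (by linarith), dbl0 := ?_, dbl1 := ?_ }⟩⟩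
    · rintro rfl
      have : ((-W.c₄/48 : ℚ):K) = 0 := by rw [← hu]; simp
      have h2 : (-W.c₄/48 : ℚ) = 0 := by exact_mod_cast this
      apply hc4; linarith
    · rw [hu]; simp
    · rw [hc6]; simp
    · rw [logHeight₁_one]; exact hD0 K
    · rw [logHeight₁_zero]; exact hD0 K
    · rw [← hA]; simp
    · rw [← hB]; simp
    · intro Q hQ h
      have hy := (dbl_eq_zero_iff hQ).mp h
      have e := sw_eq hQ
      rw [hy] at e
      rw [frm_eq]; simp
      have : Xc Q * (Xc Q^2 + 1) = 0 := by linear_combination -e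
      linear_combination 16 * (Xc Q * (Xc Q^2 + 1)) * this
    · intro Q hQ h
      have h1 := dbl_mul Q hQ h
      have e := sw_eq hQ
      have h2 : Xc (Q+Q)^2 * (16 * (Xc Q^3+Xc Q)^2) = (Xc Q^4 - 2 * Xc Q^2 + 1)^2 := by
        have : Xc Q^3 + Xc Q = Yc Q^2 := by linear_combination -e
        rw [this]
        calc _ = (Xc (Q+Q) * (4*Yc Q^2))^2 := by ring
          _ = _ := by rw [h1]; ring
      rw [frm_eq, frm_eq]; simp
      linear_combination -h2
  · set p := W.j.num with hp
    set r := W.j.den with hr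
    have hr0 : (r:ℚ) ≠ 0 := by exact_mod_cast W.j.den_nz
    have hjpr : W.j = p / r := (Rat.num_div_den W.j).symm
    have hp0 : p ≠ 0 := by
      intro h
      rw [hjpr, h] at hj
      apply hc4
      have h3 : W.c₄^3 = 0 := by rw [← hj]; simp
      exact pow_eq_zero_iff (by norm_num) |>.mp h3
    have hβ1 : 4*(1728*(r:ℤ) - p) ≠ 0 := by
      intro h
      have h1 : (1728*(r:ℚ) - p) = 0 := by
        have : (1728*(r:ℤ) - p) = 0 := by omega
        exact_mod_cast this
      have h2 : W.j = 1728 := by rw [hjpr]; field_simp; linarith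
      rw [h2, hc46] at hj
      apply hc6
      have : W.c₆^2 = 0 := by linarith
      exact pow_eq_zero_iff (by norm_num) |>.mp this
    set α : ℤ := 27*p with hα
    set β : ℤ := 4*(1728*(r:ℤ) - p) with hβ
    have hα0 : α ≠ 0 := by rw [hα]; omega
    set a : ℚ := (α:ℚ)/β with ha
    have hβq : (β:ℚ) ≠ 0 := by exact_mod_cast hβ1
    have hac : a * (4 * W.c₆^2) = -27 * W.c₄^3 := by
      rw [ha, div_mul_eq_mul_div, div_eq_iff hβq, hα, hβ]
      push_cast
      have h1 : (p:ℚ) * W.Δ = r * W.c₄^3 := by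
        rw [← hj, hjpr]; field_simp
      have h2 : W.c₆^2 = W.c₄^3 - 1728 * W.Δ := by linarith
      rw [h2]
      linear_combination (-108*1728) * h1
    have ha'' : a = -27 * W.c₄^3 / (4*W.c₆^2) := by
      rw [eq_div_iff (mul_ne_zero (by norm_num) (pow_ne_zero _ hc6))]; exact hac
    have ha0 : a ≠ 0 := div_ne_zero (by exact_mod_cast hα0) hβq
    obtain ⟨K, _, _, u, e1, e2, e3, hu, hs, hA, hB⟩ := exists_field 2 (by norm_num) (W.c₆/(18*W.c₄)) a a
    have h4a : 4*α+27*β ≠ 0 := by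
      rw [hα, hβ]; have := W.j.den_pos; omega
    have haβ : (a:K) * β = α := by
      have : a * β = α := by rw [ha]; field_simp
      exact_mod_cast this
    have hβK : (β:K) ≠ 0 := by exact_mod_cast hβ1
    have hell : (SW (a:K) a).IsElliptic := SW_ell _ _ (by
      have h1 : 4*a^3+27*a^2 ≠ 0 := by
        have h2 : 4*a+27 ≠ 0 := by
          intro h
          have : (4*α+27*β : ℚ) = 0 := by
            rw [ha] at h; field_simp at h; linarith
          exact h4a (by exact_mod_cast this)
        have : 4*a^3+27*a^2 = a^2*(4*a+27) := by ring
        rw [this]; exact mul_ne_zero (pow_ne_zero _ ha0) h2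
      exact_mod_cast h1)
    set Q : ℤ := 7000 * ((max p.natAbs r : ℕ) : ℤ) with hQ
    have hpH : |p| ≤ ((max p.natAbs r : ℕ) : ℤ) := by
      rw [Int.abs_eq_natAbs]; exact_mod_cast le_max_left _ _
    have hrH : (r:ℤ) ≤ ((max p.natAbs r : ℕ) : ℤ) := by exact_mod_cast le_max_right _ _
    have hαQ : |α| ≤ Q := by
      rw [hα, hQ, abs_mul]; norm_num; have := abs_nonneg p; omega
    have hβQ : |β| ≤ Q := by
      rw [hβ, hQ]
      rw [abs_le] at hpH ⊢
      constructor <;> omega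
    have hQr : (Q:ℝ) ≤ 7000 * Real.exp (h0-1) := by
      rw [hexp, hQ, Int.cast_mul, Int.cast_natCast]; norm_num
    have hta : logHeight₁ (a:K) ≤ totalWeight K * (20*h0) := by
      rw [logHeight₁_rat]
      gcongr
      refine (logHeight₁_rat_div α β hβ1 (7000 * Real.exp (h0-1)) ?_ ?_ hα0).trans ?_
      · exact le_trans (by exact_mod_cast hαQ) hQr
      · exact le_trans (by exact_mod_cast hβQ) hQr
      · rw [Real.log_mul (by norm_num) (by positivity), Real.log_exp]
        have : Real.log 7000 ≤ 19 := by
          rw [Real.log_le_iff_le_exp (by norm_num)]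
          have h := Real.add_one_le_exp (9.5:ℝ)
          have h2 : Real.exp 19 = (Real.exp 9.5)^2 := by rw [← Real.exp_nat_mul]; norm_num
          have h3 : Real.exp 9.5 = (Real.exp 4.75)^2 := by rw [← Real.exp_nat_mul]; norm_num
          have h4 := Real.add_one_le_exp (4.75:ℝ)
          have h5 : (33:ℝ) ≤ Real.exp 9.5 := by rw [h3]; nlinarith
          have h6 : (5.75:ℝ)^4 ≤ (Real.exp 4.75)^4 := by gcongr; linarith
          have h7 : Real.exp 19 = (Real.exp 4.75)^4 := by rw [← Real.exp_nat_mul]; norm_num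
          have h8 : Real.exp 19 = (Real.exp 1)^19 := by rw [← Real.exp_nat_mul]; norm_num
          have h9 : (2:ℝ)^19 ≤ (Real.exp 1)^19 := by gcongr; have := Real.add_one_le_exp (1:ℝ); linarith
          rw [h8]; linarith
        nlinarith
    refine ⟨K, _, ‹_›, inferInstance, a, a, hell, ⟨{
      u := u, e1 := e1, e2 := e2, e3 := e3, hs := hs, h01 := h01, k := 1, c := _, d := _, ρ := _,
      hu := ?_, hA := ?_, hB := ?_, htA := hta, htB := hta, hAe := hA, hBe := hB, hk1 := by norm_num, hk3 := by norm_num,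
      hur := ⟨_, hu⟩, ld := LD_gen α β Q h0 hαQ hβQ hα0 hβ1 h4a hQr h01, dbl0 := ?_, dbl1 := ?_ }⟩⟩
    · rintro rfl
      have : ((W.c₆/(18*W.c₄) : ℚ):K) = 0 := by rw [← hu]; simp
      have h2 : (W.c₆/(18*W.c₄) : ℚ) = 0 := by exact_mod_cast this
      exact (div_ne_zero hc6 (mul_ne_zero (by norm_num) hc4)) h2
    · have h1 : (-W.c₄/48) = (W.c₆/(18*W.c₄))^2 * a := by
        rw [ha'']; field_simp; norm_num
      have : u^4 = ((W.c₆/(18*W.c₄) : ℚ):K)^2 := by rw [← hu]; ring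
      rw [this, h1]; simp
    · have h1 : (-W.c₆/864) = (W.c₆/(18*W.c₄))^3 * a := by
        rw [ha'']; field_simp; norm_num
      have : u^6 = ((W.c₆/(18*W.c₄) : ℚ):K)^3 := by rw [← hu]; ring
      rw [this, h1]; simp
    · intro Q hQ h
      have hy := (dbl_eq_zero_iff hQ).mp h
      have e := sw_eq hQ
      rw [hy] at e
      rw [frm_eq]; simp
      rw [← haβ]
      linear_combination (-4*(β:K)^2) * e
    · intro Q hQ h
      have h1 := dbl_mul Q hQ h
      have e := sw_eq hQ
      rw [frm_eq, frm_eq]; simp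
      rw [← haβ]
      linear_combination (-(β:K)^2) * h1 + 4 * (β:K)^2 * Xc (Q+Q) * e
end APR

set_option linter.unusedSectionVars false
set_option linter.unusedVariables false
set_option linter.unusedSimpArgs false
namespace APR
open WeierstrassCurve Height

section heights
variable {K : Type*} [Field K] [NumberField K]

theorem log2_le_one : Real.log 2 ≤ 1 := by
  have := Real.log_two_lt_d9; linarith

/-- height bound -/
def HB (β : ℝ) (x : K) (c : ℕ) : Prop := logHeight₁ x ≤ c * β

theorem HB.mono {β : ℝ} (hβ : (totalWeight K : ℝ) ≤ β) {x : K} {c c' : ℕ} (h : HB β x c) (hc : c ≤ c') : HB β x c' := by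
  have h0 : (0:ℝ) ≤ β := le_trans (by positivity) hβ
  unfold HB at *
  refine h.trans ?_
  gcongr

theorem HB.add {β : ℝ} (hβ : (totalWeight K : ℝ) ≤ β) {x y : K} {c c' : ℕ} (h : HB β x c) (h' : HB β y c') :
    HB β (x+y) (c+c'+1) := by
  unfold HB at *
  have h1 := logHeight₁_add_le x y
  have h2 : (totalWeight K : ℝ) * Real.log 2 ≤ β := by
    have := log2_le_one
    have h3 : (0:ℝ) ≤ totalWeight K := by positivity
    nlinarith
  push_cast
  nlinarith

theorem HB.mul {β : ℝ} {x y : K} {c c' : ℕ} (h : HB β x c) (h' : HB β y c') :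
    HB β (x*y) (c+c') := by
  unfold HB at *
  have h1 := logHeight₁_mul_le x y
  push_cast
  nlinarith

theorem HB.neg {β : ℝ} {x : K} {c : ℕ} (h : HB β x c) : HB β (-x) c := by
  unfold HB at *
  rw [logHeight₁_neg]; exact h

theorem HB.inv {β : ℝ} {x : K} {c : ℕ} (h : HB β x c) : HB β (x⁻¹) c := by
  unfold HB at *
  rw [logHeight₁_inv]; exact h

theorem HB.div {β : ℝ} {x y : K} {c c' : ℕ} (h : HB β x c) (h' : HB β y c') : HB β (x/y) (c+c') := by
  rw [div_eq_mul_inv]; exact h.mul h'.inv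

theorem HB.sub {β : ℝ} (hβ : (totalWeight K : ℝ) ≤ β) {x y : K} {c c' : ℕ} (h : HB β x c) (h' : HB β y c') :
    HB β (x-y) (c+c'+1) := by
  rw [sub_eq_add_neg]; exact h.add hβ h'.neg

theorem HB.one {β : ℝ} : HB β (1:K) 0 := by
  unfold HB; simp

theorem HB.zero {β : ℝ} : HB β (0:K) 0 := by
  unfold HB; simp

/-- polynomial height bound -/
structure PB (β : ℝ) (p : Polynomial K) (n c : ℕ) : Prop where
  deg : p.natDegree ≤ n
  ht : ∀ k, HB β (p.coeff k) c

theorem PB.C {β : ℝ} (hβ : (totalWeight K : ℝ) ≤ β) {x : K} {c : ℕ} (h : HB β x c) : PB β (Polynomial.C x) 0 c := by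
  refine ⟨by simp, fun k => ?_⟩
  rw [Polynomial.coeff_C]
  split_ifs
  · exact h
  · exact HB.zero.mono hβ (Nat.zero_le _)

theorem PB.X {β : ℝ} : PB β (Polynomial.X : Polynomial K) 1 0 := by
  refine ⟨by simp, fun k => ?_⟩
  rw [Polynomial.coeff_X]
  split_ifs
  · exact HB.one
  · exact HB.zero

theorem PB.add {β : ℝ} (hβ : (totalWeight K : ℝ) ≤ β) {p q : Polynomial K} {n m c c' : ℕ} (h : PB β p n c) (h' : PB β q m c') :
    PB β (p+q) (max n m) (c+c'+1) := by
  refine ⟨(Polynomial.natDegree_add_le _ _).trans (max_le_max h.deg h'.deg), fun k => ?_⟩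
  rw [Polynomial.coeff_add]
  exact (h.ht k).add hβ (h'.ht k)

theorem PB.neg {β : ℝ} {p : Polynomial K} {n c : ℕ} (h : PB β p n c) : PB β (-p) n c := by
  refine ⟨by rw [Polynomial.natDegree_neg]; exact h.deg, fun k => ?_⟩
  rw [Polynomial.coeff_neg]
  exact (h.ht k).neg

theorem PB.sub {β : ℝ} (hβ : (totalWeight K : ℝ) ≤ β) {p q : Polynomial K} {n m c c' : ℕ} (h : PB β p n c) (h' : PB β q m c') :
    PB β (p-q) (max n m) (c+c'+1) := by
  rw [sub_eq_add_neg]; exact h.add hβ h'.neg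

theorem PB.mul {β : ℝ} (hβ : (totalWeight K : ℝ) ≤ β) {p q : Polynomial K} {n m c c' : ℕ} (h : PB β p n c) (h' : PB β q m c') :
    PB β (p*q) (n+m) ((n+m+1)*(c+c'+1)) := by
  refine ⟨Polynomial.natDegree_mul_le.trans (add_le_add h.deg h'.deg), fun k => ?_⟩
  have h0 : (0:ℝ) ≤ totalWeight K := by positivity
  have hβ0 : 0 ≤ β := h0.trans hβ
  by_cases hk : n + m < k
  · rw [Polynomial.coeff_eq_zero_of_natDegree_lt (lt_of_le_of_lt (Polynomial.natDegree_mul_le.trans (add_le_add h.deg h'.deg)) hk)]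
    exact HB.zero.mono hβ (Nat.zero_le _)
  · push Not at hk
    rw [Polynomial.coeff_mul]
    have h1 := logHeight₁_sum_le (Finset.HasAntidiagonal.antidiagonal k) (fun x : ℕ × ℕ => p.coeff x.1 * q.coeff x.2)
    have h2 : ∑ x ∈ Finset.HasAntidiagonal.antidiagonal k, logHeight₁ (p.coeff x.1 * q.coeff x.2) ≤ ∑ x ∈ Finset.HasAntidiagonal.antidiagonal k, ((c+c':ℕ):ℝ)*β :=
      Finset.sum_le_sum fun x _ => (h.ht x.1).mul (h'.ht x.2)
    rw [Finset.sum_const, Finset.Nat.card_antidiagonal, nsmul_eq_mul] at h2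
    rw [Finset.Nat.card_antidiagonal] at h1
    have h3 : Real.log ((k+1:ℕ):ℝ) ≤ ((k+1:ℕ):ℝ) := by
      have : (0:ℝ) < ((k+1:ℕ):ℝ) := by positivity
      have := Real.log_le_sub_one_of_pos this
      linarith
    have h4 : (totalWeight K : ℝ) * Real.log ((k+1:ℕ):ℝ) ≤ β * ((k+1:ℕ):ℝ) := by
      have : (0:ℝ) ≤ Real.log ((k+1:ℕ):ℝ) := Real.log_natCast_nonneg _
      nlinarith
    have h5 : ((k+1:ℕ):ℝ) ≤ ((n+m+1:ℕ):ℝ) := by exact_mod_cast Nat.succ_le_succ hk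
    unfold HB
    refine h1.trans ?_
    rw [Nat.cast_mul]
    have h6 : ((c+c'+1:ℕ):ℝ) = ((c+c':ℕ):ℝ) + 1 := by push_cast; ring
    rw [h6]
    calc _ ≤ ((k+1:ℕ):ℝ) * (((c+c':ℕ):ℝ) + 1) * β := by nlinarith
      _ ≤ _ := by gcongr

/-- height of a vector is at most the sum of the heights of entries -/
theorem logHeight_le_sum {ι : Type*} [Fintype ι] [DecidableEq ι] (x : ι → K) : logHeight x ≤ ∑ i, logHeight₁ (x i) := by
  have h1 := logHeight_fun_prod_eq (K := K) (α := ι) (ι := fun _ => Fin 2) (x := fun i => ![x i, 1]) (fun a h => by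
    have := congrFun h 1; simp at this)
  simp only [← logHeight₁_eq_logHeight] at h1
  rw [← h1]
  have h2 := logHeight_comp_le (fun (i : ι) (j : ι) => if j = i then (0 : Fin 2) else 1)
    (fun I : (ι → Fin 2) => ∏ a, (![x a, 1] : Fin 2 → K) (I a))
  refine le_trans (le_of_eq ?_) h2
  congr 1
  ext i
  simp only [Function.comp]
  rw [Finset.prod_eq_single i]
  · simp
  · intro b _ hb; simp [hb]
  · simp

theorem logHeight_powers (x : K) (m : ℕ) : logHeight (fun i : Fin (m+1) => x^(i:ℕ)) ≤ m * logHeight₁ x := by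
  have h1 := logHeight_fun_prod_eq (K := K) (α := Fin m) (ι := fun _ => Fin 2) (x := fun i => ![x, 1]) (fun a h => by
    have := congrFun h 1; simp at this)
  simp only [← logHeight₁_eq_logHeight, Finset.sum_const, Finset.card_univ, Fintype.card_fin, nsmul_eq_mul] at h1
  rw [← h1]
  have h2 := logHeight_comp_le (fun (i : Fin (m+1)) (j : Fin m) => if (j:ℕ) < (i:ℕ) then (0 : Fin 2) else 1)
    (fun I : (Fin m → Fin 2) => ∏ a, (![x, 1] : Fin 2 → K) (I a))
  refine le_trans (le_of_eq ?_) h2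
  congr 1
  ext i
  simp only [Function.comp]
  have : ∀ a : Fin m, (![x, 1] : Fin 2 → K) (if (a:ℕ) < (i:ℕ) then (0 : Fin 2) else 1) = if (a:ℕ) < (i:ℕ) then x else 1 := by
    intro a; split_ifs <;> simp
  simp only [this]
  rw [Finset.prod_ite]
  simp only [Finset.prod_const, Finset.prod_const_one, mul_one]
  congr 1
  have := i.2
  rw [Fin.card_filter_val_lt]
  rw [one_pow, mul_one, min_eq_right (by omega)]

theorem root_height {β : ℝ} (hβ : (totalWeight K : ℝ) ≤ β) {p : Polynomial K} {n c : ℕ} (h : PB β p n c) (hp : p ≠ 0)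
    {x : K} (hx : p.eval x = 0) : HB β x (n*(2*c+1)) := by
  classical
  have h0 : (0:ℝ) ≤ totalWeight K := by positivity
  have hβ0 : 0 ≤ β := h0.trans hβ
  obtain ⟨m, hm⟩ : ∃ m, p.natDegree = m + 1 := by
    have : p.natDegree ≠ 0 := by
      intro h
      rw [Polynomial.eq_C_of_natDegree_eq_zero h] at hx hp
      simp at hx hp; exact hp hx
    exact ⟨p.natDegree - 1, by omega⟩
  have hl : p.coeff (m+1) ≠ 0 := by
    rw [← hm]; exact Polynomial.leadingCoeff_ne_zero.mpr hp
  set b : ℕ → K := fun i => -(p.coeff i / p.coeff (m+1)) with hb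
  have hbh : ∀ i, logHeight₁ (b i) ≤ ((2*c:ℕ):ℝ) * β := fun i => by
    have := ((h.ht i).div (h.ht (m+1))).neg
    rw [← two_mul] at this; exact this
  have hxm : x^(m+1) = ∑ i : Fin (m+1), b i * x^(i:ℕ) := by
    rw [Polynomial.eval_eq_sum_range, hm, Finset.sum_range_succ] at hx
    rw [Fin.sum_univ_eq_sum_range (fun i => b i * x^i)]
    simp only [hb]
    have : ∑ i ∈ Finset.range (m+1), -(p.coeff i / p.coeff (m+1)) * x^i = -(∑ i ∈ Finset.range (m+1), p.coeff i * x^i)/p.coeff (m+1) := by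
      rw [neg_div, Finset.sum_div, ← Finset.sum_neg_distrib]
      apply Finset.sum_congr rfl; intro i _; ring
    rw [this, eq_div_iff hl]
    linear_combination hx
  have h1 := logHeight_linearMap_apply_le (K := K) (ι' := Fin 2) (ι := Fin (m+1))
    (fun q => if q.1 = 0 then b q.2 else if q.2 = 0 then 1 else 0) (fun i : Fin (m+1) => x^(i:ℕ))
  have h2 : (fun j : Fin 2 => ∑ i : Fin (m+1), (if j = 0 then b i else if i = 0 then 1 else 0) * x^(i:ℕ)) = ![x^(m+1), 1] := by
    ext j
    fin_cases j
    · simp [hxm]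
    · simp [ite_mul]
  simp only at h1
  rw [h2, ← logHeight₁_eq_logHeight, logHeight₁_pow] at h1
  have h3 := logHeight_powers x m
  have h4 : logHeight (fun q : Fin 2 × Fin (m+1) => if q.1 = 0 then b q.2 else if q.2 = 0 then 1 else 0) ≤ ((m+1:ℕ):ℝ) * (((2*c:ℕ):ℝ) * β) := by
    refine (logHeight_le_sum _).trans ?_
    rw [Fintype.sum_prod_type, Fin.sum_univ_two]
    have h5 : ∀ i : Fin (m+1), logHeight₁ (if i = 0 then (1:K) else 0) = 0 := by
      intro i; split_ifs <;> simp
    simp only [if_true, Fin.isValue, one_ne_zero, if_false, h5, Finset.sum_const_zero, add_zero]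
    refine (Finset.sum_le_sum (fun (i : Fin (m+1)) _ => hbh (i:ℕ))).trans ?_
    simp
  have h6 : (totalWeight K : ℝ) * Real.log (Nat.card (Fin (m+1))) ≤ ((m+1:ℕ):ℝ) * β := by
    rw [Nat.card_fin]
    have : (0:ℝ) < ((m+1:ℕ):ℝ) := by positivity
    have h7 := Real.log_le_sub_one_of_pos this
    have h8 : (0:ℝ) ≤ Real.log ((m+1:ℕ):ℝ) := Real.log_natCast_nonneg _
    nlinarith
  have hmn : ((m+1:ℕ):ℝ) ≤ n := by
    have := h.deg; rw [hm] at this; exact_mod_cast this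
  unfold HB
  have h9 : logHeight₁ x ≤ ((m+1:ℕ):ℝ) * ((((2*c:ℕ):ℝ) + 1) * β) := by
    have e : ((m+1:ℕ):ℝ) = (m:ℝ) + 1 := by push_cast; ring
    rw [e] at h1 h4 h6 ⊢
    linarith
  refine h9.trans ?_
  calc _ ≤ (n:ℝ) * ((((2*c:ℕ):ℝ) + 1) * β) := by gcongr
    _ = _ := by push_cast; ring
end heights
end APR

set_option linter.unusedSectionVars false
set_option linter.unusedVariables false
set_option linter.unusedSimpArgs false
namespace APR
open WeierstrassCurve Height Polynomial

section geom
variable {K : Type*} [Field K] [CharZero K] [DecidableEq K] {A B : K}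

noncomputable def fP (A B : K) : K[X] := X*X*X + C A * X + C B

theorem fP_eval (A B x : K) : (fP A B).eval x = x^3+A*x+B := by
  simp [fP]; ring

theorem fP_natDegree (A B : K) : (fP A B).natDegree = 3 := by
  unfold fP; compute_degree!

theorem fP_ne (A B : K) : fP A B ≠ 0 := by
  intro h; have := fP_natDegree A B; rw [h] at this; simp at this

theorem fP_Xc {P : Pt A B} (hP : P ≠ 0) : (fP A B).eval (Xc P) = Yc P^2 := by
  rw [fP_eval, sw_eq hP]

theorem norm_ne {p q : K[X]} (h : ¬ (p = 0 ∧ q = 0)) : p*p - fP A B * (q*q) ≠ 0 := by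
  intro h0
  have h1 : p*p = fP A B * (q*q) := sub_eq_zero.mp h0
  by_cases hq : q = 0
  · apply h; refine ⟨?_, hq⟩
    rw [hq] at h1; simpa using h1
  · have hp : p ≠ 0 := by
      rintro rfl
      rw [mul_zero] at h1
      exact (mul_ne_zero (fP_ne A B) (mul_ne_zero hq hq)) h1.symm
    have h2 := congrArg natDegree h1
    rw [natDegree_mul hp hp, natDegree_mul (fP_ne A B) (mul_ne_zero hq hq), natDegree_mul hq hq, fP_natDegree] at h2
    omega

theorem card_root {ι : Type*} (S : Finset ι) (P : ι → Pt A B) (hinj : Set.InjOn P S) (h0 : ∀ i ∈ S, P i ≠ 0)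
    (p : K[X]) (hp : p ≠ 0) (hr : ∀ i ∈ S, p.eval (Xc (P i)) = 0) : S.card ≤ 2 * p.natDegree := by
  classical
  have h1 := Finset.card_le_mul_card_image (f := fun i => Xc (P i)) S 2 (by
    intro a ha
    obtain ⟨i, hi, rfl⟩ := Finset.mem_image.mp ha
    have h2 : ({x ∈ S | Xc (P x) = Xc (P i)} : Finset ι).image P ⊆ {P i, -P i} := by
      intro Q hQ
      obtain ⟨j, hj, rfl⟩ := Finset.mem_image.mp hQ
      rw [Finset.mem_filter] at hj
      rcases X_eq (h0 j hj.1) (h0 i hi) hj.2 with h | h <;> simp [h]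
    rw [← Finset.card_image_of_injOn (f := P) (hinj.mono (fun x hx => (Finset.mem_filter.mp hx).1))]
    exact (Finset.card_le_card h2).trans Finset.card_le_two)
  refine h1.trans (Nat.mul_le_mul_left _ ?_)
  have h3 : S.image (fun i => Xc (P i)) ⊆ p.roots.toFinset := by
    intro x hx
    obtain ⟨i, hi, rfl⟩ := Finset.mem_image.mp hx
    rw [Multiset.mem_toFinset, mem_roots hp]
    exact hr i hi
  exact (Finset.card_le_card h3).trans ((Multiset.toFinset_card_le _).trans (card_roots' p))

theorem noncol4 {P Q R S : Pt A B} (hP : P ≠ 0) (hQ : Q ≠ 0) (hR : R ≠ 0) (hS : S ≠ 0)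
    (hPQ : P ≠ Q) (hPR : P ≠ R) (hPS : P ≠ S) (hQR : Q ≠ R) (hQS : Q ≠ S) (hRS : R ≠ S)
    (h1 : (Xc Q - Xc P) * (Yc R - Yc P) - (Xc R - Xc P) * (Yc Q - Yc P) = 0)
    (h2 : (Xc Q - Xc P) * (Yc S - Yc P) - (Xc S - Xc P) * (Yc Q - Yc P) = 0) : False := by
  by_cases hx : Xc P = Xc Q
  · have hy : Yc Q - Yc P ≠ 0 := fun h => hPQ (pt_ext hP hQ hx (sub_eq_zero.mp h).symm)
    have h3 : Xc R = Xc P := by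
      rw [hx, sub_self, zero_mul, zero_sub, neg_eq_zero, mul_eq_zero] at h1
      rcases h1 with h | h
      · rw [hx]; exact sub_eq_zero.mp h
      · exact absurd (by linear_combination h) hy
    rcases X_eq hQ hP hx.symm with h | h
    · exact hPQ h.symm
    rcases X_eq hR hP h3 with h' | h'
    · exact hPR h'.symm
    · exact hQR (h.trans h'.symm)
  · have hx' : Xc Q - Xc P ≠ 0 := fun h => hx (sub_eq_zero.mp h).symm
    obtain ⟨m, hm⟩ : ∃ m, m * (Xc Q - Xc P) = Yc Q - Yc P := ⟨(Yc Q - Yc P)/(Xc Q - Xc P), by field_simp⟩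
    have lin : ∀ T : Pt A B, (Xc Q - Xc P) * (Yc T - Yc P) - (Xc T - Xc P) * (Yc Q - Yc P) = 0 → Yc T - Yc P = m * (Xc T - Xc P) := by
      intro T h
      apply mul_left_cancel₀ hx'
      linear_combination h - (Xc T - Xc P) * hm
    have key : ∀ T : Pt A B, T ≠ 0 → P ≠ T → Q ≠ T → (Xc Q - Xc P) * (Yc T - Yc P) - (Xc T - Xc P) * (Yc Q - Yc P) = 0 →
        Xc P + Xc Q + Xc T = m^2 := by
      intro T hT hPT hQT h
      have l := lin T h
      have a1 : Xc T - Xc P ≠ 0 := by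
        intro h; rw [h, mul_zero] at l
        exact hPT (pt_ext hP hT (sub_eq_zero.mp h).symm (sub_eq_zero.mp l).symm)
      have a2 : Xc T - Xc Q ≠ 0 := by
        intro h
        exact hQT (pt_ext hQ hT (sub_eq_zero.mp h).symm (by linear_combination -m * h - l - hm))
      have eP := sw_eq hP
      have eQ := sw_eq hQ
      have eT := sw_eq hT
      have yT : Yc T = Yc P + m * (Xc T - Xc P) := by linear_combination l
      have yQ : Yc Q = Yc P + m * (Xc Q - Xc P) := by linear_combination -hm
      have q1 : (Xc T - Xc P) * (Xc T^2 + Xc T * Xc P + Xc P^2 + A - 2 * Yc P * m - m^2 * (Xc T - Xc P)) = 0 := by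
        rw [yT] at eT; linear_combination eP - eT
      have q2 : (Xc Q - Xc P) * (Xc Q^2 + Xc Q * Xc P + Xc P^2 + A - 2 * Yc P * m - m^2 * (Xc Q - Xc P)) = 0 := by
        rw [yQ] at eQ; linear_combination eP - eQ
      have r1 := (mul_eq_zero.mp q1).resolve_left a1
      have r2 := (mul_eq_zero.mp q2).resolve_left hx'
      have q3 : (Xc T - Xc Q) * (Xc P + Xc Q + Xc T - m^2) = 0 := by linear_combination r1 - r2
      have r3 := (mul_eq_zero.mp q3).resolve_left a2
      linear_combination r3
    have k1 := key R hR hPR hQR h1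
    have k2 := key S hS hPS hQS h2
    have hX : Xc R = Xc S := by linear_combination k1 - k2
    apply hRS
    exact pt_ext hR hS hX (by linear_combination lin R h1 - lin S h2 + m * hX)

/-! chord polynomials -/
noncomputable def aP (u : K) : K[X] := X - C u
noncomputable def G0 (A B u w : K) : K[X] := fP A B + C w * C w - (X + X + C u) * (aP u * aP u)
noncomputable def G1 (w : K) : K[X] := -(C w + C w)
noncomputable def H0 (A B u w : K) : K[X] := C w * (G0 A B u w + fP A B + fP A B)
noncomputable def H1 (A B u w : K) : K[X] :=
  -(G0 A B u w + C w * C w + C w * C w + aP u * aP u * aP u + aP u * aP u * aP u)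

theorem chord {P T : Pt A B} (hP : P ≠ 0) (hT : T ≠ 0) (hx : Xc P ≠ Xc T) :
    (Xc P - Xc T)^2 * (Xc (P+T) - Xc P) = (G0 A B (Xc T) (Yc T)).eval (Xc P) + (G1 (Yc T)).eval (Xc P) * Yc P ∧
    (Xc P - Xc T)^3 * (Yc (P+T) - Yc P) = (H0 A B (Xc T) (Yc T)).eval (Xc P) + (H1 A B (Xc T) (Yc T)).eval (Xc P) * Yc P := by
  obtain ⟨_, h1, h2⟩ := add_formula hP hT hx
  have ha : Xc P - Xc T ≠ 0 := sub_ne_zero.mpr hx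
  have eP := sw_eq hP
  have eT := sw_eq hT
  have g : (Xc P - Xc T)^2 * (Xc (P+T) - Xc P) = (G0 A B (Xc T) (Yc T)).eval (Xc P) + (G1 (Yc T)).eval (Xc P) * Yc P := by
    rw [h1]
    simp only [G0, G1, aP, eval_add, eval_sub, eval_mul, eval_neg, eval_X, eval_C, fP_eval]
    field_simp
    linear_combination eP
  refine ⟨g, ?_⟩
  have h3 : (Xc P - Xc T)^3 * (Yc (P+T) - Yc P) = - (Yc P - Yc T) * ((Xc P - Xc T)^2 * (Xc (P+T) - Xc P)) - 2 * Yc P * (Xc P - Xc T)^3 := by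
    rw [h2]; field_simp; ring
  rw [h3, g]
  simp only [G0, G1, H0, H1, aP, eval_add, eval_sub, eval_mul, eval_neg, eval_X, eval_C, fP_eval]
  linear_combination (2 * Yc T) * eP

end geom
end APR

set_option linter.unusedSectionVars false
set_option linter.unusedVariables false
set_option linter.unusedSimpArgs false
namespace APR
open WeierstrassCurve Height Polynomial

section geom
variable {K : Type*} [Field K] [CharZero K] [DecidableEq K] {A B : K}

noncomputable def V0 (A B u w u' w' : K) : K[X] :=
  aP u * (G0 A B u w * H0 A B u' w' + G1 w * H1 A B u' w' * fP A B)
   - aP u' * (G0 A B u' w' * H0 A B u w + G1 w' * H1 A B u w * fP A B)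
noncomputable def V1 (A B u w u' w' : K) : K[X] :=
  aP u * (G0 A B u w * H1 A B u' w' + G1 w * H0 A B u' w')
   - aP u' * (G0 A B u' w' * H1 A B u w + G1 w' * H0 A B u w)
noncomputable def D0 (A B u1 w1 m1 u2 w2 m2 u3 w3 m3 : K) : K[X] :=
  C m1 * (aP u1 * aP u1 * aP u1) * V0 A B u2 w2 u3 w3 + C m2 * (aP u2 * aP u2 * aP u2) * V0 A B u3 w3 u1 w1
   + C m3 * (aP u3 * aP u3 * aP u3) * V0 A B u1 w1 u2 w2
noncomputable def D1 (A B u1 w1 m1 u2 w2 m2 u3 w3 m3 : K) : K[X] :=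
  C m1 * (aP u1 * aP u1 * aP u1) * V1 A B u2 w2 u3 w3 + C m2 * (aP u2 * aP u2 * aP u2) * V1 A B u3 w3 u1 w1
   + C m3 * (aP u3 * aP u3 * aP u3) * V1 A B u1 w1 u2 w2
noncomputable def DN (A B u1 w1 m1 u2 w2 m2 u3 w3 m3 : K) : K[X] :=
  D0 A B u1 w1 m1 u2 w2 m2 u3 w3 m3 * D0 A B u1 w1 m1 u2 w2 m2 u3 w3 m3
   - fP A B * (D1 A B u1 w1 m1 u2 w2 m2 u3 w3 m3 * D1 A B u1 w1 m1 u2 w2 m2 u3 w3 m3)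

theorem V_eval (A B u w u' w' x y : K) (e : (fP A B).eval x = y^2) :
    (V0 A B u w u' w').eval x + (V1 A B u w u' w').eval x * y =
     (x-u) * ((G0 A B u w).eval x + (G1 w).eval x * y) * ((H0 A B u' w').eval x + (H1 A B u' w').eval x * y)
     - (x-u') * ((G0 A B u' w').eval x + (G1 w').eval x * y) * ((H0 A B u w).eval x + (H1 A B u w).eval x * y) := by
  simp only [V0, V1, eval_add, eval_sub, eval_mul, e]
  simp only [aP, eval_sub, eval_X, eval_C]
  ring

theorem D_eval (A B u1 w1 m1 u2 w2 m2 u3 w3 m3 x y : K) :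
    (D0 A B u1 w1 m1 u2 w2 m2 u3 w3 m3).eval x + (D1 A B u1 w1 m1 u2 w2 m2 u3 w3 m3).eval x * y =
     m1 * (x-u1)^3 * ((V0 A B u2 w2 u3 w3).eval x + (V1 A B u2 w2 u3 w3).eval x * y)
     + m2 * (x-u2)^3 * ((V0 A B u3 w3 u1 w1).eval x + (V1 A B u3 w3 u1 w1).eval x * y)
     + m3 * (x-u3)^3 * ((V0 A B u1 w1 u2 w2).eval x + (V1 A B u1 w1 u2 w2).eval x * y) := by
  simp only [D0, D1, eval_add, eval_sub, eval_mul, eval_C]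
  simp only [aP, eval_sub, eval_X, eval_C]
  ring

/-- the relation forces the determinant to vanish -/
theorem D_vanish {P T1 T2 T3 : Pt A B} (hP : P ≠ 0) (h1 : T1 ≠ 0) (h2 : T2 ≠ 0) (h3 : T3 ≠ 0)
    (x1 : Xc P ≠ Xc T1) (x2 : Xc P ≠ Xc T2) (x3 : Xc P ≠ Xc T3) (α b m1 m2 m3 : K)
    (r1 : α * (Xc (P+T1) - Xc P) + b * (Yc (P+T1) - Yc P) = m1)
    (r2 : α * (Xc (P+T2) - Xc P) + b * (Yc (P+T2) - Yc P) = m2)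
    (r3 : α * (Xc (P+T3) - Xc P) + b * (Yc (P+T3) - Yc P) = m3) :
    (DN A B (Xc T1) (Yc T1) m1 (Xc T2) (Yc T2) m2 (Xc T3) (Yc T3) m3).eval (Xc P) = 0 := by
  have e := fP_Xc hP
  have d : (D0 A B (Xc T1) (Yc T1) m1 (Xc T2) (Yc T2) m2 (Xc T3) (Yc T3) m3).eval (Xc P) +
     (D1 A B (Xc T1) (Yc T1) m1 (Xc T2) (Yc T2) m2 (Xc T3) (Yc T3) m3).eval (Xc P) * Yc P = 0 := by
    rw [D_eval, V_eval _ _ _ _ _ _ _ _ e, V_eval _ _ _ _ _ _ _ _ e, V_eval _ _ _ _ _ _ _ _ e]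
    obtain ⟨a1, b1⟩ := chord hP h1 x1
    obtain ⟨a2, b2⟩ := chord hP h2 x2
    obtain ⟨a3, b3⟩ := chord hP h3 x3
    rw [← a1, ← b1, ← a2, ← b2, ← a3, ← b3, ← r1, ← r2, ← r3]
    ring
  simp only [DN, eval_sub, eval_mul, e]
  set p := (D0 A B (Xc T1) (Yc T1) m1 (Xc T2) (Yc T2) m2 (Xc T3) (Yc T3) m3).eval (Xc P)
  set q := (D1 A B (Xc T1) (Yc T1) m1 (Xc T2) (Yc T2) m2 (Xc T3) (Yc T3) m3).eval (Xc P)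
  linear_combination (p - q * Yc P) * d

/-- nonvanishing of the determinant -/
theorem D_ne {T1 T2 T3 : Pt A B} (h1 : T1 ≠ 0) (h2 : T2 ≠ 0) (h3 : T3 ≠ 0) (hy : Yc T1 ≠ 0)
    (x2 : Xc T1 ≠ Xc T2) (x3 : Xc T1 ≠ Xc T3) (m1 m2 m3 : K)
    (hn : m2 * (Xc (T3 - T1) - Xc T1) ≠ m3 * (Xc (T2 - T1) - Xc T1)) :
    DN A B (Xc T1) (Yc T1) m1 (Xc T2) (Yc T2) m2 (Xc T3) (Yc T3) m3 ≠ 0 := by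
  apply norm_ne
  rintro ⟨p0, q0⟩
  have hN : -T1 ≠ 0 := neg_ne_zero.mpr h1
  have e : (fP A B).eval (Xc T1) = (Yc (-T1))^2 := by rw [← Xc_neg]; exact fP_Xc hN
  have d := D_eval A B (Xc T1) (Yc T1) m1 (Xc T2) (Yc T2) m2 (Xc T3) (Yc T3) m3 (Xc T1) (Yc (-T1))
  rw [p0, q0, V_eval _ _ _ _ _ _ _ _ e, V_eval _ _ _ _ _ _ _ _ e, V_eval _ _ _ _ _ _ _ _ e] at d
  have c2 := (chord hN h2 (by rwa [Xc_neg])).1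
  have c3 := (chord hN h3 (by rwa [Xc_neg])).1
  rw [Xc_neg] at c2 c3
  rw [← c2, ← c3] at d
  have hH : (H0 A B (Xc T1) (Yc T1)).eval (Xc T1) + (H1 A B (Xc T1) (Yc T1)).eval (Xc T1) * Yc (-T1) = 8 * Yc T1^3 := by
    have e' := sw_eq h1
    simp only [G0, H0, H1, aP, eval_add, eval_sub, eval_mul, eval_neg, eval_X, eval_C, fP_eval, Yc_neg]
    linear_combination (-4 * Yc T1) * e'
  rw [hH] at d
  have s2 : -T1 + T2 = T2 - T1 := by abel
  have s3 : -T1 + T3 = T3 - T1 := by abel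
  rw [s2, s3] at d
  simp only [eval_zero, sub_self] at d
  apply hn
  have a2 : Xc T1 - Xc T2 ≠ 0 := sub_ne_zero.mpr x2
  have a3 : Xc T1 - Xc T3 ≠ 0 := sub_ne_zero.mpr x3
  have hc : 8 * Yc T1^3 * ((Xc T1 - Xc T2)^3 * (Xc T1 - Xc T3)^3) ≠ 0 :=
    mul_ne_zero (mul_ne_zero (by norm_num) (pow_ne_zero _ hy)) (mul_ne_zero (pow_ne_zero _ a2) (pow_ne_zero _ a3))
  apply mul_left_cancel₀ hc
  linear_combination -d

/-- degenerate case counting -/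
theorem degenerate_card {ι : Type*} (S : Finset ι) (R : ι → Pt A B) (hinj : Set.InjOn R S) (Q : Pt A B) (hQ : Q ≠ 0)
    (h0 : ∀ i ∈ S, R i ≠ 0) (hx : ∀ i ∈ S, Xc (R i) ≠ Xc Q) (α b c0 c1 : K) (hc1 : c1 ≠ 0)
    (hr : ∀ i ∈ S, α * Xc (R i + Q) + b * Yc (R i + Q) = c0 + c1 * Xc (R i)) : S.card ≤ 18 := by
  set u := Xc Q with hu
  set w := Yc Q with hw
  let p : K[X] := C α * aP u * (G0 A B u w + X * (aP u * aP u)) + C b * H0 A B u w - (C c0 + C c1 * X) * (aP u * aP u * aP u)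
  let q : K[X] := C α * aP u * G1 w + C b * (H1 A B u w + aP u * aP u * aP u)
  have hp : p ≠ 0 := by
    intro h
    have h4 : p.coeff 4 = -c1 := by
      have h5 : (p + C c1 * X^4).natDegree ≤ 3 := by
        have : p + C c1 * X^4 = C α * aP u * (C u * X^2 + C (u^2+A)*X + C (B + w^2-u^3)) + C b * H0 A B u w
           - C c0 * (aP u * aP u * aP u) - C c1 * X * (C (-3*u)*X^2 + C (3*u^2) * X - C (u^3)) := by
          simp only [p, G0, aP, fP, C_add, C_sub, C_mul, C_pow, C_neg]
          simp only [map_ofNat]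
          ring
        rw [this]
        unfold H0 G0 aP fP
        compute_degree
      have h6 : (p + C c1 * X^4).coeff 4 = 0 := coeff_eq_zero_of_natDegree_lt (by omega)
      simp only [coeff_add, coeff_C_mul, coeff_X_pow, if_true, mul_one] at h6
      linear_combination h6
    rw [h] at h4
    simp at h4; exact hc1 h4
  have hN := norm_ne (A := A) (B := B) (p := p) (q := q) (fun h => hp h.1)
  have hd : (p*p - fP A B * (q*q)).natDegree ≤ 9 := by
    simp only [p, q]
    unfold H0 H1 G0 G1 aP fP
    compute_degree
  refine (card_root S R hinj h0 _ hN ?_).trans (by omega)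
  intro i hi
  have e := fP_Xc (h0 i hi)
  have c := chord (h0 i hi) hQ (hx i hi)
  have r := hr i hi
  have d : p.eval (Xc (R i)) + q.eval (Xc (R i)) * Yc (R i) = 0 := by
    simp only [p, q, eval_add, eval_sub, eval_mul, eval_C, eval_X]
    simp only [aP, eval_sub, eval_X, eval_C]
    linear_combination (-α * (Xc (R i) - u)) * c.1 - b * c.2 + (Xc (R i) - u)^3 * r
  simp only [eval_sub, eval_mul, e]
  linear_combination (p.eval (Xc (R i)) - q.eval (Xc (R i)) * Yc (R i)) * d
end geom
end APR

set_option linter.unusedSectionVars false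
set_option linter.unusedVariables false
set_option linter.unusedSimpArgs false
namespace APR
open WeierstrassCurve Height Polynomial

section geom
variable {K : Type*} [Field K] [NumberField K] [DecidableEq K] {A B : K}

theorem HB.Y {β : ℝ} (hβ : (totalWeight K : ℝ) ≤ β) (hA : HB β A 1) (hB : HB β B 1) {P : Pt A B} {c : ℕ}
    (h : HB β (Xc P) c) : HB β (Yc P) (2*c+2) := by
  by_cases hP : P = 0
  · subst hP; rw [Yc_zero]; exact HB.zero.mono hβ (Nat.zero_le _)
  have e := sw_eq hP
  have h1 := (((h.mul h).mul h).add hβ (hA.mul h)).add hβ hB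
  have h2 : Xc P * Xc P * Xc P + A * Xc P + B = Yc P^2 := by rw [e]; ring
  rw [h2] at h1
  unfold HB at *
  rw [logHeight₁_pow] at h1
  push_cast at *
  linarith

theorem PB.mono {β : ℝ} (hβ : (totalWeight K : ℝ) ≤ β) {p : K[X]} {n c n' c' : ℕ} (h : PB β p n c) (hn : n ≤ n') (hc : c ≤ c') :
    PB β p n' c' := ⟨h.deg.trans hn, fun k => (h.ht k).mono hβ hc⟩

section
variable {β : ℝ} {u w u' w' : K}

theorem PB_f (hβ : (totalWeight K : ℝ) ≤ β) (hA : HB β A 1) (hB : HB β B 1) : PB β (fP A B) 3 30 := by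
  unfold fP
  refine (PB.add hβ (PB.add hβ (PB.mul hβ (PB.mul hβ PB.X PB.X) PB.X) (PB.mul hβ (PB.C hβ hA) PB.X)) (PB.C hβ hB)).mono hβ ?_ ?_ <;> norm_num

theorem PB_a (hβ : (totalWeight K : ℝ) ≤ β) (hu : HB β u 1) : PB β (aP u) 1 2 := by
  unfold aP
  exact (PB.sub hβ PB.X (PB.C hβ hu)).mono hβ (by norm_num) (by norm_num)

theorem PB_a3 (hβ : (totalWeight K : ℝ) ≤ β) (hu : HB β u 1) : PB β (aP u * aP u * aP u) 3 100 := by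
  have h := PB_a hβ hu
  exact (PB.mul hβ (PB.mul hβ h h) h).mono hβ (by norm_num) (by norm_num)

theorem PB_G0 (hβ : (totalWeight K : ℝ) ≤ β) (hA : HB β A 1) (hB : HB β B 1) (hu : HB β u 1) (hw : HB β w 4) : PB β (G0 A B u w) 3 150 := by
  unfold G0
  have h := PB_a hβ hu
  have hf := PB_f hβ hA hB
  have hw := PB.C hβ hw
  refine (PB.sub hβ (PB.add hβ hf (PB.mul hβ hw hw)) (PB.mul hβ (PB.add hβ (PB.add hβ PB.X PB.X) (PB.C hβ hu)) (PB.mul hβ h h))).mono hβ ?_ ?_ <;> norm_num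

theorem PB_G1 (hβ : (totalWeight K : ℝ) ≤ β) (hw : HB β w 4) : PB β (G1 w) 0 9 := by
  unfold G1
  have hw := PB.C hβ hw
  refine (PB.neg (PB.add hβ hw hw)).mono hβ ?_ ?_ <;> norm_num

theorem PB_H0 (hβ : (totalWeight K : ℝ) ≤ β) (hA : HB β A 1) (hB : HB β B 1) (hu : HB β u 1) (hw : HB β w 4) : PB β (H0 A B u w) 3 1000 := by
  unfold H0
  have hf := PB_f hβ hA hB
  have hg := PB_G0 hβ hA hB hu hw
  have hw := PB.C hβ hw
  refine (PB.mul hβ hw (PB.add hβ (PB.add hβ hg hf) hf)).mono hβ ?_ ?_ <;> norm_num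

theorem PB_H1 (hβ : (totalWeight K : ℝ) ≤ β) (hA : HB β A 1) (hB : HB β B 1) (hu : HB β u 1) (hw : HB β w 4) : PB β (H1 A B u w) 3 1000 := by
  unfold H1
  have ha := PB_a3 hβ hu
  have hg := PB_G0 hβ hA hB hu hw
  have hw := PB.C hβ hw
  refine (PB.neg (PB.add hβ (PB.add hβ (PB.add hβ (PB.add hβ hg (PB.mul hβ hw hw)) (PB.mul hβ hw hw)) ha) ha)).mono hβ ?_ ?_ <;> norm_num

theorem PB_V0 (hβ : (totalWeight K : ℝ) ≤ β) (hA : HB β A 1) (hB : HB β B 1) (hu : HB β u 1) (hw : HB β w 4) (hu' : HB β u' 1) (hw' : HB β w' 4) :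
    PB β (V0 A B u w u' w') 7 1000000 := by
  unfold V0
  have hf := PB_f hβ hA hB
  have a := PB_a hβ hu
  have a' := PB_a hβ hu'
  have g := PB_G0 hβ hA hB hu hw
  have g' := PB_G0 hβ hA hB hu' hw'
  have k := PB_G1 hβ hw
  have k' := PB_G1 hβ hw'
  have h0 := PB_H0 hβ hA hB hu hw
  have h0' := PB_H0 hβ hA hB hu' hw'
  have h1 := PB_H1 hβ hA hB hu hw
  have h1' := PB_H1 hβ hA hB hu' hw'
  refine (PB.sub hβ (PB.mul hβ a (PB.add hβ (PB.mul hβ g h0') (PB.mul hβ (PB.mul hβ k h1') hf)))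
    (PB.mul hβ a' (PB.add hβ (PB.mul hβ g' h0) (PB.mul hβ (PB.mul hβ k' h1) hf)))).mono hβ ?_ ?_ <;> norm_num

theorem PB_V1 (hβ : (totalWeight K : ℝ) ≤ β) (hA : HB β A 1) (hB : HB β B 1) (hu : HB β u 1) (hw : HB β w 4) (hu' : HB β u' 1) (hw' : HB β w' 4) :
    PB β (V1 A B u w u' w') 7 1000000 := by
  unfold V1
  have a := PB_a hβ hu
  have a' := PB_a hβ hu'
  have g := PB_G0 hβ hA hB hu hw
  have g' := PB_G0 hβ hA hB hu' hw'
  have k := PB_G1 hβ hw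
  have k' := PB_G1 hβ hw'
  have h0 := PB_H0 hβ hA hB hu hw
  have h0' := PB_H0 hβ hA hB hu' hw'
  have h1 := PB_H1 hβ hA hB hu hw
  have h1' := PB_H1 hβ hA hB hu' hw'
  refine (PB.sub hβ (PB.mul hβ a (PB.add hβ (PB.mul hβ g h1') (PB.mul hβ k h0')))
    (PB.mul hβ a' (PB.add hβ (PB.mul hβ g' h1) (PB.mul hβ k' h0)))).mono hβ ?_ ?_ <;> norm_num

theorem PB_DN (hβ : (totalWeight K : ℝ) ≤ β) (hA : HB β A 1) (hB : HB β B 1) {u1 w1 m1 u2 w2 m2 u3 w3 m3 : K} (hu1 : HB β u1 1) (hw1 : HB β w1 4) (hm1 : HB β m1 1)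
    (hu2 : HB β u2 1) (hw2 : HB β w2 4) (hm2 : HB β m2 1) (hu3 : HB β u3 1) (hw3 : HB β w3 4) (hm3 : HB β m3 1) :
    PB β (DN A B u1 w1 m1 u2 w2 m2 u3 w3 m3) 23 100000000000 := by
  have hf := PB_f hβ hA hB
  have a1 := PB.mul hβ (PB.C hβ hm1) (PB_a3 hβ hu1)
  have a2 := PB.mul hβ (PB.C hβ hm2) (PB_a3 hβ hu2)
  have a3 := PB.mul hβ (PB.C hβ hm3) (PB_a3 hβ hu3)
  have d0 : PB β (D0 A B u1 w1 m1 u2 w2 m2 u3 w3 m3) 10 40000000 := by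
    unfold D0
    refine (PB.add hβ (PB.add hβ (PB.mul hβ a1 (PB_V0 hβ hA hB hu2 hw2 hu3 hw3)) (PB.mul hβ a2 (PB_V0 hβ hA hB hu3 hw3 hu1 hw1)))
      (PB.mul hβ a3 (PB_V0 hβ hA hB hu1 hw1 hu2 hw2))).mono hβ ?_ ?_ <;> norm_num
  have d1 : PB β (D1 A B u1 w1 m1 u2 w2 m2 u3 w3 m3) 10 40000000 := by
    unfold D1
    refine (PB.add hβ (PB.add hβ (PB.mul hβ a1 (PB_V1 hβ hA hB hu2 hw2 hu3 hw3)) (PB.mul hβ a2 (PB_V1 hβ hA hB hu3 hw3 hu1 hw1)))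
      (PB.mul hβ a3 (PB_V1 hβ hA hB hu1 hw1 hu2 hw2))).mono hβ ?_ ?_ <;> norm_num
  unfold DN
  refine (PB.sub hβ (PB.mul hβ d0 d0) (PB.mul hβ hf (PB.mul hβ d1 d1))).mono hβ ?_ ?_ <;> norm_num

end

/-- F1 -/
theorem F1 {β : ℝ} (hβ : (totalWeight K : ℝ) ≤ β) (hA : HB β A 1) (hB : HB β B 1) {P : Pt A B} (hP : P ≠ 0)
    {e α b : K} (he : HB β e 3) (hα : HB β α 1) (hb : HB β b 1) (h0 : ¬ (α = 0 ∧ b = 0)) (hr : α * Xc P + b * Yc P = e) :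
    HB β (Xc P) 10000 := by
  have hf := PB_f hβ hA hB
  have he := PB.C hβ he
  have hα := PB.C hβ hα
  have hb := PB.C hβ hb
  have l := PB.sub hβ he (PB.mul hβ hα PB.X)
  have hp := PB.sub hβ (PB.mul hβ (PB.mul hβ hb hb) hf) (PB.mul hβ l l)
  refine (root_height hβ (x := Xc P) hp ?_ ?_).mono hβ (by norm_num)
  · have : C b * C b * fP A B - (C e - C α * X) * (C e - C α * X) = (⟨b^2, -α^2, b^2*A+2*e*α, b^2*B-e^2⟩ : Cubic K).toPoly := by
      simp only [Cubic.toPoly, fP, C_add, C_sub, C_mul, C_pow, C_neg]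
      simp only [map_ofNat]
      ring
    rw [this]
    by_cases hb0 : b = 0
    · apply Cubic.ne_zero_of_b_ne_zero
      simp; intro h; exact h0 ⟨h, hb0⟩
    · apply Cubic.ne_zero_of_a_ne_zero
      simp [hb0]
  · simp only [eval_sub, eval_mul, eval_C, eval_X, fP_Xc hP]
    rw [← hr]; ring

/-- F2 -/
theorem F2 {β : ℝ} (hβ : (totalWeight K : ℝ) ≤ β) (hA : HB β A 1) (hB : HB β B 1) {P Q R S : Pt A B}
    (hP : P ≠ 0) (hQ : Q ≠ 0) (hR : R ≠ 0) (hS : S ≠ 0)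
    (hPQ : P ≠ Q) (hPR : P ≠ R) (hPS : P ≠ S) (hQR : Q ≠ R) (hQS : Q ≠ S) (hRS : R ≠ S)
    (xP : HB β (Xc P) 1) (xQ : HB β (Xc Q) 1) (xR : HB β (Xc R) 1) (xS : HB β (Xc S) 1)
    {e α b n1 n2 n3 n4 : K} (rP : α * Xc P + b * Yc P = e + n1) (rQ : α * Xc Q + b * Yc Q = e + n2)
    (rR : α * Xc R + b * Yc R = e + n3) (rS : α * Xc S + b * Yc S = e + n4)
    (h1 : HB β n1 1) (h2 : HB β n2 1) (h3 : HB β n3 1) (h4 : HB β n4 1) :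
    HB β e 1000 ∧ HB β α 1000 ∧ HB β b 1000 := by
  have key : ∀ (T : Pt A B) (n : K), T ≠ 0 → HB β (Xc T) 1 → α * Xc T + b * Yc T = e + n → HB β n 1 →
      (Xc Q - Xc P) * (Yc T - Yc P) - (Xc T - Xc P) * (Yc Q - Yc P) ≠ 0 → HB β e 1000 ∧ HB β α 1000 ∧ HB β b 1000 := by
    intro T n hT xT rT hn hd
    have yP := HB.Y hβ hA hB xP
    have yQ := HB.Y hβ hA hB xQ
    have yT := HB.Y hβ hA hB xT
    have hD := ((xQ.sub hβ xP).mul (yT.sub hβ yP)).sub hβ ((xT.sub hβ xP).mul (yQ.sub hβ yP))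
    have ha : α = ((n2 - n1) * (Yc T - Yc P) - (n - n1) * (Yc Q - Yc P)) /
       ((Xc Q - Xc P) * (Yc T - Yc P) - (Xc T - Xc P) * (Yc Q - Yc P)) := by
      rw [eq_div_iff hd]
      linear_combination (Yc T - Yc P) * (rQ - rP) - (Yc Q - Yc P) * (rT - rP)
    have hb : b = ((n - n1) * (Xc Q - Xc P) - (n2 - n1) * (Xc T - Xc P)) /
       ((Xc Q - Xc P) * (Yc T - Yc P) - (Xc T - Xc P) * (Yc Q - Yc P)) := by
      rw [eq_div_iff hd]
      linear_combination (Xc Q - Xc P) * (rT - rP) - (Xc T - Xc P) * (rQ - rP)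
    have hα := ((((h2.sub hβ h1).mul (yT.sub hβ yP)).sub hβ ((hn.sub hβ h1).mul (yQ.sub hβ yP))).div hD)
    rw [← ha] at hα
    have hβ' := ((((hn.sub hβ h1).mul (xQ.sub hβ xP)).sub hβ ((h2.sub hβ h1).mul (xT.sub hβ xP))).div hD)
    rw [← hb] at hβ'
    have he : e = α * Xc P + b * Yc P - n1 := by rw [rP]; ring
    have hE := ((hα.mul xP).add hβ (hβ'.mul yP)).sub hβ h1
    rw [← he] at hE
    exact ⟨hE.mono hβ (by norm_num), hα.mono hβ (by norm_num), hβ'.mono hβ (by norm_num)⟩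
  by_cases d1 : (Xc Q - Xc P) * (Yc R - Yc P) - (Xc R - Xc P) * (Yc Q - Yc P) = 0
  · by_cases d2 : (Xc Q - Xc P) * (Yc S - Yc P) - (Xc S - Xc P) * (Yc Q - Yc P) = 0
    · exact (noncol4 hP hQ hR hS hPQ hPR hPS hQR hQS hRS d1 d2).elim
    · exact key S n4 hS xS rS h4 d2
  · exact key R n3 hR xR rR h3 d1
end geom
end APR

set_option linter.unusedSectionVars false
set_option linter.unusedVariables false
set_option linter.unusedSimpArgs false
namespace APR
open WeierstrassCurve Height Polynomial

section geom
variable {K : Type*} [Field K] [NumberField K] [DecidableEq K] {A B : K}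

theorem card_val {ι G : Type*} [DecidableEq G] (S : Finset ι) (P : ι → G) (hinj : Set.InjOn P S) (v : G) :
    (S.filter (fun i => P i = v)).card ≤ 1 := by
  rw [Finset.card_le_one]
  intro a ha b hb
  rw [Finset.mem_filter] at ha hb
  exact hinj ha.1 hb.1 (ha.2.trans hb.2.symm)

theorem F4 {β : ℝ} (hβ : (totalWeight K : ℝ) ≤ β) (hA : HB β A 1) (hB : HB β B 1) (hdec : DecidableEq (Pt A B))
    (S : Finset ℕ) (P : ℕ → Pt A B) (hinj : Set.InjOn P S) (h0 : ∀ i ∈ S, P i ≠ 0) (e α b : K)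
    (hr : ∀ i ∈ S, α * Xc (P i) + b * Yc (P i) = e + i) (hd : ∀ i ∈ S, ∀ j ∈ S, HB β (Xc (P i - P j)) 1)
    (hm : ∀ i ∈ S, ∀ j ∈ S, HB β ((i:K) - j) 1) (hcard : 40 ≤ S.card) :
    ∃ i ∈ S, HB β (Xc (P i)) 4600000000023 := by
  obtain ⟨o, ho⟩ : S.Nonempty := Finset.card_pos.mp (by omega)
  have hl : ∃ l ∈ S, P l ≠ P o ∧ Yc (P l - P o) ≠ 0 ∧ P l ≠ P o + P o := by
    by_contra hcon
    push Not at hcon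
    have hsub : S ⊆ S.filter (fun i => P i = P o) ∪ S.filter (fun i => P i ≠ P o ∧ Yc (P i - P o) = 0)
        ∪ S.filter (fun i => P i = P o + P o) := by
      intro i hi
      have := hcon i hi
      simp only [Finset.mem_union, Finset.mem_filter]
      by_cases h1 : P i = P o
      · exact Or.inl (Or.inl ⟨hi, h1⟩)
      · by_cases h2 : Yc (P i - P o) = 0
        · exact Or.inl (Or.inr ⟨hi, h1, h2⟩)
        · exact Or.inr ⟨hi, this h1 h2⟩
    have c1 := card_val S P hinj (P o)
    have c2 := card_val S P hinj (P o + P o)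
    have c3 : (S.filter (fun i => P i ≠ P o ∧ Yc (P i - P o) = 0)).card ≤ 6 := by
      have := card_root (S.filter (fun i => P i ≠ P o ∧ Yc (P i - P o) = 0)) (fun i => P i - P o) (by
          intro i hi j hj hij
          have h1 := (Finset.mem_filter.mp hi).1
          have h2 := (Finset.mem_filter.mp hj).1
          exact hinj h1 h2 (sub_left_injective hij))
        (fun i hi => sub_ne_zero.mpr (Finset.mem_filter.mp hi).2.1) (fP A B) (fP_ne A B) (by
          intro i hi
          rw [fP_Xc (sub_ne_zero.mpr (Finset.mem_filter.mp hi).2.1), (Finset.mem_filter.mp hi).2.2]; simp)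
      rwa [fP_natDegree] at this
    have := Finset.card_le_card hsub
    have := Finset.card_union_le (S.filter (fun i => P i = P o) ∪ S.filter (fun i => P i ≠ P o ∧ Yc (P i - P o) = 0)) (S.filter (fun i => P i = P o + P o))
    have := Finset.card_union_le (S.filter (fun i => P i = P o)) (S.filter (fun i => P i ≠ P o ∧ Yc (P i - P o) = 0))
    omega
  obtain ⟨l, hlS, hlo, hlY, hl2⟩ := hl
  set S' := S.filter (fun j => P j ≠ P o ∧ P j ≠ P l ∧ P j ≠ P o + P o - P l ∧ P j ≠ P o + P o ∧ P j ≠ P l + P l) with hS'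
  have hS'c : S.card ≤ S'.card + 5 := by
    have hsub : S ⊆ S' ∪ S.filter (fun i => P i = P o) ∪ S.filter (fun i => P i = P l) ∪ S.filter (fun i => P i = P o + P o - P l)
      ∪ S.filter (fun i => P i = P o + P o) ∪ S.filter (fun i => P i = P l + P l) := by
      intro i hi
      simp only [Finset.mem_union, Finset.mem_filter, hS']
      tauto
    have := Finset.card_le_card hsub
    have c1 := card_val S P hinj (P o)
    have c2 := card_val S P hinj (P l)
    have c3 := card_val S P hinj (P o + P o - P l)
    have c4 := card_val S P hinj (P o + P o)
    have c5 := card_val S P hinj (P l + P l)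
    have u1 := Finset.card_union_le S' (S.filter (fun i => P i = P o))
    have u2 := Finset.card_union_le (S' ∪ S.filter (fun i => P i = P o)) (S.filter (fun i => P i = P l))
    have u3 := Finset.card_union_le (S' ∪ S.filter (fun i => P i = P o) ∪ S.filter (fun i => P i = P l)) (S.filter (fun i => P i = P o + P o - P l))
    have u4 := Finset.card_union_le (S' ∪ S.filter (fun i => P i = P o) ∪ S.filter (fun i => P i = P l) ∪ S.filter (fun i => P i = P o + P o - P l)) (S.filter (fun i => P i = P o + P o))
    have u5 := Finset.card_union_le (S' ∪ S.filter (fun i => P i = P o) ∪ S.filter (fun i => P i = P l) ∪ S.filter (fun i => P i = P o + P o - P l) ∪ S.filter (fun i => P i = P o + P o)) (S.filter (fun i => P i = P l + P l))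
    omega
  have hmem : ∀ j ∈ S', j ∈ S ∧ P j ≠ P o ∧ P j ≠ P l ∧ P j ≠ P o + P o - P l ∧ P j ≠ P o + P o ∧ P j ≠ P l + P l := by
    intro j hj; exact Finset.mem_filter.mp hj
  have hxo : ∀ a ∈ S, P a ≠ P o → P a ≠ P o + P o → Xc (P o) ≠ Xc (P a - P o) := by
    intro a ha h1 h2 h
    rcases X_eq (h0 o ho) (sub_ne_zero.mpr h1) h with h | h
    · apply h2; nth_rewrite 1 [h]; abel
    · apply h0 a ha
      have : P a = - (-(P a - P o)) + P o := by abel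
      rw [this, ← h]; abel
  have hrel : ∀ a ∈ S, α * (Xc (P o + (P a - P o)) - Xc (P o)) + b * (Yc (P o + (P a - P o)) - Yc (P o)) = (a:K) - o := by
    intro a ha
    rw [add_sub_cancel]
    linear_combination hr a ha - hr o ho
  by_cases hc : ∃ j ∈ S', ∃ k ∈ S', ((j:K) - o) * (Xc ((P k - P o) - (P l - P o)) - Xc (P l - P o)) ≠ ((k:K) - o) * (Xc ((P j - P o) - (P l - P o)) - Xc (P l - P o))
  · obtain ⟨j, hj, k, hk, hjk⟩ := hc
    obtain ⟨jS, j1, j2, j3, j4, j5⟩ := hmem j hj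
    obtain ⟨kS, k1, k2, k3, k4, k5⟩ := hmem k hk
    refine ⟨o, ho, ?_⟩
    have tl := sub_ne_zero.mpr hlo
    have tj := sub_ne_zero.mpr j1
    have tk := sub_ne_zero.mpr k1
    have hX : ∀ a, P a ≠ P o → P a ≠ P l → P a ≠ P o + P o - P l → Xc (P l - P o) ≠ Xc (P a - P o) := by
      intro a a1 a2 a3 h
      rcases X_eq tl (sub_ne_zero.mpr a1) h with h | h
      · exact a2 (sub_left_injective h).symm
      · apply a3
        have : P a = P o - (-(P a - P o)) := by abel
        rw [this, ← h]; abel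
    have hne := D_ne tl tj tk hlY (hX j j1 j2 j3) (hX k k1 k2 k3) ((l:K) - o) ((j:K) - o) ((k:K) - o) hjk
    have hv := D_vanish (h0 o ho) tl tj tk (hxo l hlS hlo hl2) (hxo j jS j1 j4) (hxo k kS k1 k4) α b _ _ _ (hrel l hlS) (hrel j jS) (hrel k kS)
    have hpb := PB_DN hβ hA hB (hd l hlS o ho) (HB.Y hβ hA hB (hd l hlS o ho)) (hm l hlS o ho)
       (hd j jS o ho) (HB.Y hβ hA hB (hd j jS o ho)) (hm j jS o ho)
       (hd k kS o ho) (HB.Y hβ hA hB (hd k kS o ho)) (hm k kS o ho)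
    exact (root_height hβ hpb hne hv).mono hβ (by norm_num)
  · exfalso
    push Not at hc
    obtain ⟨j, hj⟩ : S'.Nonempty := Finset.card_pos.mp (by omega)
    obtain ⟨jS, j1, j2, j3, j4, j5⟩ := hmem j hj
    have hjo : (j:K) - o ≠ 0 := by
      intro h
      have : j = o := by exact_mod_cast sub_eq_zero.mp h
      exact j1 (by rw [this])
    have hinj' : Set.InjOn (fun k => P k - P l) S' := by
      intro a ha b hb hab
      exact hinj (hmem a ha).1 (hmem b hb).1 (sub_left_injective hab)
    have hR0 : ∀ k ∈ S', P k - P l ≠ 0 := fun k hk => sub_ne_zero.mpr (hmem k hk).2.2.1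
    have hR : ∀ k, (P k - P o) - (P l - P o) = P k - P l := by intro k; abel
    simp only [hR] at hc
    by_cases hX : Xc (P j - P l) - Xc (P l - P o) = 0
    · have := card_root S' (fun k => P k - P l) hinj' hR0 (X - C (Xc (P l - P o))) (X_sub_C_ne_zero _) (by
        intro k hk
        have h := hc j hj k hk
        rw [hX, mul_zero] at h
        have h' := (mul_eq_zero.mp h).resolve_left hjo
        simpa using h')
      rw [natDegree_X_sub_C] at this
      omega
    · have := degenerate_card S' (fun k => P k - P l) hinj' (P l) (h0 l hlS) hR0 (by
          intro k hk h
          obtain ⟨kS, k1, k2, k3, k4, k5⟩ := hmem k hk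
          rcases X_eq (sub_ne_zero.mpr k2) (h0 l hlS) h with h | h
          · exact k5 (sub_eq_iff_eq_add.mp h)
          · apply h0 k kS
            have := sub_eq_iff_eq_add.mp h
            rw [this]; abel)
        α b (e + o - ((j:K) - o)/(Xc (P j - P l) - Xc (P l - P o)) * Xc (P l - P o)) (((j:K) - o)/(Xc (P j - P l) - Xc (P l - P o)))
        (div_ne_zero hjo hX) (by
          intro k hk
          have h := hc j hj k hk
          simp only [sub_add_cancel]
          rw [hr k (hmem k hk).1]
          field_simp
          linear_combination -h)
      omega
end geom
end APR

set_option linter.unusedSectionVars false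
set_option linter.unusedVariables false
set_option linter.unusedSimpArgs false
namespace APR
open WeierstrassCurve Height
open scoped TensorProduct

section base
variable {W : WeierstrassCurve ℚ} {K : Type} [Field K] [NumberField K] [DecidableEq K]
    {A B : K} [(SW A B).IsElliptic] {h0 : ℝ}

noncomputable def Setup.τ (s : Setup W K A B h0) : W.toAffine.Point →+ Pt A B := trHom s.hu s.hA s.hB

theorem Setup.τ_inj (s : Setup W K A B h0) : Function.Injective s.τ := tr_injective s.hu s.hA s.hB

theorem Setup.τ_ne (s : Setup W K A B h0) {P : W.toAffine.Point} (h : P ≠ 0) : s.τ P ≠ 0 := by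
  intro e
  exact h (s.τ_inj (by rw [e, map_zero]))

/-- the rational number attached to a point -/
theorem Setup.exists_w (s : Setup W K A B h0) (P : W.toAffine.Point) (hP : P ≠ 0) :
    ∃ w : ℚ, Xc (s.τ P) ^ s.k = (w : K) := by
  obtain ⟨q, hq⟩ := s.hur
  match P, hP with
  | .zero, h => exact absurd rfl h
  | .some x y h, _ =>
    refine ⟨(x + W.b₂/12)^s.k / q, ?_⟩
    have : Xc (s.τ (.some x y h)) = algebraMap ℚ K (x + W.b₂/12)/s.u^2 := Xc_tr s.hu s.hA s.hB h
    rw [this, div_pow, ← pow_mul, hq]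
    simp

theorem Dpos : (0:ℝ) < totalWeight K := by exact_mod_cast NumberField.totalWeight_pos K

theorem Setup.exists_pair (s : Setup W K A B h0) (P : W.toAffine.Point) :
    ∃ xz : ℤ × ℤ, IsCoprime xz.1 xz.2 ∧ (P = 0 → xz = (1, 0)) ∧
      (P ≠ 0 → xz.2 ≠ 0 ∧ Xc (s.τ P) ^ s.k * (xz.2 : K) = xz.1) ∧
      Real.log (max |xz.1| |xz.2| : ℤ) = s.k * (nh (s.τ P) / totalWeight K) := by
  by_cases hP : P = 0
  · subst hP
    refine ⟨(1, 0), isCoprime_one_left, fun _ => rfl, fun h => absurd rfl h, ?_⟩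
    simp [nh, Xc_zero]
  · obtain ⟨w, hw⟩ := s.exists_w P hP
    refine ⟨(w.num, w.den), Rat.isCoprime_num_den w, fun h => absurd h hP, fun _ => ⟨Int.natCast_ne_zero.mpr w.den_nz, ?_⟩, ?_⟩
    · have hd : ((w.den : ℤ) : K) ≠ 0 := by exact_mod_cast w.den_nz
      rw [hw]
      have : (w : K) = (w.num : K) / (w.den : ℤ) := by
        conv_lhs => rw [← Rat.num_div_den w]
        push_cast; rfl
      rw [this, div_mul_cancel₀ _ hd]
    · have e1 : logHeight₁ (Xc (s.τ P) ^ s.k) = s.k * logHeight₁ (Xc (s.τ P)) := logHeight₁_pow _ _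
      rw [hw, logHeight₁_rat, Rat.logHeight₁_eq_log_max] at e1
      have hD := Dpos (K := K)
      have e2 : (s.k:ℝ) * (nh (s.τ P) / totalWeight K) = Real.log (max w.num.natAbs w.den : ℕ) := by
        rw [← mul_div_assoc, show (s.k:ℝ) * nh (s.τ P) = _ from e1.symm]
        field_simp
      rw [e2]
      congr 1
      rw [Int.cast_max, Nat.cast_max]
      congr 1
      · rw [← Int.natCast_natAbs]; simp
      · simp

noncomputable def Setup.pr (s : Setup W K A B h0) (P : W.toAffine.Point) : ℤ × ℤ := (s.exists_pair P).choose

theorem Setup.pr_dbl (s : Setup W K A B h0) (P : W.toAffine.Point) :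
    ∃ g : ℤ, frm s.c (s.pr P).1 (s.pr P).2 = g * (s.pr (P+P)).1 ∧ frm s.d (s.pr P).1 (s.pr P).2 = g * (s.pr (P+P)).2 := by
  obtain ⟨h1, h2, h3, h4⟩ := (s.exists_pair P).choose_spec
  obtain ⟨k1, k2, k3, k4⟩ := (s.exists_pair (P+P)).choose_spec
  change IsCoprime (s.pr P).1 (s.pr P).2 at h1
  change P = 0 → s.pr P = (1,0) at h2
  change P ≠ 0 → (s.pr P).2 ≠ 0 ∧ Xc (s.τ P) ^ s.k * ((s.pr P).2 : K) = (s.pr P).1 at h3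
  change IsCoprime (s.pr (P+P)).1 (s.pr (P+P)).2 at k1
  change P+P = 0 → s.pr (P+P) = (1,0) at k2
  change P+P ≠ 0 → (s.pr (P+P)).2 ≠ 0 ∧ Xc (s.τ (P+P)) ^ s.k * ((s.pr (P+P)).2 : K) = (s.pr (P+P)).1 at k3
  generalize s.pr P = a at *
  generalize s.pr (P+P) = b at *
  obtain ⟨x, z⟩ := a
  obtain ⟨x', z'⟩ := b
  simp only at *
  by_cases hP : P = 0
  · have e1 := h2 hP
    have e2 := k2 (by rw [hP, add_zero])
    simp only [Prod.mk.injEq] at e1 e2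
    obtain ⟨rfl, rfl⟩ := e1
    obtain ⟨rfl, rfl⟩ := e2
    refine ⟨s.c 4, ?_, ?_⟩
    · rw [frm_eq]; simp
    · rw [frm_eq]; simp [s.ld.d4]
  · obtain ⟨hz, hx⟩ := h3 hP
    have hsm : ∀ c : Fin 5 → ℤ, ((frm c x z : ℤ) : K) = (z:K)^4 * frm c (Xc (s.τ P) ^ s.k) 1 := by
      intro c
      rw [← frm_smul, mul_one, mul_comm, hx]
      exact frm_map (Int.castRingHom K) c x z
    by_cases h2P : P + P = 0
    · have e2 := k2 h2P
      simp only [Prod.mk.injEq] at e2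
      obtain ⟨rfl, rfl⟩ := e2
      have := s.dbl0 (s.τ P) (s.τ_ne hP) (by rw [← map_add, h2P, map_zero])
      have e := hsm s.d
      rw [this, mul_zero] at e
      refine ⟨frm s.c x z, by ring, ?_⟩
      rw [mul_zero]; exact_mod_cast e
    · obtain ⟨hz', hx'⟩ := k3 h2P
      have := s.dbl1 (s.τ P) (s.τ_ne hP) (by rw [← map_add]; exact s.τ_ne h2P)
      rw [← map_add] at this
      have key : frm s.c x z * z' = x' * frm s.d x z := by
        have : ((frm s.c x z * z' : ℤ) : K) = ((x' * frm s.d x z : ℤ) : K) := by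
          rw [Int.cast_mul, Int.cast_mul, hsm, hsm, this, ← hx']; ring
        exact_mod_cast this
      obtain ⟨g, hg⟩ : z' ∣ frm s.d x z := by
        apply k1.symm.dvd_of_dvd_mul_left
        exact ⟨frm s.c x z, by rw [← key]; ring⟩
      refine ⟨g, ?_, by rw [hg]; ring⟩
      apply mul_right_cancel₀ hz'
      rw [key, hg]; ring

theorem Setup.mw (s : Setup W K A B h0) : Module.Finite ℤ W.toAffine.Point := by
  have h : AddGroup.FG (Pt A B) := mordell_weil s.hs s.hAe s.hBe
  have : Module.Finite ℤ (Pt A B) := Module.Finite.iff_addGroup_fg.mpr h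
  exact Module.Finite.of_injective s.τ.toIntLinearMap s.τ_inj

theorem Setup.exists_q (s : Setup W K A B h0) : ∃ q : W.toAffine.Point → ℝ, (∀ P, 0 ≤ q P) ∧
    (∀ P Q, q (P + Q) + q (P - Q) = 2 * (q P + q Q)) ∧ ∀ P, |q P - nh (s.τ P) / totalWeight K| ≤ 27 * h0 := by
  have hD := Dpos (K := K)
  obtain ⟨C, hC⟩ := nh_parallelogram (A := A) (B := B)
  obtain ⟨q, q1, q2, q3⟩ := canonical (fun P => nh (s.τ P) / totalWeight K)
    (fun P => div_nonneg (zero_le_logHeight₁ _) hD.le) (C / totalWeight K) (80*h0) (by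
      intro P Q
      have := hC (s.τ P) (s.τ Q)
      have e : nh (s.τ (P+Q)) / totalWeight K + nh (s.τ (P-Q)) / totalWeight K - 2 * (nh (s.τ P)/totalWeight K + nh (s.τ Q)/totalWeight K)
        = (nh (s.τ P + s.τ Q) + nh (s.τ P - s.τ Q) - 2*(nh (s.τ P) + nh (s.τ Q))) / totalWeight K := by
        rw [map_add, map_sub]; field_simp
      rw [e, abs_div, abs_of_pos hD]
      gcongr) (by
      intro P
      obtain ⟨h1, h2, h3, h4⟩ := (s.exists_pair P).choose_spec
      obtain ⟨k1, k2, k3, k4⟩ := (s.exists_pair (P+P)).choose_spec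
      obtain ⟨g, g1, g2⟩ := s.pr_dbl P
      have := s.ld.dbl _ _ _ _ g h1 k1 g1 g2
      rw [h4, k4] at this
      have hk : (1:ℝ) ≤ s.k := by exact_mod_cast s.hk1
      have e : (s.k:ℝ) * (nh (s.τ (P+P)) / totalWeight K) - 4 * (s.k * (nh (s.τ P) / totalWeight K))
        = s.k * (nh (s.τ (P+P)) / totalWeight K - 4 * (nh (s.τ P) / totalWeight K)) := by ring
      rw [e, abs_mul, abs_of_pos (by linarith : (0:ℝ) < s.k)] at this
      nlinarith [abs_nonneg (nh (s.τ (P+P)) / totalWeight K - 4 * (nh (s.τ P) / totalWeight K))])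
  refine ⟨q, q1, q2, fun P => (q3 P).trans ?_⟩
  have := s.h01
  linarith

theorem Setup.pr_spec (s : Setup W K A B h0) (P : W.toAffine.Point) : IsCoprime (s.pr P).1 (s.pr P).2 ∧ (P = 0 → s.pr P = (1, 0)) ∧
      (P ≠ 0 → (s.pr P).2 ≠ 0 ∧ Xc (s.τ P) ^ s.k * ((s.pr P).2 : K) = (s.pr P).1) ∧
      Real.log (max |(s.pr P).1| |(s.pr P).2| : ℤ) = s.k * (nh (s.τ P) / totalWeight K) :=
  (s.exists_pair P).choose_spec

theorem Setup.pr_bound (s : Setup W K A B h0) {q : W.toAffine.Point → ℝ}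
    (q3 : ∀ P, |q P - nh (s.τ P) / totalWeight K| ≤ 27 * h0) {R : ℝ} (P : W.toAffine.Point) (hP : q P ≤ R) :
    ((|(s.pr P).1| : ℤ) : ℝ) ≤ Real.exp (3*(R+27*h0)) ∧ ((|(s.pr P).2| : ℤ) : ℝ) ≤ Real.exp (3*(R+27*h0)) := by
  obtain ⟨h1, h2, h3, h4⟩ := s.pr_spec P
  generalize s.pr P = a at *
  have hpos : (0:ℤ) < max |a.1| |a.2| := by
    by_contra hc
    have e1 : |a.1| ≤ 0 := (le_max_left _ _).trans (not_lt.mp hc)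
    have e2 : |a.2| ≤ 0 := (le_max_right _ _).trans (not_lt.mp hc)
    rw [abs_nonpos_iff.mp e1, abs_nonpos_iff.mp e2] at h1
    exact not_isCoprime_zero_zero h1
  have hk : (s.k:ℝ) ≤ 3 := by exact_mod_cast s.hk3
  have hb := (abs_le.mp (q3 P)).1
  have hn : 0 ≤ nh (s.τ P) / totalWeight K := div_nonneg (zero_le_logHeight₁ _) (Dpos (K := K)).le
  have hle : Real.log (max |a.1| |a.2| : ℤ) ≤ 3*(R+27*h0) := by
    rw [h4]
    nlinarith
  have := (Real.log_le_iff_le_exp (by exact_mod_cast hpos)).mp hle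
  exact ⟨le_trans (by exact_mod_cast le_max_left _ _) this, le_trans (by exact_mod_cast le_max_right _ _) this⟩

theorem Setup.count (s : Setup W K A B h0) {q : W.toAffine.Point → ℝ} (q1 : ∀ P, 0 ≤ q P)
    (q2 : ∀ P Q, q (P + Q) + q (P - Q) = 2 * (q P + q Q))
    (q3 : ∀ P, |q P - nh (s.τ P) / totalWeight K| ≤ 27 * h0) (S : Finset W.toAffine.Point) (t : ℕ) (R : ℝ)
    (hR : 0 ≤ R) (hS : ∀ P ∈ S, 4^t * q P ≤ R) (hm : 12*(3*(R+27*h0)+1) ≤ (4:ℝ)^t) (κ : ℕ) (hκ : 80*h0 ≤ κ) :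
    S.card ≤ 1 + 6*(((10*κ)^2+1)*(4^t*4^t)) := by
  classical
  have h01 := s.h01
  obtain ⟨ℓ, hℓ, hℓρ, hℓb⟩ := exists_prime s.ρ s.ld.rho κ (by
    have : (1:ℝ) ≤ κ := by linarith
    exact_mod_cast this) (s.ld.lrho.trans hκ)
  have hc1 : S.card ≤ 1 + (S.erase 0).card := by
    have := Finset.pred_card_le_card_erase (s := S) (a := 0)
    omega
  have hE : ∀ P ∈ S.erase 0, P ≠ 0 ∧ P ∈ S := fun P hP => ⟨Finset.ne_of_mem_erase hP, Finset.mem_of_mem_erase hP⟩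
  generalize S.erase 0 = S0 at *
  let f : W.toAffine.Point → K := fun P => Xc (s.τ P)^s.k
  have hc2 : S0.card ≤ 6 * (S0.image f).card := by
    apply Finset.card_le_mul_card_image
    intro v hv
    have := card_root ({P ∈ S0 | f P = v} : Finset W.toAffine.Point) (fun P => s.τ P) (s.τ_inj.injOn) (by
      intro P hP
      exact s.τ_ne (hE P (Finset.mem_filter.mp hP).1).1) (Polynomial.X^s.k - Polynomial.C v)
      (Polynomial.X_pow_sub_C_ne_zero s.hk1 v) (by
      intro P hP
      have := (Finset.mem_filter.mp hP).2
      simp only [f] at this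
      simp [this])
    rw [Polynomial.natDegree_X_pow_sub_C] at this
    have := s.hk3
    omega
  have hg : ∀ v : K, ∃ P : W.toAffine.Point, v ∈ S0.image f → P ∈ S0 ∧ f P = v := by
    intro v
    by_cases hv : v ∈ S0.image f
    · obtain ⟨P, hP⟩ := Finset.mem_image.mp hv
      exact ⟨P, fun _ => hP⟩
    · exact ⟨0, fun h => absurd h hv⟩
  choose g hg using hg
  have hl := lemM s.c s.d s.ld.c4 s.ld.d4 s.ρ s.ld.rho s.ld.bez ℓ hℓ hℓρ (S0.image f)
    (fun v n => (s.pr (2^n • g v)).1) (fun v n => (s.pr (2^n • g v)).2)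
    (fun v n => (s.pr_spec _).1)
    (fun v n => by
      have := s.pr_dbl (2^n • g v)
      rwa [← two_smul ℕ (2^n • g v), smul_smul, ← pow_succ'] at this)
    (fun v hv => by
      simp only [pow_zero, one_smul]
      exact ((s.pr_spec (g v)).2.2.1 (hE _ (hg v hv).1).1).1)
    (fun v hv v' hv' hne h => by
      simp only [pow_zero, one_smul] at h
      obtain ⟨a1, a2⟩ := (s.pr_spec (g v)).2.2.1 (hE _ (hg v hv).1).1
      obtain ⟨b1, b2⟩ := (s.pr_spec (g v')).2.2.1 (hE _ (hg v' hv').1).1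
      have e1 : Xc (s.τ (g v))^s.k = v := (hg v hv).2
      have e2 : Xc (s.τ (g v'))^s.k = v' := (hg v' hv').2
      rw [e1] at a2
      rw [e2] at b2
      have h' := congrArg (Int.cast (R := K)) h
      rw [Int.cast_mul, Int.cast_mul, ← a2, ← b2] at h'
      have a1' : ((s.pr (g v)).2 : K) ≠ 0 := by exact_mod_cast a1
      have b1' : ((s.pr (g v')).2 : K) ≠ 0 := by exact_mod_cast b1
      apply hne
      apply mul_right_cancel₀ (mul_ne_zero a1' b1')
      linear_combination h') t (3*(R+27*h0)) (by nlinarith)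
    (fun v hv => by
      have hq := hS _ (hE _ (hg v hv).1).2
      have h1 : (1:ℝ) ≤ 4^t := one_le_pow₀ (by norm_num)
      have hq0 : q (2^0 • g v) ≤ R := by
        simp only [pow_zero, one_smul]
        nlinarith [q1 (g v)]
      have hqt : q (2^t • g v) ≤ R := by
        rw [q_pow q2]; exact hq
      have r1 := s.pr_bound q3 _ hq0
      have r2 := s.pr_bound q3 _ hqt
      exact ⟨r1.1, r1.2, r2.1, r2.2⟩) hm
  have : (ℓ+1) * (4^t*4^t) ≤ ((10*κ)^2+1)*(4^t*4^t) := Nat.mul_le_mul_right _ (by omega)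
  omega

end base
end APR

set_option linter.unusedSectionVars false
set_option linter.unusedVariables false
set_option linter.unusedSimpArgs false
namespace APR
open WeierstrassCurve Height
open scoped TensorProduct

theorem HB.of {K : Type*} [Field K] [NumberField K] {β : ℝ} {x : K} (h : logHeight₁ x ≤ β) : HB β x 1 := by
  unfold HB; simpa using h

theorem int_height {K : Type*} [Field K] [NumberField K] (z : ℤ) (n : ℕ) (hn : 1 ≤ n) (h : |z| ≤ n) :
    logHeight₁ (z : K) ≤ totalWeight K * Real.log n := by
  have e : (z : K) = ((z : ℚ) : K) := by simp
  rw [e, logHeight₁_rat]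
  gcongr
  rw [Rat.logHeight₁_eq_log_max]
  simp only [Rat.num_intCast, Rat.den_intCast]
  apply Real.log_le_log
  · exact_mod_cast lt_of_lt_of_le one_pos (le_max_right _ _)
  · have h2 : z.natAbs ≤ n := by
      rw [Int.abs_eq_natAbs] at h
      exact_mod_cast h
    exact_mod_cast max_le h2 hn

theorem nat_height {K : Type*} [Field K] [NumberField K] (m : ℕ) (hm : 1 ≤ m) :
    logHeight₁ (m : K) = totalWeight K * Real.log m := by
  have e : (m : K) = ((m : ℚ) : K) := by simp
  rw [e, logHeight₁_rat]
  congr 1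
  rw [Rat.logHeight₁_eq_log_max]
  simp only [Rat.num_natCast, Rat.den_natCast]
  congr 2
  simp; omega

section blk
variable {W : WeierstrassCurve ℚ} {K : Type} [Field K] [NumberField K] [DecidableEq K]
    {A B : K} [(SW A B).IsElliptic] {h0 : ℝ}

/-- a block of an arithmetic progression -/
structure Blk (s : Setup W K A B h0) (n : ℕ) (P : ℕ → W.toAffine.Point) (e α b : K) (Λ : ℝ) : Prop where
  hn : 1 ≤ n
  hP : ∀ i < n, P i ≠ 0
  hne : ¬ (α = 0 ∧ b = 0)
  hr : ∀ i < n, α * Xc (s.τ (P i)) + b * Yc (s.τ (P i)) = e + i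
  he : logHeight₁ e ≤ totalWeight K * Λ
  hα : logHeight₁ α ≤ totalWeight K * Λ
  hb : logHeight₁ b ≤ totalWeight K * Λ
  hΛ : ∀ μ, logHeight₁ e ≤ μ → logHeight₁ α ≤ μ → logHeight₁ b ≤ μ → totalWeight K * Λ ≤ μ

theorem Blk.inj {s : Setup W K A B h0} {n : ℕ} {P : ℕ → W.toAffine.Point} {e α b : K} {Λ : ℝ}
    (H : Blk s n P e α b Λ) {i j : ℕ} (hi : i < n) (hj : j < n) (h : P i = P j) : i = j := by
  have h1 := H.hr i hi
  have h2 := H.hr j hj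
  rw [h, h2] at h1
  have := add_left_cancel h1
  exact_mod_cast this.symm

theorem Blk.F1 {s : Setup W K A B h0} {n : ℕ} {P : ℕ → W.toAffine.Point} {e α b : K} {Λ Λ' : ℝ}
    (H : Blk s n P e α b Λ) (h1 : Λ ≤ Λ') (h2 : 20*h0 + Real.log n + 1 ≤ Λ') (i : ℕ) (hi : i < n) :
    nh (s.τ (P i)) / totalWeight K ≤ 10000 * Λ' := by
  have hD := Dpos (K := K)
  have hh := s.h01
  have hln : 0 ≤ Real.log n := Real.log_natCast_nonneg n
  have hβ : (totalWeight K : ℝ) ≤ totalWeight K * Λ' := by nlinarith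
  have hle : totalWeight K * Λ ≤ totalWeight K * Λ' := by gcongr
  have hA : HB (totalWeight K * Λ') A 1 := .of (s.htA.trans (by gcongr; linarith))
  have hB : HB (totalWeight K * Λ') B 1 := .of (s.htB.trans (by gcongr; linarith))
  have hi1 : HB (totalWeight K * Λ') (i:K) 1 := .of (by
    have := int_height (K := K) i n H.hn (by rw [abs_of_nonneg (by positivity)]; exact_mod_cast hi.le)
    rw [Int.cast_natCast] at this
    exact this.trans (by gcongr; linarith))
  have := APR.F1 hβ hA hB (s.τ_ne (H.hP i hi)) ((HB.of (H.he.trans hle)).add hβ hi1) (.of (H.hα.trans hle)) (.of (H.hb.trans hle)) H.hne (H.hr i hi)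
  unfold HB at this
  rw [div_le_iff₀ hD]
  unfold nh
  push_cast at this
  linarith

theorem Blk.large {s : Setup W K A B h0} {n : ℕ} {P : ℕ → W.toAffine.Point} {e α b : K} {Λ : ℝ}
    (H : Blk s n P e α b Λ) {q : W.toAffine.Point → ℝ} (q1 : ∀ P, 0 ≤ q P)
    (q2 : ∀ P Q, q (P + Q) + q (P - Q) = 2 * (q P + q Q))
    (q3 : ∀ P, |q P - nh (s.τ P) / totalWeight K| ≤ 27 * h0)
    (hΛ : 10^18 * (20*h0 + Real.log n + 1) ≤ Λ)
    (hn : 43 * 5^(Module.finrank ℚ (ℚ ⊗[ℤ] W.toAffine.Point) * 37) ≤ n) : False := by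
  classical
  have hmw := s.mw
  have hfin : Module.Finite ℚ (ℚ ⊗[ℤ] W.toAffine.Point) := inferInstance
  have hD := Dpos (K := K)
  have hh := s.h01
  have hln : 0 ≤ Real.log n := Real.log_natCast_nonneg n
  have hΛ0 : 0 < Λ := by nlinarith
  have hdiff : ∀ i < n, ∀ j < n, logHeight₁ ((i:K) - j) ≤ totalWeight K * Real.log n := by
    intro i hi j hj
    have := int_height (K := K) ((i:ℤ) - j) n H.hn (by rw [abs_le]; omega)
    rw [Int.cast_sub, Int.cast_natCast, Int.cast_natCast] at this
    exact this
  have hsm : ∀ i < n, logHeight₁ (i:K) ≤ totalWeight K * Real.log n := by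
    intro i hi
    have := hdiff i hi 0 H.hn
    simpa using this
  let bad := (Finset.range n).filter (fun i => nh (s.τ (P i)) ≤ totalWeight K * (Λ/2000))
  have hbad : bad.card ≤ 3 := by
    by_contra hc
    push Not at hc
    obtain ⟨T, hT, hT4⟩ := Finset.exists_subset_card_eq (show 4 ≤ bad.card from hc)
    have hmem : ∀ a : Fin 4, T.orderEmbOfFin hT4 a < n ∧ nh (s.τ (P (T.orderEmbOfFin hT4 a))) ≤ totalWeight K * (Λ/2000) := by
      intro a
      have := hT (T.orderEmbOfFin_mem hT4 a)
      simp only [bad, Finset.mem_filter, Finset.mem_range] at this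
      exact this
    have hdist : ∀ a a' : Fin 4, a ≠ a' → s.τ (P (T.orderEmbOfFin hT4 a)) ≠ s.τ (P (T.orderEmbOfFin hT4 a')) := by
      intro a a' h h'
      exact h ((T.orderEmbOfFin hT4).injective (H.inj (hmem a).1 (hmem a').1 (s.τ_inj h')))
    have hβ : (totalWeight K : ℝ) ≤ totalWeight K * (Λ/2000) := by
      have : 1 ≤ Λ/2000 := by linarith
      nlinarith
    have hA : HB (totalWeight K * (Λ/2000)) A 1 := .of (s.htA.trans (by gcongr; linarith))
    have hB : HB (totalWeight K * (Λ/2000)) B 1 := .of (s.htB.trans (by gcongr; linarith))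
    have hi1 : ∀ a : Fin 4, HB (totalWeight K * (Λ/2000)) ((T.orderEmbOfFin hT4 a : ℕ):K) 1 := fun a =>
      .of ((hsm _ (hmem a).1).trans (by gcongr; linarith))
    obtain ⟨c1, c2, c3⟩ := F2 hβ hA hB (s.τ_ne (H.hP _ (hmem 0).1)) (s.τ_ne (H.hP _ (hmem 1).1)) (s.τ_ne (H.hP _ (hmem 2).1)) (s.τ_ne (H.hP _ (hmem 3).1))
      (hdist 0 1 (by decide)) (hdist 0 2 (by decide)) (hdist 0 3 (by decide)) (hdist 1 2 (by decide)) (hdist 1 3 (by decide)) (hdist 2 3 (by decide))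
      (.of (hmem 0).2) (.of (hmem 1).2) (.of (hmem 2).2) (.of (hmem 3).2)
      (H.hr _ (hmem 0).1) (H.hr _ (hmem 1).1) (H.hr _ (hmem 2).1) (H.hr _ (hmem 3).1)
      (hi1 0) (hi1 1) (hi1 2) (hi1 3)
    unfold HB at c1 c2 c3
    have := H.hΛ _ c1 c2 c3
    push_cast at this
    have : 0 < totalWeight K * Λ := by positivity
    linarith
  let S := (Finset.range n).filter (fun i => ¬ nh (s.τ (P i)) ≤ totalWeight K * (Λ/2000))
  have hcard : n ≤ 3 + S.card := by
    have := Finset.card_filter_add_card_filter_not (s := Finset.range n) (fun i => nh (s.τ (P i)) ≤ totalWeight K * (Λ/2000))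
    rw [Finset.card_range] at this
    simp only [bad] at hbad
    simp only [S]
    omega
  have hSn : ∀ i ∈ S, i < n ∧ totalWeight K * (Λ/2000) < nh (s.τ (P i)) := by
    intro i hi
    simp only [S, Finset.mem_filter, Finset.mem_range, not_le] at hi
    exact hi
  have h5 : 1 ≤ 5^(Module.finrank ℚ (ℚ ⊗[ℤ] W.toAffine.Point) * 37) := Nat.one_le_pow _ _ (by norm_num)
  obtain ⟨S', hS', -, hS'c, hS'q⟩ := packing_q q1 q2 S (Finset.card_pos.mp (by omega)) P (R := 10001*Λ) (by positivity) (by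
    intro i hi
    have h1 := H.F1 (Λ' := Λ) le_rfl (by linarith) i (hSn i hi).1
    have h2 := (abs_le.mp (q3 (P i))).2
    linarith) 37
  have hS'40 : 40 ≤ S'.card := by
    by_contra hc
    push Not at hc
    have : 5^(Module.finrank ℚ (ℚ ⊗[ℤ] W.toAffine.Point) * 37) * S'.card ≤ 5^(Module.finrank ℚ (ℚ ⊗[ℤ] W.toAffine.Point) * 37) * 39 :=
      Nat.mul_le_mul_left _ (by omega)
    omega
  have hβ : (totalWeight K : ℝ) ≤ totalWeight K * (Λ/10^17) := by
    have : 1 ≤ Λ/10^17 := by linarith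
    nlinarith
  have hA : HB (totalWeight K * (Λ/10^17)) A 1 := .of (s.htA.trans (by gcongr; linarith))
  have hB : HB (totalWeight K * (Λ/10^17)) B 1 := .of (s.htB.trans (by gcongr; linarith))
  obtain ⟨i, hi, hiH⟩ := F4 hβ hA hB inferInstance S' (fun i => s.τ (P i))
    (fun i hi j hj h => H.inj (hSn i (hS' hi)).1 (hSn j (hS' hj)).1 (s.τ_inj h))
    (fun i hi => s.τ_ne (H.hP i (hSn i (hS' hi)).1)) e α b (fun i hi => H.hr i (hSn i (hS' hi)).1)
    (fun i hi j hj => by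
      apply HB.of
      have h1 := hS'q i hi j hj
      have h2 := (abs_le.mp (q3 (P i - P j))).1
      have h3 : nh (s.τ (P i - P j)) / totalWeight K ≤ Λ/10^17 := by
        have : 4 * (10001*Λ)/4^37 ≤ Λ/(2*10^17) := by
          rw [div_le_div_iff₀ (by positivity) (by positivity)]
          norm_num
          linarith
        linarith
      rw [div_le_iff₀ hD, map_sub] at h3
      unfold nh at h3
      linarith)
    (fun i hi j hj => .of ((hdiff i (hSn i (hS' hi)).1 j (hSn j (hS' hj)).1).trans (by gcongr; linarith)))
    hS'40
  unfold HB at hiH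
  have h1 := (hSn i (hS' hi)).2
  unfold nh at h1
  push_cast at hiH
  have : 0 < totalWeight K * Λ := by positivity
  linarith

theorem Blk.small {s : Setup W K A B h0} {n : ℕ} {P : ℕ → W.toAffine.Point} {e α b : K} {Λ : ℝ}
    (H : Blk s n P e α b Λ) {q : W.toAffine.Point → ℝ} (q1 : ∀ P, 0 ≤ q P)
    (q2 : ∀ P Q, q (P + Q) + q (P - Q) = 2 * (q P + q Q))
    (q3 : ∀ P, |q P - nh (s.τ P) / totalWeight K| ≤ 27 * h0)
    (hΛ : Λ ≤ 42*10^18*h0) (hln : Real.log n ≤ 21 * h0) (t : ℕ) (ht : 4*10^24*h0 ≤ 4^t) :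
    n ≤ 5^(Module.finrank ℚ (ℚ ⊗[ℤ] W.toAffine.Point) * (2*t)) * (7*256^t) := by
  classical
  have hmw := s.mw
  have hfin : Module.Finite ℚ (ℚ ⊗[ℤ] W.toAffine.Point) := inferInstance
  have hh := s.h01
  have hlarge := H.hn
  obtain ⟨S', hS', hne, hS'c, hS'q⟩ := packing_q q1 q2 (Finset.range n) (Finset.card_pos.mp (by rw [Finset.card_range]; omega)) P
    (R := 10^24*h0) (by positivity) (by
    intro i hi
    have h1 := H.F1 (Λ' := 42*10^18*h0) hΛ (by linarith) i (Finset.mem_range.mp hi)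
    have h2 := (abs_le.mp (q3 (P i))).2
    linarith) (2*t)
  rw [Finset.card_range] at hS'c
  refine hS'c.trans (Nat.mul_le_mul_left _ ?_)
  obtain ⟨j, hj⟩ := hne
  have hcd : (S'.image (fun i => P i - P j)).card = S'.card := by
    apply Finset.card_image_of_injOn
    intro i hi k hk h
    simp only [sub_left_inj] at h
    exact H.inj (Finset.mem_range.mp (hS' hi)) (Finset.mem_range.mp (hS' hk)) h
  have hκ : 80*h0 ≤ (⌈80*h0⌉₊ : ℝ) := Nat.le_ceil _
  have hκ2 : (⌈80*h0⌉₊ : ℝ) ≤ 81*h0 := (Nat.ceil_lt_add_one (by positivity)).le.trans (by linarith)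
  have h4 : (0:ℝ) < 4^t := by positivity
  have key := s.count q1 q2 q3 (S'.image (fun i => P i - P j)) t 1 (by norm_num) (by
    intro T hT
    obtain ⟨i, hi, rfl⟩ := Finset.mem_image.mp hT
    have := hS'q i hi j hj
    rw [show 2*t = t + t by ring, pow_add] at this
    calc (4:ℝ)^t * q (P i - P j) ≤ 4^t * (4*(10^24*h0)/(4^t*4^t)) := by gcongr
      _ = (4*10^24*h0)/4^t := by field_simp
      _ ≤ 1 := by rw [div_le_one h4]; exact ht) (by nlinarith) ⌈80*h0⌉₊ hκ
  rw [hcd] at key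
  generalize ⌈80*h0⌉₊ = κ at *
  have hk : 10*κ+1 ≤ 4^t := by
    have : ((10*κ+1 : ℕ) : ℝ) ≤ ((4^t : ℕ) : ℝ) := by
      push_cast; linarith
    exact_mod_cast this
  have h256 : 256^t = 4^t*4^t*(4^t*4^t) := by
    rw [← mul_pow, ← mul_pow]; norm_num
  have hk2 : (10*κ)^2+1 ≤ 4^t*4^t := by nlinarith
  have : ((10*κ)^2+1)*(4^t*4^t) ≤ 256^t := by
    rw [h256]; exact Nat.mul_le_mul_right _ hk2
  have : 1 ≤ 256^t := Nat.one_le_pow _ _ (by norm_num)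
  omega

theorem core (s : Setup W K A B h0) (N : ℕ) (P : ℕ → W.toAffine.Point) (e α b : K) (hP : ∀ i < N, P i ≠ 0)
    (hne : ¬ (α = 0 ∧ b = 0)) (hr : ∀ i < N, α * Xc (s.τ (P i)) + b * Yc (s.τ (P i)) = e + i)
    (t : ℕ) (ht37 : 37 ≤ t) (ht : 4*10^24*h0 ≤ 4^t) (n : ℕ)
    (hn : n = 8*256^t * 5^(Module.finrank ℚ (ℚ ⊗[ℤ] W.toAffine.Point) * (2*t)))
    (hN : 5*10^18 * Real.log n ≤ Real.log N) : False := by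
  obtain ⟨q, q1, q2, q3⟩ := s.exists_q
  have hD := Dpos (K := K)
  have hh := s.h01
  have h51 : 1 ≤ 5^(Module.finrank ℚ (ℚ ⊗[ℤ] W.toAffine.Point) * (2*t)) := Nat.one_le_pow _ _ (by norm_num)
  have h2561 : 256 ≤ 256^t := Nat.le_self_pow (by omega) _
  have hn8 : 2048 ≤ n := by rw [hn]; nlinarith
  have hln1 : 1 ≤ Real.log n := by
    rw [Real.le_log_iff_exp_le (by positivity)]
    have : (2048:ℝ) ≤ n := by exact_mod_cast hn8
    linarith [Real.exp_one_lt_d9]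
  have hln2 := log2_le_one
  have hNpos : 1 ≤ N := by
    rcases Nat.eq_zero_or_pos N with h | h
    · subst h; simp at hN; linarith
    · exact h
  have hnN : 2 * n ≤ N := by
    have : Real.log ((2*n : ℕ):ℝ) ≤ Real.log N := by
      push_cast
      rw [Real.log_mul (by norm_num) (by positivity)]
      linarith
    rw [Real.log_le_log_iff (by positivity) (by positivity)] at this
    exact_mod_cast this
  have hM : Real.log N - Real.log 2 ≤ Real.log ((N - n : ℕ):ℝ) := by
    rw [← Real.log_div (by positivity) (by norm_num)]
    apply Real.log_le_log (by positivity)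
    rw [div_le_iff₀ (by norm_num)]
    have : N ≤ (N-n)*2 := by omega
    exact_mod_cast this
  obtain ⟨m, hm, hem⟩ : ∃ m, m + n ≤ N ∧ totalWeight K * (2*10^18 * Real.log n) ≤ logHeight₁ (e + (m:K)) := by
    by_contra hc
    push Not at hc
    have c0 := hc 0 (by omega)
    have c1 := hc (N-n) (by omega)
    have h1 := logHeight₁_sub_le (e + ((N-n:ℕ):K)) (e + ((0:ℕ):K))
    rw [add_sub_add_left_eq_sub, Nat.cast_zero, sub_zero, nat_height _ (by omega)] at h1
    rw [Nat.cast_zero] at c0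
    have : totalWeight K * (5*10^18 * Real.log n - 2) ≤ totalWeight K * Real.log ((N-n:ℕ):ℝ) - totalWeight K * Real.log 2 := by
      rw [← mul_sub]
      exact mul_le_mul_of_nonneg_left (by linarith) hD.le
    have h3 : (totalWeight K : ℝ) * 1 ≤ totalWeight K * Real.log n := mul_le_mul_of_nonneg_left hln1 hD.le
    linarith
  obtain ⟨Λ, H⟩ : ∃ Λ, Blk s n (fun i => P (m+i)) (e+(m:K)) α b Λ := by
    refine ⟨(max (logHeight₁ (e+(m:K))) (max (logHeight₁ α) (logHeight₁ b))) / totalWeight K, by omega, fun i hi => hP _ (by omega), hne, ?_, ?_, ?_, ?_, ?_⟩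
    · intro i hi
      rw [hr (m+i) (by omega)]; push_cast; ring
    · rw [mul_div_cancel₀ _ hD.ne']; exact le_max_left _ _
    · rw [mul_div_cancel₀ _ hD.ne']; exact (le_max_left _ _).trans (le_max_right _ _)
    · rw [mul_div_cancel₀ _ hD.ne']; exact (le_max_right _ _).trans (le_max_right _ _)
    · intro μ h1 h2 h3
      rw [mul_div_cancel₀ _ hD.ne']
      exact max_le h1 (max_le h2 h3)
  have hΛ1 : 2*10^18 * Real.log n ≤ Λ := le_of_mul_le_mul_left (hem.trans H.he) hD
  by_cases hΛ : 10^18 * (20*h0 + Real.log n + 1) ≤ Λ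
  · refine H.large q1 q2 q3 hΛ ?_
    rw [hn]
    have : 5^(Module.finrank ℚ (ℚ ⊗[ℤ] W.toAffine.Point) * 37) ≤ 5^(Module.finrank ℚ (ℚ ⊗[ℤ] W.toAffine.Point) * (2*t)) :=
      Nat.pow_le_pow_right (by norm_num) (Nat.mul_le_mul_left _ (by omega))
    exact Nat.mul_le_mul (by omega) this
  · push Not at hΛ
    have := H.small q1 q2 q3 (by linarith) (by linarith) t ht
    rw [hn, mul_comm] at this
    have := Nat.le_of_mul_le_mul_left this h51
    omega

end blk
end APR

set_option linter.unusedSectionVars false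
set_option linter.unusedVariables false
set_option linter.unusedSimpArgs false
namespace APR
open WeierstrassCurve Height
open scoped TensorProduct

theorem Setup.rel {W : WeierstrassCurve ℚ} {K : Type} [Field K] [NumberField K] [DecidableEq K]
    {A B : K} [(SW A B).IsElliptic] {h0 : ℝ} (s : Setup W K A B h0) (N : ℕ) (x y : Fin N → ℚ)
    (hns : ∀ i, W.toAffine.Nonsingular (x i) (y i))
    (hap : (∃ a b : ℚ, b ≠ 0 ∧ ∀ i : Fin N, x i = a + (((i : ℕ) + 1 : ℕ) : ℚ) * b) ∨
      (∃ a b : ℚ, b ≠ 0 ∧ ∀ i : Fin N, y i = a + (((i : ℕ) + 1 : ℕ) : ℚ) * b)) :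
    ∃ (P : ℕ → W.toAffine.Point) (e α b : K), (∀ i < N, P i ≠ 0) ∧ ¬ (α = 0 ∧ b = 0) ∧
      ∀ i < N, α * Xc (s.τ (P i)) + b * Yc (s.τ (P i)) = e + i := by
  have hu := s.hu
  let P : ℕ → W.toAffine.Point := fun i => if h : i < N then .some _ _ (hns ⟨i, h⟩) else 0
  have hPe : ∀ i (h : i < N), P i = .some _ _ (hns ⟨i, h⟩) := fun i h => by simp only [P, dif_pos h]
  have hX : ∀ i (h : i < N), Xc (s.τ (P i)) = ((x ⟨i,h⟩ + W.b₂/12 : ℚ):K) / s.u^2 := fun i h => by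
    rw [hPe i h]
    exact Xc_tr s.hu s.hA s.hB (hns ⟨i, h⟩)
  have hY : ∀ i (h : i < N), Yc (s.τ (P i)) = ((y ⟨i,h⟩ + (W.a₁*x ⟨i,h⟩+W.a₃)/2 : ℚ):K) / s.u^3 := fun i h => by
    rw [hPe i h]
    exact Yc_tr s.hu s.hA s.hB (hns ⟨i, h⟩)
  have hP0 : ∀ i < N, P i ≠ 0 := fun i h => by
    rw [hPe i h]; exact Affine.Point.some_ne_zero _
  rcases hap with ⟨a, b, hb, h⟩ | ⟨a, b, hb, h⟩
  · have hb' : (b:K) ≠ 0 := by exact_mod_cast hb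
    refine ⟨P, ((a + W.b₂/12 : ℚ):K)/b + 1, s.u^2/b, 0, hP0, ?_, ?_⟩
    · rintro ⟨h1, -⟩
      exact div_ne_zero (pow_ne_zero _ hu) hb' h1
    · intro i hi
      rw [hX i hi, h ⟨i, hi⟩]
      push_cast
      field_simp
      ring
  · have hb' : (b:K) ≠ 0 := by exact_mod_cast hb
    refine ⟨P, ((a + W.a₃/2 - W.a₁/2*(W.b₂/12) : ℚ):K)/b + 1, -((W.a₁/2 : ℚ):K)*s.u^2/b, s.u^3/b, hP0, ?_, ?_⟩
    · rintro ⟨-, h1⟩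
      exact div_ne_zero (pow_ne_zero _ hu) hb' h1
    · intro i hi
      rw [hX i hi, hY i hi, h ⟨i, hi⟩]
      push_cast
      field_simp
      ring

theorem final (W : WeierstrassCurve ℚ) [W.IsElliptic] (h0 : ℝ)
    (hh0 : h0 = 1 + Real.log (max W.j.num.natAbs W.j.den : ℕ)) (N : ℕ) (x y : Fin N → ℚ)
    (hns : ∀ i, W.toAffine.Nonsingular (x i) (y i))
    (hap : (∃ a b : ℚ, b ≠ 0 ∧ ∀ i : Fin N, x i = a + (((i : ℕ) + 1 : ℕ) : ℚ) * b) ∨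
      (∃ a b : ℚ, b ≠ 0 ∧ ∀ i : Fin N, y i = a + (((i : ℕ) + 1 : ℕ) : ℚ) * b)) :
    Real.log N ≤ 45*10^18 * (42 + Real.log h0) * (1 + (Module.finrank ℚ (ℚ ⊗[ℤ] W.toAffine.Point) : ℝ)) := by
  obtain ⟨K, _, _, _, A, B, _, ⟨s⟩⟩ := exists_setup W h0 hh0
  obtain ⟨P, e, α, b, hP, hne, hr⟩ := s.rel N x y hns hap
  have hh := s.h01
  by_contra hcon
  push Not at hcon
  have hl0 : 0 ≤ Real.log h0 := Real.log_nonneg hh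
  set r := Module.finrank ℚ (ℚ ⊗[ℤ] W.toAffine.Point) with hrdef
  obtain ⟨m, hm⟩ : ∃ m, m = ⌈Real.log h0⌉₊ := ⟨_, rfl⟩
  have hm1 : Real.log h0 ≤ m := hm ▸ Nat.le_ceil _
  have hm2 : (m:ℝ) ≤ Real.log h0 + 1 := hm ▸ (Nat.ceil_lt_add_one hl0).le
  have h4m : h0 ≤ 4^m := by
    have h1 : h0 ≤ Real.exp m := by
      rw [← Real.log_le_iff_le_exp (by linarith)]; exact hm1
    have h2 : Real.exp m = (Real.exp 1)^m := by
      rw [← Real.exp_nat_mul, mul_one]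
    rw [h2] at h1
    refine h1.trans ?_
    gcongr
    linarith [Real.exp_one_lt_d9]
  refine core s N P e α b hP hne hr (m+41) (by omega) ?_ _ rfl ?_
  · rw [pow_add]
    have : (4:ℝ)*10^24 ≤ 4^41 := by norm_num
    nlinarith
  · refine le_trans ?_ hcon.le
    have e1 : Real.log ((8*256^(m+41)*5^(r*(2*(m+41))) : ℕ) : ℝ) = 3*Real.log 2 + (m+41)*(8*Real.log 2) + r*(2*(m+41))*Real.log 5 := by
      push_cast
      rw [Real.log_mul (by positivity) (by positivity), Real.log_mul (by positivity) (by positivity), Real.log_pow, Real.log_pow,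
        show (8:ℝ) = 2^3 by norm_num, show (256:ℝ) = 2^8 by norm_num, Real.log_pow, Real.log_pow]
      push_cast; ring
    rw [e1]
    have l2 := Real.log_two_lt_d9
    have l2' := Real.log_two_gt_d9
    have l5 : Real.log 5 ≤ 3 * Real.log 2 := by
      rw [show 3 * Real.log 2 = Real.log (2^3) by rw [Real.log_pow]; norm_num]
      apply Real.log_le_log <;> norm_num
    have hm0 : (0:ℝ) ≤ m := by positivity
    have hr0 : (0:ℝ) ≤ r := by positivity
    have a1 : (m+41:ℝ)*(8*Real.log 2) ≤ (m+41)*6 := by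
      apply mul_le_mul_of_nonneg_left _ (by linarith); linarith
    have a2 : (r:ℝ)*(2*(m+41))*Real.log 5 ≤ r*(2*(m+41))*3 := by
      apply mul_le_mul_of_nonneg_left _ (by positivity); linarith
    have a3 : 3*Real.log 2 + (m+41)*(8*Real.log 2) + r*(2*(m+41))*Real.log 5 ≤ 9*((m+41)*(1+r)) := by
      have : 0 ≤ (m:ℝ)*r := by positivity
      nlinarith
    have a4 : (m+41:ℝ)*(1+r) ≤ (42+Real.log h0)*(1+r) := by
      apply mul_le_mul_of_nonneg_right _ (by positivity); linarith
    nlinarith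

end APR

/-- The explicit constant `c(j₀)` is admissible in the rank bound: for every elliptic curve
`E/ℚ` with `j`-invariant `j₀`, any non-trivial arithmetic progression of length `N ≥ 1` in the
`x`-coordinates (or `y`-coordinates) of rational points forces
`1 + rank E(ℚ) ≥ c(j₀) · log N`. -/
theorem rank_ge_of_arithmetic_progression_explicit (j₀ : ℚ) :
    ∀ (W : WeierstrassCurve ℚ) [W.IsElliptic], W.j = j₀ →
      ∀ (N : ℕ), 1 ≤ N →
        ∀ x y : Fin N → ℚ,
          (∀ i, W.toAffine.Nonsingular (x i) (y i)) →
          (IsNontrivAP x ∨ IsNontrivAP y) →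
          1 + (grpRank W.toAffine.Point : ℝ) ≥ cConst j₀ * Real.log N := by
  intro W _ hj N hN x y hns hap
  have hap' : (∃ a b : ℚ, b ≠ 0 ∧ ∀ i : Fin N, x i = a + (((i : ℕ) + 1 : ℕ) : ℚ) * b) ∨
      (∃ a b : ℚ, b ≠ 0 ∧ ∀ i : Fin N, y i = a + (((i : ℕ) + 1 : ℕ) : ℚ) * b) := hap
  have hH : ((max W.j.num.natAbs W.j.den : ℕ) : ℝ) = naiveHeight j₀ := by
    rw [hj, naiveHeight, Nat.cast_max]
    congr 1
    exact_mod_cast Nat.cast_natAbs (α := ℝ) j₀.num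
  have key := APR.final W (1 + Real.log (naiveHeight j₀)) (by rw [hH]) N x y hns hap'
  have hH1 : 1 ≤ naiveHeight j₀ := by
    rw [← hH]
    exact_mod_cast le_max_of_le_right W.j.den_pos
  have hl : 0 ≤ Real.log (naiveHeight j₀) := Real.log_nonneg hH1
  have hl2 : 0 ≤ Real.log (1 + Real.log (naiveHeight j₀)) := Real.log_nonneg (by linarith)
  unfold cConst
  have hr : (grpRank W.toAffine.Point : ℝ) = (Module.finrank ℚ (ℚ ⊗[ℤ] W.toAffine.Point) : ℝ) := rfl
  rw [← hr] at key
  have hr0 : (0:ℝ) ≤ grpRank W.toAffine.Point := by positivity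
  have hmax := le_max_left (Real.log (1 + Real.log (naiveHeight j₀)))
    (255 + Real.log (2 + Real.log (1 + Real.log (naiveHeight j₀))))
  generalize max (Real.log (1 + Real.log (naiveHeight j₀)))
    (255 + Real.log (2 + Real.log (1 + Real.log (naiveHeight j₀)))) = m at *
  generalize Real.log (1 + Real.log (naiveHeight j₀)) = l at *
  generalize (grpRank W.toAffine.Point : ℝ) = r at *
  have hpos : 0 < (80:ℝ)^46 * (209 + m) := by
    have : 0 < 209 + m := by linarith
    positivity
  rw [ge_iff_le, one_div, inv_mul_le_iff₀ hpos]
  refine key.trans ?_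
  apply mul_le_mul_of_nonneg_right _ (by linarith)
  have : (45*10^18 : ℝ) ≤ 80^46 := by norm_num
  apply mul_le_mul this (by linarith) (by linarith) (by positivity)
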